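/- arXiv:1709.02266 — 4 statements merged into one kernel-verified Lean document; each statement's English description precedes it below -/
import Mathlib

section
/- Let a<b and p1*,p2* ∈ (0,1) with p1* ≥ p2* and p1*+p2* ≤ 1, so that the measure μ_{a,b,p1*,p2*} has no atoms. Define Q: (a,b) → ℝ by Q(t) = −((p1*/p2*)−1) log(t−a) − ((1−p1*−p2*)/p2*) log(b−t). Then μ_{a,b,p1*,p2*} is the unique Borel probability measure on [a,b] minimizing the energy functional ν ↦ ∫_a^b Q(t) dν(t) − ∫_a^b ∫_a^b log|t−s| dν(t) dν(s) (with values in (−∞,+∞]) over all Borel probability measures ν on [a,b]. -/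
open MeasureTheory Real Filter Topology Polynomial
open scoped ENNReal NNReal

noncomputable section
/-- `l₋` for the measure `μ_{a,b,p1,p2}`. -/
def lmin (a b p1 p2 : ℝ) : ℝ :=
  a + (b - a) * (Real.sqrt (p1 * (1 - p2)) - Real.sqrt (p2 * (1 - p1))) ^ 2

/-- `l₊` for the measure `μ_{a,b,p1,p2}`. -/
def lmax (a b p1 p2 : ℝ) : ℝ :=
  a + (b - a) * (Real.sqrt (p1 * (1 - p2)) + Real.sqrt (p2 * (1 - p1))) ^ 2

/-- Density of the absolutely continuous part of `μ_{a,b,p1,p2}`. -/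
def compactDensity (a b p1 p2 : ℝ) (x : ℝ) : ℝ :=
  if x ∈ Set.Icc (lmin a b p1 p2) (lmax a b p1 p2) then
    Real.sqrt ((x - lmin a b p1 p2) * (lmax a b p1 p2 - x)) /
      (2 * π * p2 * (x - a) * (b - x))
  else 0

/-- The measure `μ_{a,b,p1,p2}` (free binomial / Kesten-McKay measure). -/
def muCompact (a b p1 p2 : ℝ) : Measure ℝ :=
  volume.withDensity (fun x => ENNReal.ofReal (compactDensity a b p1 p2 x))
    + ENNReal.ofReal (max (1 - p1 / p2) 0) • Measure.dirac a
    + ENNReal.ofReal (max ((p1 + p2 - 1) / p2) 0) • Measure.dirac b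

/-- The external field `Q(t) = -(p1/p2 - 1) log(t-a) - ((1-p1-p2)/p2) log(b-t)`, extended to
`[a,b]` with value `+∞` (encoded below) at an endpoint whose logarithmic coefficient is
nonzero; shifted by the constant `cq` to make it nonnegative and `ℝ≥0∞`-valued. Points
outside `[a,b]` are irrelevant (all competing measures live on `[a,b]`). -/
def fieldQ (a b p1 p2 cq : ℝ) (t : ℝ) : ℝ≥0∞ :=
  if t ∈ Set.Ioo a b then
    ENNReal.ofReal (-((p1 / p2 - 1) * Real.log (t - a))
      - (1 - p1 - p2) / p2 * Real.log (b - t) + cq)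
  else if t = a then
    (if p1 / p2 - 1 = 0 then
      ENNReal.ofReal (-((1 - p1 - p2) / p2 * Real.log (b - a)) + cq) else ⊤)
  else if t = b then
    (if (1 - p1 - p2) / p2 = 0 then
      ENNReal.ofReal (-((p1 / p2 - 1) * Real.log (b - a)) + cq) else ⊤)
  else 0

/-- The logarithmic kernel `-log |t-s|`, extended by `+∞` on the diagonal and shifted by the
constant `cl` to make it nonnegative and `ℝ≥0∞`-valued on `[a,b]²`. -/
def logKernel (cl : ℝ) (p : ℝ × ℝ) : ℝ≥0∞ :=
  if p.1 = p.2 then ⊤ else ENNReal.ofReal (-Real.log |p.1 - p.2| + cl)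

/-- The weighted logarithmic energy `ν ↦ ∫ Q dν - ∬ log|t-s| dν(t) dν(s)`, with values in
`(-∞, +∞]` (as an `EReal`); the shifts `cq = (c₁+c₂)|log(b-a)|` and `cl = |log(b-a)|`
make both integrands pointwise nonnegative on `[a,b]` and are subtracted again, so that for
probability measures on `[a,b]` this is exactly the energy functional of the statement. -/
def energy (a b p1 p2 : ℝ) (ν : Measure ℝ) : EReal :=
  ((∫⁻ t, fieldQ a b p1 p2
      ((p1 / p2 - 1 + (1 - p1 - p2) / p2) * |Real.log (b - a)|) t ∂ν : ℝ≥0∞) : EReal)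
  + ((∫⁻ p, logKernel (|Real.log (b - a)|) p ∂(ν.prod ν) : ℝ≥0∞) : EReal)
  - (((p1 / p2 - 1 + (1 - p1 - p2) / p2) * |Real.log (b - a)| + |Real.log (b - a)| : ℝ) : EReal)

/-- The Poisson kernel of the unit disc at a real point `α`, as a function of the angle. -/
def realPoisson (α θ : ℝ) : ℝ := (1 - α ^ 2) / (1 - 2 * α * cos θ + α ^ 2)

lemma realPoisson_denom_pos {α : ℝ} (hα : |α| < 1) (θ : ℝ) :
    0 < 1 - 2 * α * cos θ + α ^ 2 := by
  have h1 := abs_lt.1 hα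
  rcases le_total 0 α with h | h
  · nlinarith [mul_nonneg h (sub_nonneg.2 (cos_le_one θ)), sq_pos_of_pos (sub_pos.2 h1.2)]
  · nlinarith [mul_nonneg (neg_nonneg.2 h) (neg_le_iff_add_nonneg.1 (neg_one_le_cos θ)),
      sq_pos_of_pos (neg_lt_iff_pos_add.1 h1.1)]

lemma continuous_realPoisson {α : ℝ} (hα : |α| < 1) : Continuous (realPoisson α) := by
  unfold realPoisson
  exact continuous_const.div (by fun_prop) fun θ ↦ (realPoisson_denom_pos hα θ).ne'

lemma normSq_circleMap_sub (α θ : ℝ) :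
    ‖circleMap 0 1 θ - (α : ℂ)‖ ^ 2 = 1 - 2 * α * cos θ + α ^ 2 := by
  rw [← Complex.normSq_eq_norm_sq, Complex.normSq_apply]
  simp [circleMap, Complex.exp_ofReal_mul_I_re, Complex.exp_ofReal_mul_I_im]
  nlinarith [sin_sq_add_cos_sq θ]

lemma re_herglotzRieszKernel_circleMap (α θ : ℝ) :
    (herglotzRieszKernel 0 (α : ℂ) (circleMap 0 1 θ)).re = realPoisson α θ := by
  have := congrFun (poissonKernel_eq_re_herglotzRieszKernel (c := 0) (w := α)) (circleMap 0 1 θ)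
  rw [Function.comp_apply] at this
  rw [← this, poissonKernel_def, realPoisson, sub_zero, sub_zero, normSq_circleMap_sub]
  simp

lemma integral_zero_two_pi_eq_of_symm {f : ℝ → ℝ} (hf : IntervalIntegrable f volume 0 (2 * π))
    (hsymm : ∀ θ, f (2 * π - θ) = f θ) : ∫ θ in 0..2 * π, f θ = 2 * ∫ θ in 0..π, f θ := by
  have h1 : IntervalIntegrable f volume 0 π :=
    hf.mono_set (Set.uIcc_subset_uIcc_left (by
      rw [Set.mem_uIcc]; left; constructor <;> linarith [pi_pos]))
  have h2 : IntervalIntegrable f volume π (2 * π) :=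
    hf.mono_set (Set.uIcc_subset_uIcc_right (by
      rw [Set.mem_uIcc]; left; constructor <;> linarith [pi_pos]))
  rw [← intervalIntegral.integral_add_adjacent_intervals h1 h2]
  have := intervalIntegral.integral_comp_sub_left f (2 * π) (a := 0) (b := π)
  simp only [hsymm, sub_zero, show 2 * π - π = π by ring] at this
  rw [← this]; ring

lemma realPoisson_symm (α θ : ℝ) : realPoisson α (2 * π - θ) = realPoisson α θ := by
  simp [realPoisson, cos_two_pi_sub]

lemma intervalIntegral_realPoisson {α : ℝ} (hα : |α| < 1) :
    ∫ θ in 0..π, realPoisson α θ = π := by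
  have hw : (α : ℂ) ∈ Metric.ball (0 : ℂ) 1 := by simpa using hα
  have h := InnerProductSpace.HarmonicContOnCl.circleAverage_re_herglotzRieszKernel_smul
    (f := fun _ ↦ 1) (InnerProductSpace.harmonicContOnCl_const) hw
  rw [circleAverage_def] at h
  simp only [Pi.smul_apply', Function.comp_apply, re_herglotzRieszKernel_circleMap, smul_eq_mul,
    mul_one] at h
  rw [integral_zero_two_pi_eq_of_symm ((continuous_realPoisson hα).intervalIntegrable _ _)
    (realPoisson_symm α)] at h
  field_simp at h
  linarith

lemma normSq_circleMap_sub_circleMap (θ φ : ℝ) :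
    ‖circleMap 0 1 θ - circleMap 0 1 φ‖ ^ 2 = 2 - 2 * cos θ * cos φ - 2 * sin θ * sin φ := by
  rw [← Complex.normSq_eq_norm_sq, Complex.normSq_apply]
  simp [circleMap, Complex.exp_ofReal_mul_I_re, Complex.exp_ofReal_mul_I_im]
  linear_combination sin_sq_add_cos_sq θ + sin_sq_add_cos_sq φ

lemma log_norm_circleMap_sub_add {θ φ : ℝ} (h : cos θ ≠ cos φ) :
    log ‖circleMap 0 1 θ - circleMap 0 1 φ‖ + log ‖circleMap 0 1 θ - circleMap 0 1 (-φ)‖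
      = log 2 + log |cos θ - cos φ| := by
  have key : ‖circleMap 0 1 θ - circleMap 0 1 φ‖ * ‖circleMap 0 1 θ - circleMap 0 1 (-φ)‖
      = 2 * |cos θ - cos φ| := by
    have h1 : sin θ ^ 2 = 1 - cos θ ^ 2 := by rw [← sin_sq_add_cos_sq θ]; ring
    have h2 : sin φ ^ 2 = 1 - cos φ ^ 2 := by rw [← sin_sq_add_cos_sq φ]; ring
    have hX := normSq_circleMap_sub_circleMap θ φ
    have hY := normSq_circleMap_sub_circleMap θ (-φ)
    rw [cos_neg, sin_neg] at hY
    rw [← sq_eq_sq₀ (by positivity) (by positivity), mul_pow, mul_pow, sq_abs, hX, hY]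
    linear_combination (-4) * sin φ ^ 2 * h1 - 4 * (1 - cos θ ^ 2) * h2
  have hpos : 0 < 2 * |cos θ - cos φ| := by
    have := abs_pos.2 (sub_ne_zero.2 h); positivity
  rw [← key] at hpos
  rw [← log_mul (left_ne_zero_of_mul hpos.ne') (right_ne_zero_of_mul hpos.ne'), key,
    log_mul two_ne_zero (abs_pos.2 (sub_ne_zero.2 h)).ne']

lemma ae_cos_ne (φ : ℝ) : ∀ᵐ θ : ℝ, cos θ ≠ cos φ := by
  have : {θ : ℝ | cos θ = cos φ} ⊆
      (Set.range fun k : ℤ ↦ 2 * k * π + φ) ∪ Set.range fun k : ℤ ↦ 2 * k * π - φ := by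
    intro θ hθ
    obtain ⟨k, hk⟩ := (cos_eq_cos_iff (x := φ) (y := θ)).1 (Eq.symm hθ)
    rcases hk with hk | hk
    · exact Or.inl ⟨k, hk.symm⟩
    · exact Or.inr ⟨k, hk.symm⟩
  have hc := ((Set.countable_range fun k : ℤ ↦ 2 * k * π + φ).union
    (Set.countable_range fun k : ℤ ↦ 2 * k * π - φ)).mono this
  exact compl_mem_ae_iff.2 (hc.measure_zero volume)

lemma intervalIntegrable_realPoisson_mul_log_norm {α : ℝ} (hα : |α| < 1) (φ : ℝ) :
    IntervalIntegrable
      (fun θ ↦ realPoisson α θ * log ‖circleMap 0 1 θ - circleMap 0 1 φ‖) volume 0 (2 * π) :=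
  IntervalIntegrable.continuousOn_mul
    (circleIntegrable_log_norm_sub_const (a := circleMap 0 1 φ) (c := 0) 1)
    (continuous_realPoisson hα).continuousOn

lemma integral_realPoisson_mul_log_norm {α : ℝ} (hα : |α| < 1) (φ : ℝ) :
    ∫ θ in 0..2 * π, realPoisson α θ * log ‖circleMap 0 1 θ - circleMap 0 1 φ‖
      = π * log (1 - 2 * α * cos φ + α ^ 2) := by
  have hw : (α : ℂ) ∈ Metric.ball (0 : ℂ) 1 := by simpa using hα
  have h := circleAverage_re_herglotzRieszKernel_mul_log₀ (ρ := circleMap 0 1 φ) (by simp) hw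
  rw [circleAverage_def] at h
  simp only [Pi.smul_apply', Function.comp_apply, re_herglotzRieszKernel_circleMap,
    smul_eq_mul] at h
  rw [← normSq_circleMap_sub, log_pow, norm_sub_rev, ← h]
  field_simp
  push_cast
  ring

lemma realPoisson_mul_log_abs_cos_sub_cos_ae (α φ : ℝ) :
    (fun θ ↦ realPoisson α θ * log ‖circleMap 0 1 θ - circleMap 0 1 φ‖
      + realPoisson α θ * log ‖circleMap 0 1 θ - circleMap 0 1 (-φ)‖ - log 2 * realPoisson α θ)
    =ᵐ[volume] fun θ ↦ realPoisson α θ * log |cos θ - cos φ| := by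
  filter_upwards [ae_cos_ne φ] with θ hθ
  linear_combination realPoisson α θ * log_norm_circleMap_sub_add hθ

lemma intervalIntegrable_realPoisson_mul_log {α : ℝ} (hα : |α| < 1) (φ : ℝ) :
    IntervalIntegrable (fun θ ↦ realPoisson α θ * log |cos θ - cos φ|) volume 0 (2 * π) := by
  refine (((intervalIntegrable_realPoisson_mul_log_norm hα φ).add
    (intervalIntegrable_realPoisson_mul_log_norm hα (-φ))).sub
    (((continuous_realPoisson hα).intervalIntegrable _ _).const_mul (log 2))).congr_ae ?_
  exact ae_restrict_of_ae (realPoisson_mul_log_abs_cos_sub_cos_ae α φ)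

/-- The logarithmic potential, on the interval `[-1, 1]`, of the Poisson kernel. -/
lemma integral_realPoisson_mul_log {α : ℝ} (hα : |α| < 1) (φ : ℝ) :
    ∫ θ in 0..π, realPoisson α θ * log |cos θ - cos φ|
      = π * (log (1 - 2 * α * cos φ + α ^ 2) - log 2) := by
  have h1 := integral_zero_two_pi_eq_of_symm (intervalIntegrable_realPoisson_mul_log hα φ)
    fun θ ↦ by rw [realPoisson_symm, cos_two_pi_sub]
  have h2 := integral_zero_two_pi_eq_of_symm
    ((continuous_realPoisson hα).intervalIntegrable 0 (2 * π)) (realPoisson_symm α)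
  rw [intervalIntegral_realPoisson hα] at h2
  rw [← intervalIntegral.integral_congr_ae
    ((realPoisson_mul_log_abs_cos_sub_cos_ae α φ).mono fun θ h _ ↦ h),
    intervalIntegral.integral_sub, intervalIntegral.integral_add,
    integral_realPoisson_mul_log_norm hα, integral_realPoisson_mul_log_norm hα,
    intervalIntegral.integral_const_mul, h2, cos_neg] at h1
  · linarith
  · exact intervalIntegrable_realPoisson_mul_log_norm hα φ
  · exact intervalIntegrable_realPoisson_mul_log_norm hα (-φ)
  · exact (intervalIntegrable_realPoisson_mul_log_norm hα φ).add
      (intervalIntegrable_realPoisson_mul_log_norm hα (-φ))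
  · exact ((continuous_realPoisson hα).intervalIntegrable _ _).const_mul (log 2)

/-- The measure on scales `r` for which `log (L / d) = ∫ (r - d)₊ dκ(r)` on `(0, L]`. -/
def scaleMeasure (L : ℝ) : Measure ℝ :=
  (volume.restrict (Set.Ioo 0 L)).withDensity (fun r ↦ ENNReal.ofReal (1 / r ^ 2))
    + ENNReal.ofReal (1 / L) • Measure.dirac L

instance (L : ℝ) : SFinite (scaleMeasure L) := by
  unfold scaleMeasure; infer_instance

lemma integral_scale {L d : ℝ} (hd : 0 < d) (hdL : d ≤ L) :
    ∫ r in d..L, 1 / r ^ 2 * (r - d) = log (L / d) - (1 - d / L) := by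
  have hL : 0 < L := hd.trans_le hdL
  have hpos : ∀ r ∈ Set.uIcc d L, 0 < r := fun r hr ↦ by
    rw [Set.uIcc_of_le hdL] at hr; exact hd.trans_le hr.1
  rw [intervalIntegral.integral_eq_sub_of_hasDerivAt (f := fun r ↦ log r + d / r)]
  · rw [log_div hL.ne' hd.ne', div_self hd.ne']; ring
  · intro r hr
    have hr := hpos r hr
    refine HasDerivAt.congr_deriv
      ((hasDerivAt_log hr.ne').add ((hasDerivAt_const r d).div (hasDerivAt_id' r) hr.ne')) ?_
    field_simp
    ring
  · refine ContinuousOn.intervalIntegrable fun r hr ↦ ContinuousAt.continuousWithinAt ?_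
    have := (hpos r hr).ne'
    exact ContinuousAt.mul (continuousAt_const.div (by fun_prop) (by positivity)) (by fun_prop)

lemma lintegral_scaleMeasure_of_pos {L d : ℝ} (hd : 0 < d) (hdL : d ≤ L) :
    ∫⁻ r, ENNReal.ofReal (r - d) ∂(scaleMeasure L) = ENNReal.ofReal (log (L / d)) := by
  have hL : 0 < L := hd.trans_le hdL
  have hm : Measurable fun r : ℝ ↦ ENNReal.ofReal (1 / r ^ 2) := by fun_prop
  rw [scaleMeasure, lintegral_add_measure, lintegral_smul_measure, lintegral_dirac' _ (by fun_prop),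
    lintegral_withDensity_eq_lintegral_mul _ hm (by fun_prop)]
  have h1 : ∫⁻ r in Set.Ioo 0 L, ((fun r : ℝ ↦ ENNReal.ofReal (1 / r ^ 2)) *
      fun r ↦ ENNReal.ofReal (r - d)) r = ENNReal.ofReal (log (L / d) - (1 - d / L)) := by
    have h2 : ∀ r : ℝ, ((fun r : ℝ ↦ ENNReal.ofReal (1 / r ^ 2)) *
        fun r ↦ ENNReal.ofReal (r - d)) r
        = (Set.Ioi d).indicator (fun r ↦ ENNReal.ofReal (1 / r ^ 2 * (r - d))) r := by
      intro r
      rw [Pi.mul_apply, ← ENNReal.ofReal_mul (by positivity)]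
      by_cases hr : r ∈ Set.Ioi d
      · rw [Set.indicator_of_mem hr]
      · rw [Set.indicator_of_notMem hr, ENNReal.ofReal_eq_zero]
        exact mul_nonpos_of_nonneg_of_nonpos (by positivity) (sub_nonpos.2 (not_lt.1 hr))
    rw [lintegral_congr h2, lintegral_indicator measurableSet_Ioi,
      Measure.restrict_restrict measurableSet_Ioi]
    have h3 : Set.Ioi d ∩ Set.Ioo 0 L = Set.Ioo d L := by
      ext r; simp only [Set.mem_inter_iff, Set.mem_Ioi, Set.mem_Ioo]
      exact ⟨fun h ↦ ⟨h.1, h.2.2⟩, fun h ↦ ⟨h.1, hd.trans h.1, h.2⟩⟩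
    rw [h3, restrict_Ioo_eq_restrict_Ioc, ← integral_scale hd hdL,
      intervalIntegral.integral_of_le hdL,
      ofReal_integral_eq_lintegral_ofReal]
    · rw [← IntegrableOn, ← intervalIntegrable_iff_integrableOn_Ioc_of_le hdL]
      refine ContinuousOn.intervalIntegrable fun r hr ↦ ContinuousAt.continuousWithinAt ?_
      rw [Set.uIcc_of_le hdL] at hr
      have := (hd.trans_le hr.1).ne'
      exact ContinuousAt.mul (continuousAt_const.div (by fun_prop) (by positivity)) (by fun_prop)
    · filter_upwards [ae_restrict_mem measurableSet_Ioc] with r hr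
      exact mul_nonneg (by positivity) (sub_nonneg.2 hr.1.le)
  have h4 : 0 ≤ 1 - d / L := by rw [sub_nonneg, div_le_one hL]; exact hdL
  rw [h1, smul_eq_mul, ← ENNReal.ofReal_mul (by positivity), show 1 / L * (L - d) = 1 - d / L by
    field_simp, ← ENNReal.ofReal_add _ h4]
  · ring_nf
  · have := one_sub_inv_le_log_of_pos (show 0 < L / d by positivity)
    rw [inv_div] at this
    linarith

lemma lintegral_scaleMeasure_zero {L : ℝ} (hL : 0 < L) :
    ∫⁻ r, ENNReal.ofReal (r - 0) ∂(scaleMeasure L) = ⊤ := by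
  refine ENNReal.eq_top_of_forall_nnreal_le fun x ↦ ?_
  have hd : 0 < L * exp (-x) := by positivity
  calc (x : ℝ≥0∞) = ENNReal.ofReal (log (L / (L * exp (-x)))) := by
        rw [← div_div, div_self hL.ne', exp_neg, one_div, inv_inv, log_exp,
          ENNReal.ofReal_coe_nnreal]
    _ = ∫⁻ r, ENNReal.ofReal (r - L * exp (-x)) ∂(scaleMeasure L) :=
        (lintegral_scaleMeasure_of_pos hd (mul_le_of_le_one_right hL.le (by simp))).symm
    _ ≤ _ := lintegral_mono fun r ↦ ENNReal.ofReal_le_ofReal (by linarith)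

lemma logKernel_eq_lintegral {L t s : ℝ} (hL : 0 < L) (hts : |t - s| ≤ L) :
    logKernel (log L) (t, s) = ∫⁻ r, ENNReal.ofReal (r - |t - s|) ∂(scaleMeasure L) := by
  unfold logKernel
  split_ifs with h
  · simp only at h
    rw [h, sub_self, abs_zero, lintegral_scaleMeasure_zero hL]
  · have hd : 0 < |t - s| := abs_pos.2 (sub_ne_zero.2 h)
    rw [lintegral_scaleMeasure_of_pos hd hts, log_div hL.ne' hd.ne']
    ring_nf

/-- The indicator of the event that `t` lies in the window `[u, u + r]`. -/
def window (ω : ℝ × ℝ) (t : ℝ) : ℝ≥0∞ :=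
  (Set.Icc ω.2 (ω.2 + ω.1)).indicator 1 t

lemma measurable_window : Measurable (Function.uncurry window) := by
  have : Function.uncurry window = Set.indicator
      {p : (ℝ × ℝ) × ℝ | p.1.2 ≤ p.2 ∧ p.2 ≤ p.1.2 + p.1.1} 1 := by
    ext p
    by_cases h : p.1.2 ≤ p.2 ∧ p.2 ≤ p.1.2 + p.1.1 <;>
      simp [Function.uncurry, window, Set.indicator, h]
  rw [this]
  refine measurable_one.indicator (MeasurableSet.inter ?_ ?_)
  · exact measurableSet_le (f := fun p : (ℝ × ℝ) × ℝ ↦ p.1.2) (g := fun p ↦ p.2)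
      (by fun_prop) (by fun_prop)
  · exact measurableSet_le (f := fun p : (ℝ × ℝ) × ℝ ↦ p.2) (g := fun p ↦ p.1.2 + p.1.1)
      (by fun_prop) (by fun_prop)

lemma lintegral_window (ν : Measure ℝ) (ω : ℝ × ℝ) :
    ∫⁻ t, window ω t ∂ν = ν (Set.Icc ω.2 (ω.2 + ω.1)) :=
  lintegral_indicator_one measurableSet_Icc

lemma lintegral_window_mul_window (r t s : ℝ) :
    ∫⁻ u, window (r, u) t * window (r, u) s = ENNReal.ofReal (r - |t - s|) := by
  have : ∀ u, window (r, u) t * window (r, u) s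
      = (Set.Icc (max t s - r) (min t s)).indicator 1 u := by
    intro u
    simp only [window, Set.indicator, Set.mem_Icc, Pi.one_apply, sub_le_iff_le_add, max_le_iff,
      le_min_iff]
    by_cases h1 : u ≤ t ∧ t ≤ u + r <;> by_cases h2 : u ≤ s ∧ s ≤ u + r <;> simp [h1, h2] <;>
      grind
  simp_rw [this]
  rw [lintegral_indicator_one measurableSet_Icc, Real.volume_Icc, ← max_sub_min_eq_abs,
    max_comm s t,
    min_comm s t]
  ring_nf

/-- The measure on windows representing the truncated logarithmic kernel. -/
def windowMeasure (L : ℝ) : Measure (ℝ × ℝ) := (scaleMeasure L).prod volume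

instance (L : ℝ) : SFinite (windowMeasure L) := by
  unfold windowMeasure; infer_instance

lemma measurable_window_mul_window :
    Measurable fun q : (ℝ × ℝ) × (ℝ × ℝ) ↦ window q.2 q.1.1 * window q.2 q.1.2 :=
  (measurable_window.comp (by fun_prop : Measurable fun q : (ℝ × ℝ) × (ℝ × ℝ) ↦ (q.2, q.1.1))).mul
    (measurable_window.comp (by fun_prop : Measurable fun q : (ℝ × ℝ) × (ℝ × ℝ) ↦ (q.2, q.1.2)))

lemma logKernel_eq_lintegral_window {L t s : ℝ} (hL : 0 < L) (hts : |t - s| ≤ L) :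
    logKernel (log L) (t, s) = ∫⁻ ω, window ω t * window ω s ∂(windowMeasure L) := by
  rw [logKernel_eq_lintegral hL hts, windowMeasure, lintegral_prod]
  · simp_rw [lintegral_window_mul_window]
  · exact (measurable_window_mul_window.comp
      (by fun_prop : Measurable fun ω : ℝ × ℝ ↦ ((t, s), ω))).aemeasurable

lemma lintegral_logKernel_prod {a b L : ℝ} (hL : 0 < L) (hab : b - a ≤ L) (ν μ : Measure ℝ)
    [SFinite ν] [SFinite μ] (hν : ν (Set.Icc a b)ᶜ = 0) (hμ : μ (Set.Icc a b)ᶜ = 0) :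
    ∫⁻ p, logKernel (log L) p ∂(ν.prod μ)
      = ∫⁻ ω, ν (Set.Icc ω.2 (ω.2 + ω.1)) * μ (Set.Icc ω.2 (ω.2 + ω.1)) ∂(windowMeasure L) := by
  have h : ∀ᵐ p ∂(ν.prod μ), logKernel (log L) p
      = ∫⁻ ω, window ω p.1 * window ω p.2 ∂(windowMeasure L) := by
    have h1 : ∀ᵐ p ∂(ν.prod μ), p.1 ∈ Set.Icc a b :=
      Measure.quasiMeasurePreserving_fst.ae (show ∀ᵐ x ∂ν, x ∈ Set.Icc a b from mem_ae_iff.2 hν)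
    have h2 : ∀ᵐ p ∂(ν.prod μ), p.2 ∈ Set.Icc a b :=
      Measure.quasiMeasurePreserving_snd.ae (show ∀ᵐ x ∂μ, x ∈ Set.Icc a b from mem_ae_iff.2 hμ)
    filter_upwards [h1, h2] with p hp1 hp2
    refine logKernel_eq_lintegral_window hL ?_
    rw [abs_le]
    constructor <;> linarith [hp1.1, hp1.2, hp2.1, hp2.2]
  rw [lintegral_congr_ae h, lintegral_lintegral_swap measurable_window_mul_window.aemeasurable]
  refine lintegral_congr fun ω ↦ ?_
  have hm : Measurable (window ω) :=
    measurable_window.comp (by fun_prop : Measurable fun t : ℝ ↦ (ω, t))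
  rw [lintegral_prod_mul hm.aemeasurable hm.aemeasurable, lintegral_window, lintegral_window]

lemma measurable_measure_Icc_add (ν : Measure ℝ) [SFinite ν] :
    Measurable fun ω : ℝ × ℝ ↦ ν (Set.Icc ω.2 (ω.2 + ω.1)) := by
  simp_rw [← lintegral_window]
  exact measurable_window.lintegral_prod_right'

lemma ENNReal.two_mul_mul_le_add_mul_self (x y : ℝ≥0∞) : 2 * (x * y) ≤ x * x + y * y := by
  rcases eq_or_ne x ⊤ with rfl | hx
  · simp
  rcases eq_or_ne y ⊤ with rfl | hy
  · simp
  lift x to ℝ≥0 using hx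
  lift y to ℝ≥0 using hy
  norm_cast
  rw [← NNReal.coe_le_coe]
  push_cast
  nlinarith [sq_nonneg ((x : ℝ) - y)]

lemma ENNReal.eq_of_two_mul_mul_eq_add_mul_self {x y : ℝ≥0∞} (hx : x ≠ ⊤) (hy : y ≠ ⊤)
    (h : 2 * (x * y) = x * x + y * y) : x = y := by
  lift x to ℝ≥0 using hx
  lift y to ℝ≥0 using hy
  norm_cast at h ⊢
  rw [← NNReal.coe_inj] at h ⊢
  push_cast at h
  have : ((x : ℝ) - y) ^ 2 = 0 := by linarith
  exact sub_eq_zero.1 (pow_eq_zero_iff two_ne_zero |>.1 this)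

lemma eq_of_measure_Iic_ae_eq {ν μ : Measure ℝ} [IsProbabilityMeasure ν] [IsProbabilityMeasure μ]
    (h : ∀ᵐ x : ℝ, ν (Set.Iic x) = μ (Set.Iic x)) : ν = μ := by
  refine Measure.eq_of_cdf ν μ (StieltjesFunction.ext fun x ↦ ?_)
  have hlim (ρ : Measure ℝ) : Tendsto (ProbabilityTheory.cdf ρ) (𝓝[>] x)
      (𝓝 (ProbabilityTheory.cdf ρ x)) :=
    ((ProbabilityTheory.cdf ρ).right_continuous x).mono_left
      (nhdsWithin_mono x Set.Ioi_subset_Ici_self)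
  refine tendsto_nhds_unique_of_frequently_eq (hlim ν) (hlim μ) fun hne ↦ ?_
  obtain ⟨z, hz, hsub⟩ := mem_nhdsGT_iff_exists_Ioo_subset.1 hne
  have hnull : volume (Set.Ioo x z) = 0 := by
    refine measure_mono_null (t := {y | ν (Set.Iic y) = μ (Set.Iic y)}ᶜ)
      (fun y hy hy' ↦ hsub hy ?_) (mem_ae_iff.1 h)
    have hy' : ν (Set.Iic y) = μ (Set.Iic y) := hy'
    simp only [ProbabilityTheory.cdf_eq_real, Measure.real]
    rw [hy']
  rw [Real.volume_Ioo, ENNReal.ofReal_eq_zero] at hnull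
  have hz : x < z := hz
  linarith

/-- Strict positive definiteness of the logarithmic kernel. -/
lemma two_mul_lintegral_logKernel_lt {a b L : ℝ} (hL : 0 < L) (hab : b - a ≤ L)
    {ν μ : Measure ℝ} [IsProbabilityMeasure ν] [IsProbabilityMeasure μ]
    (hν : ν (Set.Icc a b)ᶜ = 0) (hμ : μ (Set.Icc a b)ᶜ = 0) (hne : ν ≠ μ)
    (hfν : ∫⁻ p, logKernel (log L) p ∂(ν.prod ν) ≠ ⊤)
    (hfμ : ∫⁻ p, logKernel (log L) p ∂(μ.prod μ) ≠ ⊤) :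
    2 * ∫⁻ p, logKernel (log L) p ∂(ν.prod μ)
      < ∫⁻ p, logKernel (log L) p ∂(ν.prod ν) + ∫⁻ p, logKernel (log L) p ∂(μ.prod μ) := by
  rw [lintegral_logKernel_prod hL hab ν ν hν hν] at hfν ⊢
  rw [lintegral_logKernel_prod hL hab μ μ hμ hμ] at hfμ ⊢
  rw [lintegral_logKernel_prod hL hab ν μ hν hμ]
  have hmν := measurable_measure_Icc_add ν
  have hmμ := measurable_measure_Icc_add μ
  have hadd := lintegral_add_left (μ := windowMeasure L)
    (f := fun ω ↦ ν (Set.Icc ω.2 (ω.2 + ω.1)) * ν (Set.Icc ω.2 (ω.2 + ω.1))) (hmν.mul hmν)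
    (fun ω ↦ μ (Set.Icc ω.2 (ω.2 + ω.1)) * μ (Set.Icc ω.2 (ω.2 + ω.1)))
  rw [← hadd, ← lintegral_const_mul 2
    (f := fun ω : ℝ × ℝ ↦ ν (Set.Icc ω.2 (ω.2 + ω.1)) * μ (Set.Icc ω.2 (ω.2 + ω.1))) (hmν.mul hmμ)]
  have hle : ∀ ω : ℝ × ℝ, 2 * (ν (Set.Icc ω.2 (ω.2 + ω.1)) * μ (Set.Icc ω.2 (ω.2 + ω.1))) ≤
      ν (Set.Icc ω.2 (ω.2 + ω.1)) * ν (Set.Icc ω.2 (ω.2 + ω.1))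
        + μ (Set.Icc ω.2 (ω.2 + ω.1)) * μ (Set.Icc ω.2 (ω.2 + ω.1)) :=
    fun ω ↦ ENNReal.two_mul_mul_le_add_mul_self _ _
  refine lintegral_strict_mono_of_ae_le_of_frequently_ae_lt
    ((hmν.mul hmν).add (hmμ.mul hmμ)).aemeasurable
    (ne_top_of_le_ne_top ?_ (lintegral_mono hle)) (ae_of_all _ hle) fun hae ↦ hne ?_
  · rw [hadd]
    exact ENNReal.add_ne_top.2 ⟨hfν, hfμ⟩
  have hae' : ∀ᵐ ω ∂(windowMeasure L),
      ν (Set.Icc ω.2 (ω.2 + ω.1)) = μ (Set.Icc ω.2 (ω.2 + ω.1)) := by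
    filter_upwards [hae] with ω hω
    exact ENNReal.eq_of_two_mul_mul_eq_add_mul_self (measure_ne_top _ _) (measure_ne_top _ _)
      (not_not.1 hω)
  have hL' : ∀ᵐ u : ℝ, ν (Set.Icc u (u + L)) = μ (Set.Icc u (u + L)) := by
    have h1 := Measure.ae_ae_of_ae_prod hae'
    by_contra hcon
    have h2 : scaleMeasure L {L} = 0 :=
      measure_mono_null (fun r hr ↦ by rw [Set.mem_singleton_iff.1 hr]; exact hcon) h1
    have h3 : ENNReal.ofReal (1 / L) ≤ scaleMeasure L {L} := by
      simp [scaleMeasure]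
    rw [h2, nonpos_iff_eq_zero, ENNReal.ofReal_eq_zero] at h3
    exact absurd h3 (not_le.2 (by positivity))
  refine eq_of_measure_Iic_ae_eq ?_
  have hshift : ∀ᵐ x : ℝ, ν (Set.Icc (x - L) (x - L + L)) = μ (Set.Icc (x - L) (x - L + L)) :=
    (measurePreserving_sub_right volume L).quasiMeasurePreserving.ae hL'
  have hIic (ρ : Measure ℝ) (hρ : ρ (Set.Icc a b)ᶜ = 0) {x : ℝ} (hx : x < b) :
      ρ (Set.Icc (x - L) (x - L + L)) = ρ (Set.Iic x) := by
    refine measure_congr ?_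
    filter_upwards [mem_ae_iff.2 hρ] with y hy
    refine propext ⟨fun h ↦ ?_, fun h ↦ ?_⟩
    · exact (h.2.trans (by linarith) : y ≤ x)
    · have h : y ≤ x := h
      exact ⟨by linarith [hy.1], by linarith⟩
  have hIic' (ρ : Measure ℝ) [IsProbabilityMeasure ρ] (hρ : ρ (Set.Icc a b)ᶜ = 0) {x : ℝ}
      (hx : b ≤ x) : ρ (Set.Iic x) = 1 := by
    rw [← prob_compl_eq_zero_iff measurableSet_Iic]
    exact measure_mono_null (Set.compl_subset_compl.2 fun y hy ↦ hy.2.trans hx) hρ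
  filter_upwards [hshift] with x hx
  rcases lt_or_ge x b with h | h
  · rwa [hIic ν hν h, hIic μ hμ h] at hx
  · rw [hIic' ν hν h, hIic' μ hμ h]

lemma continuous_mul_realPoisson {c α : ℝ} (h : c = 0 ∨ |α| < 1) :
    Continuous fun θ ↦ c * realPoisson α θ := by
  rcases h with rfl | h
  · simpa using continuous_const
  · exact continuous_const.mul (continuous_realPoisson h)

lemma intervalIntegral_mul_realPoisson {c α : ℝ} (h : c = 0 ∨ |α| < 1) :
    ∫ θ in 0..π, c * realPoisson α θ = c * π := by
  rcases h with rfl | h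
  · simp
  · rw [intervalIntegral.integral_const_mul, intervalIntegral_realPoisson h]

lemma intervalIntegrable_mul_realPoisson_mul_log {c α : ℝ} (h : c = 0 ∨ |α| < 1) (φ : ℝ) :
    IntervalIntegrable (fun θ ↦ c * realPoisson α θ * log |cos θ - cos φ|) volume 0 π := by
  rcases h with rfl | h
  · simp
  · simp_rw [mul_assoc]
    refine ((intervalIntegrable_realPoisson_mul_log h φ).mono_set
      (Set.uIcc_subset_uIcc_left ?_)).const_mul c
    rw [Set.mem_uIcc]
    left; constructor <;> linarith [pi_pos]

lemma intervalIntegral_mul_realPoisson_mul_log {c α : ℝ} (h : c = 0 ∨ |α| < 1) (φ : ℝ) :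
    ∫ θ in 0..π, c * realPoisson α θ * log |cos θ - cos φ|
      = c * (π * (log (1 - 2 * α * cos φ + α ^ 2) - log 2)) := by
  rcases h with rfl | h
  · simp
  · simp_rw [mul_assoc]
    rw [intervalIntegral.integral_const_mul, integral_realPoisson_mul_log h]
    ring_nf

/-- The trigonometric parameters of `μ_{a,b,p1,p2}`. -/
structure IsTrigParam (s t v w : ℝ) : Prop where
  s_pos : 0 < s
  t_pos : 0 < t
  v_pos : 0 < v
  w_pos : 0 < w
  t_le : t ≤ s
  v_le : v ≤ w
  mul_eq : s * t = v * w
  sum_eq : s ^ 2 + t ^ 2 + v ^ 2 + w ^ 2 = 1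

/-- The parametrization of the support by an angle. -/
def angleMap (a b s t θ : ℝ) : ℝ := a + (b - a) * (s ^ 2 + t ^ 2 + 2 * s * t * cos θ)

/-- The density in the angular variable. -/
def angleDensity (s t v w θ : ℝ) : ℝ :=
  1 / (2 * (t ^ 2 + v ^ 2)) - (s ^ 2 - t ^ 2) / (2 * (t ^ 2 + v ^ 2)) * realPoisson (-(t / s)) θ
    - (w ^ 2 - v ^ 2) / (2 * (t ^ 2 + v ^ 2)) * realPoisson (v / w) θ

namespace IsTrigParam

variable {s t v w : ℝ}

lemma coeff_left (h : IsTrigParam s t v w) (c : ℝ) : c * (s - t) = 0 ∨ |-(t / s)| < 1 := by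
  rcases h.t_le.eq_or_lt with e | e
  · left; rw [e, sub_self, mul_zero]
  · right
    rw [abs_neg, abs_of_pos (div_pos h.t_pos h.s_pos), div_lt_one h.s_pos]; exact e

lemma coeff_right (h : IsTrigParam s t v w) (c : ℝ) : c * (w - v) = 0 ∨ |v / w| < 1 := by
  rcases h.v_le.eq_or_lt with e | e
  · left; rw [e, sub_self, mul_zero]
  · right
    rw [abs_of_pos (div_pos h.v_pos h.w_pos), div_lt_one h.w_pos]; exact e

lemma coeff_left' (h : IsTrigParam s t v w) :
    (s ^ 2 - t ^ 2) / (2 * (t ^ 2 + v ^ 2)) = 0 ∨ |-(t / s)| < 1 := by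
  convert h.coeff_left ((s + t) / (2 * (t ^ 2 + v ^ 2))) using 2
  ring

lemma coeff_right' (h : IsTrigParam s t v w) :
    (w ^ 2 - v ^ 2) / (2 * (t ^ 2 + v ^ 2)) = 0 ∨ |v / w| < 1 := by
  convert h.coeff_right ((w + v) / (2 * (t ^ 2 + v ^ 2))) using 2
  ring

lemma continuous_angleDensity (h : IsTrigParam s t v w) : Continuous (angleDensity s t v w) :=
  (continuous_const.sub (continuous_mul_realPoisson h.coeff_left')).sub
    (continuous_mul_realPoisson h.coeff_right')

lemma sub_add_eq (h : IsTrigParam s t v w) :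
    1 / (2 * (t ^ 2 + v ^ 2)) - (s ^ 2 - t ^ 2) / (2 * (t ^ 2 + v ^ 2))
      - (w ^ 2 - v ^ 2) / (2 * (t ^ 2 + v ^ 2)) = 1 := by
  have := h.t_pos
  field_simp
  linear_combination -h.sum_eq

lemma intervalIntegral_angleDensity (h : IsTrigParam s t v w) :
    ∫ θ in 0..π, angleDensity s t v w θ = π := by
  unfold angleDensity
  have h1 := (continuous_mul_realPoisson h.coeff_left').intervalIntegrable (μ := volume) 0 π
  have h2 := (continuous_mul_realPoisson h.coeff_right').intervalIntegrable (μ := volume) 0 π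
  rw [intervalIntegral.integral_sub (intervalIntegrable_const.sub h1) h2,
    intervalIntegral.integral_sub intervalIntegrable_const h1,
    intervalIntegral_mul_realPoisson h.coeff_left',
    intervalIntegral_mul_realPoisson h.coeff_right', intervalIntegral.integral_const, smul_eq_mul]
  linear_combination π * h.sub_add_eq

lemma angleDensity_mul_log (θ φ : ℝ) : angleDensity s t v w θ * log |cos θ - cos φ|
    = 1 / (2 * (t ^ 2 + v ^ 2)) * realPoisson 0 θ * log |cos θ - cos φ|
      - (s ^ 2 - t ^ 2) / (2 * (t ^ 2 + v ^ 2)) * realPoisson (-(t / s)) θ * log |cos θ - cos φ|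
      - (w ^ 2 - v ^ 2) / (2 * (t ^ 2 + v ^ 2)) * realPoisson (v / w) θ
        * log |cos θ - cos φ| := by
  have : realPoisson 0 θ = 1 := by simp [realPoisson]
  rw [this, angleDensity]
  ring

lemma intervalIntegrable_angleDensity_mul_log (h : IsTrigParam s t v w) (φ : ℝ) :
    IntervalIntegrable (fun θ ↦ angleDensity s t v w θ * log |cos θ - cos φ|) volume 0 π := by
  simp_rw [angleDensity_mul_log]
  exact ((intervalIntegrable_mul_realPoisson_mul_log (.inr (by simp)) φ).sub
    (intervalIntegrable_mul_realPoisson_mul_log h.coeff_left' φ)).sub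
    (intervalIntegrable_mul_realPoisson_mul_log h.coeff_right' φ)

lemma intervalIntegral_angleDensity_mul_log (h : IsTrigParam s t v w) (φ : ℝ) :
    ∫ θ in 0..π, angleDensity s t v w θ * log |cos θ - cos φ|
      = π * (-log 2
        - (s ^ 2 - t ^ 2) / (2 * (t ^ 2 + v ^ 2)) * log (1 + 2 * (t / s) * cos φ + (t / s) ^ 2)
        - (w ^ 2 - v ^ 2) / (2 * (t ^ 2 + v ^ 2)) * log (1 - 2 * (v / w) * cos φ + (v / w) ^ 2))
      := by
  simp_rw [angleDensity_mul_log]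
  have h0 : 1 / (2 * (t ^ 2 + v ^ 2)) = 0 ∨ |(0 : ℝ)| < 1 := .inr (by simp)
  have i0 := intervalIntegrable_mul_realPoisson_mul_log h0 φ
  have i1 := intervalIntegrable_mul_realPoisson_mul_log h.coeff_left' φ
  have i2 := intervalIntegrable_mul_realPoisson_mul_log h.coeff_right' φ
  rw [intervalIntegral.integral_sub (i0.sub i1) i2, intervalIntegral.integral_sub i0 i1,
    intervalIntegral_mul_realPoisson_mul_log h0, intervalIntegral_mul_realPoisson_mul_log
    h.coeff_left', intervalIntegral_mul_realPoisson_mul_log h.coeff_right']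
  have e1 : 1 - 2 * 0 * cos φ + (0 : ℝ) ^ 2 = 1 := by ring
  have e2 : 1 - 2 * -(t / s) * cos φ + (-(t / s)) ^ 2 = 1 + 2 * (t / s) * cos φ + (t / s) ^ 2 := by
    ring
  rw [e1, e2, log_one]
  linear_combination (-π * log 2) * h.sub_add_eq

lemma left_pos (h : IsTrigParam s t v w) {c : ℝ} (hc : -1 < c) :
    0 < s ^ 2 + t ^ 2 + 2 * s * t * c := by
  nlinarith [sq_nonneg (s - t), mul_pos (mul_pos h.s_pos h.t_pos) (neg_lt_iff_pos_add.1 hc)]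

lemma right_eq (h : IsTrigParam s t v w) (c : ℝ) :
    1 - (s ^ 2 + t ^ 2 + 2 * s * t * c) = w ^ 2 + v ^ 2 - 2 * w * v * c := by
  linear_combination -h.sum_eq - 2 * c * h.mul_eq

lemma right_pos (h : IsTrigParam s t v w) {c : ℝ} (hc : c < 1) :
    0 < 1 - (s ^ 2 + t ^ 2 + 2 * s * t * c) := by
  rw [h.right_eq]
  nlinarith [sq_nonneg (w - v), mul_pos (mul_pos h.w_pos h.v_pos) (sub_pos.2 hc)]

lemma realPoisson_left (h : IsTrigParam s t v w) (θ : ℝ) :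
    realPoisson (-(t / s)) θ = (s ^ 2 - t ^ 2) / (s ^ 2 + t ^ 2 + 2 * s * t * cos θ) := by
  have := h.s_pos
  rw [realPoisson, ← mul_div_mul_left _ _ (pow_pos this 2).ne']
  congr 1 <;> field_simp
  ring

lemma realPoisson_right (h : IsTrigParam s t v w) (θ : ℝ) :
    realPoisson (v / w) θ = (w ^ 2 - v ^ 2) / (1 - (s ^ 2 + t ^ 2 + 2 * s * t * cos θ)) := by
  have := h.w_pos
  rw [h.right_eq, realPoisson, ← mul_div_mul_left _ _ (pow_pos this 2).ne']
  congr 1 <;> field_simp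
  ring

lemma angleDensity_eq (h : IsTrigParam s t v w) {θ : ℝ} (h1 : -1 < cos θ) (h2 : cos θ < 1) :
    angleDensity s t v w θ = 4 * (s * t) ^ 2 * (1 - cos θ ^ 2) / (2 * (t ^ 2 + v ^ 2)
      * (s ^ 2 + t ^ 2 + 2 * s * t * cos θ) * (1 - (s ^ 2 + t ^ 2 + 2 * s * t * cos θ))) := by
  have hD := h.left_pos h1
  have hE := h.right_pos h2
  have ht := h.t_pos
  rw [angleDensity, h.realPoisson_left, h.realPoisson_right]
  have hw : (w ^ 2 - v ^ 2) ^ 2 = (1 - s ^ 2 - t ^ 2) ^ 2 - 4 * (s * t) ^ 2 := by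
    rw [h.mul_eq, show 1 - s ^ 2 - t ^ 2 = w ^ 2 + v ^ 2 by linear_combination -h.sum_eq]
    ring
  have hs : (s ^ 2 - t ^ 2) ^ 2 = (s ^ 2 + t ^ 2) ^ 2 - 4 * (s * t) ^ 2 := by ring
  generalize hD' : s ^ 2 + t ^ 2 + 2 * s * t * cos θ = D at *
  rw [eq_div_iff (by positivity)]
  have ht2 : 0 < t ^ 2 + v ^ 2 := by positivity
  field_simp
  rw [hw, hs, ← hD']
  ring

end IsTrigParam

/-- The external field in terms of the trigonometric parameters. -/
def trigField (a b s t v w τ : ℝ) : ℝ :=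
  -((s ^ 2 - t ^ 2) / (t ^ 2 + v ^ 2) * log (τ - a))
    - (w ^ 2 - v ^ 2) / (t ^ 2 + v ^ 2) * log (b - τ)

/-- The value of the effective potential on the support of the equilibrium measure. -/
def trigConst (a b s t v w : ℝ) : ℝ :=
  -2 * log ((b - a) * (s * t)) - (s ^ 2 - t ^ 2) / (t ^ 2 + v ^ 2) * log ((b - a) * s ^ 2)
    - (w ^ 2 - v ^ 2) / (t ^ 2 + v ^ 2) * log ((b - a) * w ^ 2)

lemma angleMap_sub (a b s t θ φ : ℝ) :
    angleMap a b s t θ - angleMap a b s t φ = 2 * ((b - a) * (s * t)) * (cos θ - cos φ) := by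
  unfold angleMap; ring

lemma continuous_angleMap (a b s t : ℝ) : Continuous (angleMap a b s t) := by
  unfold angleMap; fun_prop

lemma log_abs_sub_le {x e τ : ℝ} (h : 0 ≤ (τ - e) * (e - x)) (hx : x ≠ e) :
    log |x - τ| ≤ log |x - e| - (τ - e) / (x - e) := by
  have hxe : x - e ≠ 0 := sub_ne_zero.2 hx
  have hpos : 0 < (x - τ) / (x - e) := by
    have : (x - τ) / (x - e) = 1 + (τ - e) * (e - x) / (x - e) ^ 2 := by field_simp; ring
    rw [this]
    positivity
  have hne : x - τ ≠ 0 := fun h0 ↦ by simp [h0] at hpos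
  have h1 := log_le_sub_one_of_pos hpos
  rw [← log_abs, abs_div, log_div (abs_pos.2 hne).ne' (abs_pos.2 hxe).ne'] at h1
  have h2 : (x - τ) / (x - e) = 1 - (τ - e) / (x - e) := by field_simp; ring
  linarith

lemma neg_one_lt_cos_of_mem_Ioo {θ : ℝ} (hθ : θ ∈ Set.Ioo 0 π) : -1 < cos θ := by
  rw [← cos_pi]
  exact cos_lt_cos_of_nonneg_of_le_pi hθ.1.le le_rfl hθ.2

lemma cos_lt_one_of_mem_Ioo {θ : ℝ} (hθ : θ ∈ Set.Ioo 0 π) : cos θ < 1 := by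
  rw [← cos_zero]
  exact cos_lt_cos_of_nonneg_of_le_pi le_rfl hθ.2.le hθ.1

namespace IsTrigParam

variable {a b s t v w : ℝ}

lemma log_abs_angleMap_sub (h : IsTrigParam s t v w) (hab : a < b) {θ φ : ℝ}
    (hne : cos θ ≠ cos φ) : log |angleMap a b s t θ - angleMap a b s t φ|
      = log 2 + log ((b - a) * (s * t)) + log |cos θ - cos φ| := by
  have h1 := h.s_pos
  have h2 := h.t_pos
  have h3 := sub_pos.2 hab
  rw [angleMap_sub, abs_mul, log_mul, abs_of_pos, log_mul]
  · exact two_ne_zero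
  · positivity
  · positivity
  · positivity
  · exact (abs_pos.2 (sub_ne_zero.2 hne)).ne'

lemma ae_log_abs_angleMap_sub (h : IsTrigParam s t v w) (hab : a < b) (φ : ℝ) :
    (fun θ ↦ (log 2 + log ((b - a) * (s * t))) * angleDensity s t v w θ
      + angleDensity s t v w θ * log |cos θ - cos φ|) =ᵐ[volume]
    fun θ ↦ angleDensity s t v w θ * log |angleMap a b s t θ - angleMap a b s t φ| := by
  filter_upwards [ae_cos_ne φ] with θ hθ
  rw [h.log_abs_angleMap_sub hab hθ]
  ring

lemma intervalIntegrable_log_angleMap (h : IsTrigParam s t v w) (hab : a < b) (φ : ℝ) :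
    IntervalIntegrable (fun θ ↦ angleDensity s t v w θ *
      log |angleMap a b s t θ - angleMap a b s t φ|) volume 0 π :=
  (((h.continuous_angleDensity.intervalIntegrable 0 π).const_mul _).add
    (h.intervalIntegrable_angleDensity_mul_log φ)).congr_ae
    (ae_restrict_of_ae (h.ae_log_abs_angleMap_sub hab φ))

lemma mul_log_left (h : IsTrigParam s t v w) (hab : a < b) (φ : ℝ) :
    (s ^ 2 - t ^ 2) / (t ^ 2 + v ^ 2) * log (1 + 2 * (t / s) * cos φ + (t / s) ^ 2)
      = (s ^ 2 - t ^ 2) / (t ^ 2 + v ^ 2)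
        * (log (angleMap a b s t φ - a) - log ((b - a) * s ^ 2)) := by
  rcases h.t_le.eq_or_lt with e | e
  · simp [e]
  · have hD : 0 < s ^ 2 + t ^ 2 + 2 * s * t * cos φ := by
      nlinarith [mul_pos h.s_pos h.t_pos, neg_one_le_cos φ, sq_pos_of_pos (sub_pos.2 e)]
    have hs := h.s_pos
    have hba := sub_pos.2 hab
    rw [angleMap, add_sub_cancel_left, ← log_div (by positivity) (by positivity)]
    congr 2
    field_simp
    ring

lemma mul_log_right (h : IsTrigParam s t v w) (hab : a < b) (φ : ℝ) :
    (w ^ 2 - v ^ 2) / (t ^ 2 + v ^ 2) * log (1 - 2 * (v / w) * cos φ + (v / w) ^ 2)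
      = (w ^ 2 - v ^ 2) / (t ^ 2 + v ^ 2)
        * (log (b - angleMap a b s t φ) - log ((b - a) * w ^ 2)) := by
  rcases h.v_le.eq_or_lt with e | e
  · simp [e]
  · have hD : 0 < w ^ 2 + v ^ 2 - 2 * w * v * cos φ := by
      nlinarith [mul_pos h.w_pos h.v_pos, cos_le_one φ, sq_pos_of_pos (sub_pos.2 e)]
    have hw := h.w_pos
    have hba := sub_pos.2 hab
    have hE : b - angleMap a b s t φ = (b - a) * (w ^ 2 + v ^ 2 - 2 * w * v * cos φ) := by
      rw [← h.right_eq, angleMap]; ring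
    rw [hE, ← log_div (by positivity) (by positivity)]
    congr 2
    field_simp
    ring

/-- The effective potential is constant on the support. -/
lemma trigField_sub_angleMap (h : IsTrigParam s t v w) (hab : a < b) (φ : ℝ) :
    trigField a b s t v w (angleMap a b s t φ) - 2 / π * ∫ θ in 0..π, angleDensity s t v w θ *
      log |angleMap a b s t θ - angleMap a b s t φ| = trigConst a b s t v w := by
  rw [← intervalIntegral.integral_congr_ae ((h.ae_log_abs_angleMap_sub hab φ).mono fun θ h _ ↦ h),
    intervalIntegral.integral_add ((h.continuous_angleDensity.intervalIntegrable 0 π).const_mul _)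
      (h.intervalIntegrable_angleDensity_mul_log φ), intervalIntegral.integral_const_mul,
    h.intervalIntegral_angleDensity, h.intervalIntegral_angleDensity_mul_log, trigField, trigConst]
  have h1 := h.mul_log_left hab φ
  have h2 := h.mul_log_right hab φ
  have ht : 0 < t ^ 2 + v ^ 2 := by have := h.t_pos; positivity
  have e1 : (s ^ 2 - t ^ 2) / (2 * (t ^ 2 + v ^ 2)) = (s ^ 2 - t ^ 2) / (t ^ 2 + v ^ 2) / 2 := by
    field_simp
  have e2 : (w ^ 2 - v ^ 2) / (2 * (t ^ 2 + v ^ 2)) = (w ^ 2 - v ^ 2) / (t ^ 2 + v ^ 2) / 2 := by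
    field_simp
  have eπ (x y : ℝ) : 2 / π * (x * π + π * y) = 2 * (x + y) := by
    field_simp
  rw [e1, e2, eπ]
  linear_combination h1 + h2

lemma intervalIntegrable_log_of_ne (h : IsTrigParam s t v w) {τ : ℝ}
    (hτ : ∀ θ, angleMap a b s t θ ≠ τ) :
    IntervalIntegrable (fun θ ↦ angleDensity s t v w θ * log |angleMap a b s t θ - τ|)
      volume 0 π := by
  refine (h.continuous_angleDensity.mul (Continuous.log ?_ fun θ ↦ ?_)).intervalIntegrable _ _
  · exact ((continuous_angleMap a b s t).sub continuous_const).abs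
  · exact (abs_pos.2 (sub_ne_zero.2 (hτ θ))).ne'

lemma angleDensity_div (h : IsTrigParam s t v w) (hab : a < b) {φ θ : ℝ} (hφ : cos φ ^ 2 = 1)
    (hl : 0 < s + t * cos φ) (hr : 0 < w - v * cos φ) (h1 : -1 < cos θ) (h2 : cos θ < 1) :
    angleDensity s t v w θ / (angleMap a b s t θ - angleMap a b s t φ)
      = 1 / (2 * (t ^ 2 + v ^ 2) * (b - a)) * ((s - t * cos φ) / (s + t * cos φ)) *
          realPoisson (-(t / s)) θ
        - 1 / (2 * (t ^ 2 + v ^ 2) * (b - a)) * ((w + v * cos φ) / (w - v * cos φ)) *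
          realPoisson (v / w) θ := by
  have hD := h.left_pos h1
  have hE := h.right_pos h2
  have hs := h.s_pos
  have ht := h.t_pos
  have hba := sub_pos.2 hab
  have hne : cos θ - cos φ ≠ 0 := by
    intro h0
    rw [← sub_eq_zero.1 h0] at hφ
    nlinarith
  have e1 : (s - t * cos φ) / (s + t * cos φ) * (s ^ 2 - t ^ 2) = (s - t * cos φ) ^ 2 := by
    field_simp
    linear_combination (-t ^ 2) * (s - t * cos φ) * (-hφ)
  have e2 : (w + v * cos φ) / (w - v * cos φ) * (w ^ 2 - v ^ 2) = (w + v * cos φ) ^ 2 := by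
    field_simp
    linear_combination (-v ^ 2) * (w + v * cos φ) * (-hφ)
  have e3 : (w + v * cos φ) ^ 2 = 1 - (s - t * cos φ) ^ 2 := by
    linear_combination h.sum_eq + (t ^ 2 + v ^ 2) * hφ - 2 * cos φ * h.mul_eq
  have e4 : (s - t * cos φ) ^ 2 - (s ^ 2 + t ^ 2 + 2 * s * t * cos θ)
      = -(2 * s * t * (cos θ + cos φ)) := by
    linear_combination t ^ 2 * hφ
  have e5 : 1 - cos θ ^ 2 = -(cos θ - cos φ) * (cos θ + cos φ) := by linear_combination -hφ
  have hT : 0 < t ^ 2 + v ^ 2 := by positivity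
  rw [h.angleDensity_eq h1 h2, h.realPoisson_left, h.realPoisson_right, angleMap_sub, e5,
    mul_assoc _ (_ / _) (_ / _), ← mul_div_assoc (_ / _), e1, mul_assoc _ (_ / _) (_ / _),
    ← mul_div_assoc ((w + _) / _), e2, e3]
  generalize s ^ 2 + t ^ 2 + 2 * s * t * cos θ = D at *
  generalize cos θ - cos φ = δ at *
  field_simp
  linear_combination (-2) * e4

lemma coeff_left_of_pos (h : IsTrigParam s t v w) {c : ℝ} (hc : c ^ 2 = 1) (hl : 0 < s + t * c)
    (k : ℝ) : k * ((s - t * c) / (s + t * c)) = 0 ∨ |-(t / s)| < 1 := by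
  refine (h.coeff_left 1).imp_left fun e ↦ ?_
  have e : s = t := by linarith
  subst e
  have hc1 : c = 1 := by
    rcases sq_eq_one_iff.1 hc with e | e
    · exact e
    · rw [e] at hl; linarith
  simp [hc1]

lemma coeff_right_of_pos (h : IsTrigParam s t v w) {c : ℝ} (hc : c ^ 2 = 1) (hr : 0 < w - v * c)
    (k : ℝ) : k * ((w + v * c) / (w - v * c)) = 0 ∨ |v / w| < 1 := by
  refine (h.coeff_right 1).imp_left fun e ↦ ?_
  have e : w = v := by linarith
  subst e
  have hc1 : c = -1 := by
    rcases sq_eq_one_iff.1 hc with e | e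
    · rw [e] at hr; linarith
    · exact e
  simp [hc1]

lemma angleDensity_nonneg (h : IsTrigParam s t v w) {θ : ℝ} (h1 : -1 < cos θ) (h2 : cos θ < 1) :
    0 ≤ angleDensity s t v w θ := by
  have hD := h.left_pos h1
  have hE := h.right_pos h2
  have : 0 ≤ 1 - cos θ ^ 2 := by nlinarith
  rw [h.angleDensity_eq h1 h2]
  positivity

/-- The effective potential beyond an endpoint of the support. -/
lemma trigConst_le_of_outside (h : IsTrigParam s t v w) (hab : a < b) {φ τ : ℝ}
    (hφ : cos φ ^ 2 = 1) (hl : 0 < s + t * cos φ) (hr : 0 < w - v * cos φ) (haτ : a < τ)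
    (hτb : τ < b) (hne : τ ≠ angleMap a b s t φ)
    (hout : ∀ θ, 0 ≤ (τ - angleMap a b s t φ) * (angleMap a b s t φ - angleMap a b s t θ)) :
    IntervalIntegrable (fun θ ↦ angleDensity s t v w θ * log |angleMap a b s t θ - τ|) volume 0 π ∧
    trigConst a b s t v w ≤ trigField a b s t v w τ - 2 / π * ∫ θ in 0..π,
      angleDensity s t v w θ * log |angleMap a b s t θ - τ| := by
  have hint := h.intervalIntegrable_log_of_ne (a := a) (b := b) (τ := τ) fun θ hθ ↦ by
    have := hout θ
    rw [hθ] at this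
    have h3 := sq_pos_of_pos (abs_pos.2 (sub_ne_zero.2 hne))
    rw [sq_abs] at h3
    nlinarith
  refine ⟨hint, ?_⟩
  rw [← h.trigField_sub_angleMap hab φ]
  have hba := sub_pos.2 hab
  have hs := h.s_pos
  have hT : 0 < t ^ 2 + v ^ 2 := by have := h.t_pos; positivity
  set e := angleMap a b s t φ with he
  set k := 1 / (2 * (t ^ 2 + v ^ 2) * (b - a)) with hk
  have hcl := h.coeff_left_of_pos hφ hl k
  have hcr := h.coeff_right_of_pos hφ hr k
  have i1 := (continuous_mul_realPoisson hcl).intervalIntegrable (μ := volume) 0 π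
  have i2 := (continuous_mul_realPoisson hcr).intervalIntegrable (μ := volume) 0 π
  have hle := intervalIntegral.integral_mono_on_of_le_Ioo pi_pos.le hint
    ((h.intervalIntegrable_log_angleMap hab φ).sub ((i1.sub i2).const_mul (τ - e)))
    fun θ hθ ↦ by
      have h1 := neg_one_lt_cos_of_mem_Ioo hθ
      have h2 := cos_lt_one_of_mem_Ioo hθ
      have hx : angleMap a b s t θ ≠ e := by
        rw [← sub_ne_zero, he, angleMap_sub]
        have := h.t_pos
        refine mul_ne_zero (by positivity) fun h0 ↦ ?_
        rw [← sub_eq_zero.1 h0] at hφ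
        nlinarith
      have h3 := mul_le_mul_of_nonneg_left (log_abs_sub_le (hout θ) hx)
        (h.angleDensity_nonneg h1 h2)
      rw [← h.angleDensity_div hab hφ hl hr h1 h2]
      refine h3.trans_eq ?_
      ring
  rw [intervalIntegral.integral_sub (h.intervalIntegrable_log_angleMap hab φ)
    ((i1.sub i2).const_mul (τ - e)), intervalIntegral.integral_const_mul,
    intervalIntegral.integral_sub i1 i2, intervalIntegral_mul_realPoisson hcl,
    intervalIntegral_mul_realPoisson hcr] at hle
  have hea : e - a = (b - a) * (s + t * cos φ) ^ 2 := by
    rw [he, angleMap]; linear_combination (-(b - a) * t ^ 2) * hφ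
  have hbe : b - e = (b - a) * (w - v * cos φ) ^ 2 := by
    have := h.right_eq (cos φ)
    rw [he, angleMap]
    linear_combination (b - a) * this - (b - a) * v ^ 2 * hφ
  have q1 : log (τ - a) ≤ log (e - a) + (τ - e) / (e - a) := by
    have hea' : 0 < e - a := by rw [hea]; positivity
    have := log_le_sub_one_of_pos (div_pos (sub_pos.2 haτ) hea')
    rw [log_div (sub_pos.2 haτ).ne' hea'.ne'] at this
    have h2 : (τ - a) / (e - a) = 1 + (τ - e) / (e - a) := by field_simp; ring
    linarith
  have q2 : log (b - τ) ≤ log (b - e) - (τ - e) / (b - e) := by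
    have hbe' : 0 < b - e := by rw [hbe]; positivity
    have := log_le_sub_one_of_pos (div_pos (sub_pos.2 hτb) hbe')
    rw [log_div (sub_pos.2 hτb).ne' hbe'.ne'] at this
    have h2 : (b - τ) / (b - e) = 1 - (τ - e) / (b - e) := by field_simp; ring
    linarith
  have hc1 : 0 ≤ (s ^ 2 - t ^ 2) / (t ^ 2 + v ^ 2) :=
    div_nonneg (by nlinarith [h.t_le, h.t_pos]) hT.le
  have hc2 : 0 ≤ (w ^ 2 - v ^ 2) / (t ^ 2 + v ^ 2) :=
    div_nonneg (by nlinarith [h.v_le, h.v_pos]) hT.le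
  have q1' := mul_le_mul_of_nonneg_left q1 hc1
  have q2' := mul_le_mul_of_nonneg_left q2 hc2
  have hle' := mul_le_mul_of_nonneg_left hle (show 0 ≤ 2 / π by positivity)
  have e1 : (s ^ 2 - t ^ 2) / (t ^ 2 + v ^ 2) / (e - a)
      = 2 * (k * ((s - t * cos φ) / (s + t * cos φ))) := by
    rw [hea, hk]
    field_simp
    linear_combination t ^ 2 * hφ
  have e2 : (w ^ 2 - v ^ 2) / (t ^ 2 + v ^ 2) / (b - e)
      = 2 * (k * ((w + v * cos φ) / (w - v * cos φ))) := by
    rw [hbe, hk]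
    field_simp
    linear_combination v ^ 2 * hφ
  have eπ (x y z : ℝ) : 2 / π * (x - (τ - e) * (y * π - z * π))
      = 2 / π * x - (τ - e) * (2 * y - 2 * z) := by
    field_simp
  rw [eπ, ← e1, ← e2] at hle'
  have r1 : (s ^ 2 - t ^ 2) / (t ^ 2 + v ^ 2) * ((τ - e) / (e - a))
      = (τ - e) * ((s ^ 2 - t ^ 2) / (t ^ 2 + v ^ 2) / (e - a)) := by ring
  have r2 : (w ^ 2 - v ^ 2) / (t ^ 2 + v ^ 2) * ((τ - e) / (b - e))
      = (τ - e) * ((w ^ 2 - v ^ 2) / (t ^ 2 + v ^ 2) / (b - e)) := by ring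
  rw [mul_add, r1] at q1'
  rw [mul_sub, r2] at q2'
  unfold trigField
  rw [mul_sub] at hle'
  linarith

end IsTrigParam

lemma exists_eq_angleMap {a b s t : ℝ}
    {τ : ℝ} (h1 : angleMap a b s t π ≤ τ) (h2 : τ ≤ angleMap a b s t 0) :
    ∃ φ, τ = angleMap a b s t φ := by
  obtain ⟨φ, -, hφ⟩ := intermediate_value_uIcc
    ((continuous_angleMap a b s t).continuousOn (s := Set.uIcc π 0)) (Set.Icc_subset_uIcc ⟨h1, h2⟩)
  exact ⟨φ, hφ.symm⟩

lemma IsTrigParam.trigConst_le {a b s t v w : ℝ} (h : IsTrigParam s t v w) (hab : a < b) {τ : ℝ}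
    (haτ : a ≤ τ) (hτb : τ ≤ b) (ha : s = t ∨ a < τ) (hb : w = v ∨ τ < b) :
    IntervalIntegrable (fun θ ↦ angleDensity s t v w θ * log |angleMap a b s t θ - τ|) volume 0 π ∧
    trigConst a b s t v w ≤ trigField a b s t v w τ - 2 / π * ∫ θ in 0..π,
      angleDensity s t v w θ * log |angleMap a b s t θ - τ| := by
  have hK : 0 < 2 * ((b - a) * (s * t)) := by
    have := h.s_pos
    have := h.t_pos
    have := sub_pos.2 hab
    positivity
  rcases lt_or_ge τ (angleMap a b s t π) with h1 | h1
  · have hst : 0 < s - t := by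
      rcases h.t_le.eq_or_lt with e | e
      · rw [angleMap, cos_pi, e] at h1
        linarith
      · linarith
    refine h.trigConst_le_of_outside hab (φ := π) (by simp) (by simpa using hst)
      (by rw [cos_pi]; linarith [h.w_pos, h.v_pos]) (ha.resolve_left (by linarith)) ?_ h1.ne
      fun θ ↦ ?_
    · have := h.right_eq (-1)
      rw [angleMap, cos_pi] at h1
      nlinarith [h.w_pos, h.v_pos, sq_nonneg (w + v), sub_pos.2 hab]
    · rw [angleMap_sub, cos_pi]
      refine mul_nonneg_of_nonpos_of_nonpos (by linarith) ?_
      exact mul_nonpos_of_nonneg_of_nonpos hK.le (by linarith [neg_one_le_cos θ])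
  rcases lt_or_ge (angleMap a b s t 0) τ with h2 | h2
  · have hwv : 0 < w - v := by
      rcases h.v_le.eq_or_lt with e | e
      · have := h.right_eq 1
        rw [angleMap, cos_zero] at h2
        rw [e] at this
        nlinarith
      · linarith
    refine h.trigConst_le_of_outside hab (φ := 0) (by simp)
      (by rw [cos_zero]; linarith [h.s_pos, h.t_pos]) (by simpa using hwv) ?_
      (hb.resolve_left (by linarith)) h2.ne' fun θ ↦ ?_
    · rw [angleMap, cos_zero] at h2
      nlinarith [h.s_pos, h.t_pos, sq_nonneg (s + t), sub_pos.2 hab]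
    · rw [angleMap_sub, cos_zero]
      exact mul_nonneg (by linarith) (mul_nonneg hK.le (by linarith [cos_le_one θ]))
  obtain ⟨φ, rfl⟩ := exists_eq_angleMap h1 h2
  exact ⟨h.intervalIntegrable_log_angleMap hab φ, (h.trigField_sub_angleMap hab φ).ge⟩

lemma isTrigParam_sqrt {p1 p2 : ℝ} (hp1 : p1 ∈ Set.Ioo (0 : ℝ) 1) (hp2 : p2 ∈ Set.Ioo (0 : ℝ) 1)
    (hge : p2 ≤ p1) (hsum : p1 + p2 ≤ 1) :
    IsTrigParam (√(p1 * (1 - p2))) (√(p2 * (1 - p1))) (√(p1 * p2)) (√((1 - p1) * (1 - p2))) := by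
  obtain ⟨h1, h1'⟩ := hp1
  obtain ⟨h2, h2'⟩ := hp2
  have hs : 0 < p1 * (1 - p2) := mul_pos h1 (by linarith)
  have ht : 0 < p2 * (1 - p1) := mul_pos h2 (by linarith)
  have hv : 0 < p1 * p2 := mul_pos h1 h2
  have hw : 0 < (1 - p1) * (1 - p2) := mul_pos (by linarith) (by linarith)
  refine ⟨by positivity, by positivity, by positivity, by positivity, ?_, ?_, ?_, ?_⟩
  · exact sqrt_le_sqrt (by linarith)
  · exact sqrt_le_sqrt (by linarith)
  · rw [← sqrt_mul hs.le, ← sqrt_mul hv.le]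
    congr 1; ring
  · rw [sq_sqrt hs.le, sq_sqrt ht.le, sq_sqrt hv.le, sq_sqrt hw.le]; ring

/-- The equilibrium measure in the angular variable. -/
def angleMeasure (s t v w : ℝ) : Measure ℝ :=
  (volume.restrict (Set.Ioo 0 π)).withDensity fun θ ↦ ENNReal.ofReal (angleDensity s t v w θ / π)

lemma angleMap_zero (a b s t : ℝ) : angleMap a b s t 0 = a + (b - a) * (s + t) ^ 2 := by
  rw [angleMap, cos_zero]; ring

lemma angleMap_pi (a b s t : ℝ) : angleMap a b s t π = a + (b - a) * (s - t) ^ 2 := by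
  rw [angleMap, cos_pi]; ring

lemma IsTrigParam.image_angleMap {a b s t v w : ℝ} (h : IsTrigParam s t v w) (hab : a < b) :
    angleMap a b s t '' Set.Ioo 0 π = Set.Ioo (angleMap a b s t π) (angleMap a b s t 0) := by
  have hK : 0 < 2 * ((b - a) * (s * t)) := by
    have := h.s_pos
    have := h.t_pos
    have := sub_pos.2 hab
    positivity
  refine Set.Subset.antisymm ?_ ?_
  · rintro _ ⟨θ, hθ, rfl⟩
    rw [Set.mem_Ioo, ← sub_pos, angleMap_sub, ← sub_pos (b := angleMap a b s t θ), angleMap_sub,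
      cos_pi, cos_zero]
    exact ⟨mul_pos hK (by linarith [neg_one_lt_cos_of_mem_Ioo hθ]),
      mul_pos hK (by linarith [cos_lt_one_of_mem_Ioo hθ])⟩
  · exact intermediate_value_Ioo' pi_pos.le (continuous_angleMap a b s t).continuousOn

lemma IsTrigParam.injOn_angleMap {a b s t v w : ℝ} (h : IsTrigParam s t v w) (hab : a < b) :
    Set.InjOn (angleMap a b s t) (Set.Ioo 0 π) := by
  intro θ hθ φ hφ e
  have e := sub_eq_zero.2 e
  have := h.s_pos
  have := h.t_pos
  have := sub_pos.2 hab
  rw [angleMap_sub, mul_eq_zero, or_iff_right (by positivity), sub_eq_zero] at e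
  exact injOn_cos ⟨hθ.1.le, hθ.2.le⟩ ⟨hφ.1.le, hφ.2.le⟩ e

lemma hasDerivAt_angleMap (a b s t θ : ℝ) :
    HasDerivAt (angleMap a b s t) (-(2 * ((b - a) * (s * t)) * sin θ)) θ := by
  unfold angleMap
  refine ((((hasDerivAt_cos θ).const_mul (2 * s * t)).const_add _).const_mul _ |>.const_add
    _).congr_deriv ?_
  ring

/-- The measure `μ_{a,b,p1,p2}` is the image of its angular version. -/
lemma muCompact_eq_map {a b p1 p2 : ℝ} (hab : a < b) (hp1 : p1 ∈ Set.Ioo (0 : ℝ) 1)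
    (hp2 : p2 ∈ Set.Ioo (0 : ℝ) 1) (hge : p2 ≤ p1) (hsum : p1 + p2 ≤ 1) :
    muCompact a b p1 p2 = (angleMeasure (√(p1 * (1 - p2))) (√(p2 * (1 - p1))) (√(p1 * p2))
      (√((1 - p1) * (1 - p2)))).map (angleMap a b (√(p1 * (1 - p2))) (√(p2 * (1 - p1)))) := by
  have h := isTrigParam_sqrt hp1 hp2 hge hsum
  have e1 : max (1 - p1 / p2) 0 = 0 := by
    refine max_eq_right (sub_nonpos.2 ?_)
    rwa [one_le_div hp2.1]
  have e2 : max ((p1 + p2 - 1) / p2) 0 = 0 :=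
    max_eq_right (div_nonpos_of_nonpos_of_nonneg (by linarith) hp2.1.le)
  rw [muCompact, e1, e2, ENNReal.ofReal_zero, zero_smul, zero_smul, add_zero, add_zero]
  have htv : √(p2 * (1 - p1)) ^ 2 + √(p1 * p2) ^ 2 = p2 := by
    rw [sq_sqrt (mul_nonneg hp2.1.le (by linarith [hp1.2])), sq_sqrt (mul_nonneg hp1.1.le hp2.1.le)]
    ring
  have hlmin : lmin a b p1 p2 = angleMap a b (√(p1 * (1 - p2))) (√(p2 * (1 - p1))) π := by
    rw [angleMap_pi]; rfl
  have hlmax : lmax a b p1 p2 = angleMap a b (√(p1 * (1 - p2))) (√(p2 * (1 - p1))) 0 := by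
    rw [angleMap_zero]; rfl
  generalize √(p1 * (1 - p2)) = s at *
  generalize √(p2 * (1 - p1)) = t at *
  generalize √(p1 * p2) = v at *
  generalize √((1 - p1) * (1 - p2)) = w at *
  have hX := (continuous_angleMap a b s t).measurable
  ext A hA
  rw [withDensity_apply _ hA, Measure.map_apply hX hA, angleMeasure,
    withDensity_apply _ (hX hA), Measure.restrict_restrict (hX hA), Set.inter_comm]
  have hd : ∀ x, ENNReal.ofReal (compactDensity a b p1 p2 x)
      = (angleMap a b s t '' Set.Ioo 0 π).indicator
        (fun x ↦ ENNReal.ofReal (compactDensity a b p1 p2 x)) x := by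
    intro x
    by_cases hx : x ∈ angleMap a b s t '' Set.Ioo 0 π
    · rw [Set.indicator_of_mem hx]
    · rw [Set.indicator_of_notMem hx, compactDensity]
      rw [h.image_angleMap hab, ← hlmin, ← hlmax] at hx
      split_ifs with hx'
      · have : (x - lmin a b p1 p2) * (lmax a b p1 p2 - x) = 0 := by
          by_contra hne
          rw [mul_eq_zero, not_or] at hne
          exact hx ⟨lt_of_le_of_ne hx'.1 fun e ↦ hne.1 (by rw [e, sub_self]),
            lt_of_le_of_ne hx'.2 fun e ↦ hne.2 (by rw [e, sub_self])⟩
        simp [this]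
      · simp
  have hI : MeasurableSet (angleMap a b s t '' Set.Ioo 0 π) := by
    rw [h.image_angleMap hab]; exact measurableSet_Ioo
  rw [lintegral_congr hd, lintegral_indicator hI, Measure.restrict_restrict hI,
    ← Set.image_inter_preimage, lintegral_image_eq_lintegral_abs_deriv_mul
      (measurableSet_Ioo.inter (hX hA)) (fun θ _ ↦ (hasDerivAt_angleMap a b s t θ).hasDerivWithinAt)
      ((h.injOn_angleMap hab).mono Set.inter_subset_left)]
  refine setLIntegral_congr_fun (measurableSet_Ioo.inter (hX hA)) fun θ hθ ↦ ?_
  have h1 := neg_one_lt_cos_of_mem_Ioo hθ.1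
  have h2 := cos_lt_one_of_mem_Ioo hθ.1
  have hmem : angleMap a b s t θ ∈ Set.Ioo (lmin a b p1 p2) (lmax a b p1 p2) := by
    rw [hlmin, hlmax, ← h.image_angleMap hab]
    exact Set.mem_image_of_mem _ hθ.1
  have hs := h.s_pos
  have ht := h.t_pos
  have hba := sub_pos.2 hab
  have hsin : 0 < sin θ := sin_pos_of_mem_Ioo hθ.1
  rw [compactDensity, if_pos ⟨hmem.1.le, hmem.2.le⟩, hlmin, hlmax, angleMap_sub, angleMap_sub,
    cos_pi,
    cos_zero, ← ENNReal.ofReal_mul (abs_nonneg _), h.angleDensity_eq h1 h2, abs_neg,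
    abs_of_pos (by positivity)]
  have hsq : 2 * ((b - a) * (s * t)) * (cos θ - -1) * (2 * ((b - a) * (s * t)) * (1 - cos θ))
      = (2 * ((b - a) * (s * t)) * sin θ) ^ 2 := by
    rw [mul_pow _ (sin θ), sin_sq]; ring
  have hD := h.left_pos h1
  have hE := h.right_pos h2
  have hXa : angleMap a b s t θ - a = (b - a) * (s ^ 2 + t ^ 2 + 2 * s * t * cos θ) := by
    rw [angleMap]; ring
  have hXb : b - angleMap a b s t θ = (b - a) * (1 - (s ^ 2 + t ^ 2 + 2 * s * t * cos θ)) := by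
    rw [angleMap]; ring
  have hp := hp2.1
  rw [hsq, sqrt_sq (by positivity), hXa, hXb, htv, ← sin_sq]
  generalize s ^ 2 + t ^ 2 + 2 * s * t * cos θ = D at *
  congr 1
  field_simp
  norm_num

namespace IsTrigParam

variable {a b s t v w : ℝ}

lemma integral_angleMeasure (h : IsTrigParam s t v w) {g : ℝ → ℝ}
    (hg : IntervalIntegrable (fun θ ↦ angleDensity s t v w θ * g θ) volume 0 π) :
    Integrable g (angleMeasure s t v w) ∧ ∫ θ, g θ ∂(angleMeasure s t v w)
      = 1 / π * ∫ θ in 0..π, angleDensity s t v w θ * g θ := by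
  have hm : Measurable fun θ ↦ ENNReal.ofReal (angleDensity s t v w θ / π) :=
    (h.continuous_angleDensity.div_const π).measurable.ennreal_ofReal
  have hfin : ∀ᵐ θ ∂(volume.restrict (Set.Ioo 0 π)),
      ENNReal.ofReal (angleDensity s t v w θ / π) < ⊤ := ae_of_all _ fun _ ↦ ENNReal.ofReal_lt_top
  have hcongr : (fun θ ↦ 1 / π * (angleDensity s t v w θ * g θ))
      =ᵐ[volume.restrict (Set.Ioo 0 π)]
      fun θ ↦ (ENNReal.ofReal (angleDensity s t v w θ / π)).toReal • g θ := by
    filter_upwards [ae_restrict_mem measurableSet_Ioo] with θ hθ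
    rw [ENNReal.toReal_ofReal (div_nonneg (h.angleDensity_nonneg (neg_one_lt_cos_of_mem_Ioo hθ)
      (cos_lt_one_of_mem_Ioo hθ)) pi_pos.le), smul_eq_mul]
    ring
  rw [angleMeasure, integrable_withDensity_iff_integrable_smul' hm hfin,
    integral_withDensity_eq_integral_toReal_smul hm hfin, ← integrable_congr hcongr,
    ← integral_congr_ae hcongr, integral_const_mul, intervalIntegral.integral_of_le pi_pos.le,
    integral_Ioc_eq_integral_Ioo]
  refine ⟨Integrable.const_mul ?_ _, rfl⟩
  rwa [intervalIntegrable_iff_integrableOn_Ioo_of_le pi_pos.le] at hg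

lemma isProbabilityMeasure_angleMeasure (h : IsTrigParam s t v w) :
    IsProbabilityMeasure (angleMeasure s t v w) := by
  refine ⟨?_⟩
  rw [angleMeasure, withDensity_apply _ .univ, Measure.restrict_univ,
    ← ofReal_integral_eq_lintegral_ofReal, integral_div, ← integral_Ioc_eq_integral_Ioo,
    ← intervalIntegral.integral_of_le pi_pos.le, h.intervalIntegral_angleDensity,
    div_self pi_ne_zero, ENNReal.ofReal_one]
  · have := h.continuous_angleDensity.intervalIntegrable (μ := volume) 0 π
    rw [intervalIntegrable_iff_integrableOn_Ioo_of_le pi_pos.le] at this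
    exact this.div_const π
  · filter_upwards [ae_restrict_mem measurableSet_Ioo] with θ hθ
    exact div_nonneg (h.angleDensity_nonneg (neg_one_lt_cos_of_mem_Ioo hθ)
      (cos_lt_one_of_mem_Ioo hθ)) pi_pos.le

lemma ae_mem_Ioo_angleMeasure : ∀ᵐ θ ∂(angleMeasure s t v w), θ ∈ Set.Ioo 0 π :=
  (withDensity_absolutelyContinuous _ _).ae_le (ae_restrict_mem measurableSet_Ioo)

lemma ae_angleMap_ne (h : IsTrigParam s t v w) (hab : a < b) (τ : ℝ) :
    ∀ᵐ θ ∂(angleMeasure s t v w), angleMap a b s t θ ≠ τ := by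
  by_cases hτ : ∃ φ, τ = angleMap a b s t φ
  · obtain ⟨φ, rfl⟩ := hτ
    refine (withDensity_absolutelyContinuous _ _).ae_le (ae_restrict_of_ae ?_)
    filter_upwards [ae_cos_ne φ] with θ hθ
    have := h.s_pos
    have := h.t_pos
    have := sub_pos.2 hab
    rw [← sub_ne_zero, angleMap_sub]
    exact mul_ne_zero (by positivity) (sub_ne_zero.2 hθ)
  · push Not at hτ
    exact ae_of_all _ fun θ ↦ (hτ θ).symm

lemma angleMap_mem_Ioo (h : IsTrigParam s t v w) (hab : a < b) {θ : ℝ} (hθ : θ ∈ Set.Ioo 0 π) :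
    angleMap a b s t θ ∈ Set.Ioo a b := by
  have h1 := mul_pos (sub_pos.2 hab) (h.left_pos (neg_one_lt_cos_of_mem_Ioo hθ))
  have h2 := mul_pos (sub_pos.2 hab) (h.right_pos (cos_lt_one_of_mem_Ioo hθ))
  unfold angleMap
  constructor <;> linarith

lemma lintegral_logKernel_angleMeasure (h : IsTrigParam s t v w) (hab : a < b) {τ : ℝ}
    (hτ : τ ∈ Set.Icc a b) (hint : IntervalIntegrable
      (fun θ ↦ angleDensity s t v w θ * log |angleMap a b s t θ - τ|) volume 0 π) :
    ∫⁻ θ, logKernel |log (b - a)| (τ, angleMap a b s t θ) ∂(angleMeasure s t v w)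
      = ENNReal.ofReal (|log (b - a)| - 1 / π * ∫ θ in 0..π,
        angleDensity s t v w θ * log |angleMap a b s t θ - τ|) ∧
    0 ≤ |log (b - a)| - 1 / π * ∫ θ in 0..π,
        angleDensity s t v w θ * log |angleMap a b s t θ - τ| := by
  have := h.isProbabilityMeasure_angleMeasure
  obtain ⟨hi, he⟩ := h.integral_angleMeasure hint
  have hnonneg : ∀ᵐ θ ∂(angleMeasure s t v w),
      0 ≤ |log (b - a)| - log |angleMap a b s t θ - τ| := by
    filter_upwards [ae_mem_Ioo_angleMeasure, h.ae_angleMap_ne hab τ] with θ hθ hne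
    have hm := h.angleMap_mem_Ioo hab hθ
    have := log_le_log (abs_pos.2 (sub_ne_zero.2 hne))
      (show |angleMap a b s t θ - τ| ≤ b - a by
        rw [abs_le]; constructor <;> linarith [hm.1, hm.2, hτ.1, hτ.2])
    linarith [le_abs_self (log (b - a))]
  have hc : Integrable (fun _ : ℝ ↦ |log (b - a)|) (angleMeasure s t v w) := integrable_const _
  have heq : ∫ θ, (|log (b - a)| - log |angleMap a b s t θ - τ|) ∂(angleMeasure s t v w)
      = |log (b - a)| - 1 / π * ∫ θ in 0..π,
        angleDensity s t v w θ * log |angleMap a b s t θ - τ| := by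
    rw [integral_sub hc hi, he]
    simp
  rw [← heq]
  refine ⟨?_, integral_nonneg_of_ae hnonneg⟩
  rw [ofReal_integral_eq_lintegral_ofReal
    (f := fun θ ↦ |log (b - a)| - log |angleMap a b s t θ - τ|) (hc.sub hi) hnonneg]
  refine lintegral_congr_ae ?_
  filter_upwards [h.ae_angleMap_ne hab τ] with θ hne
  rw [logKernel, if_neg hne.symm, abs_sub_comm τ]
  ring_nf

end IsTrigParam

lemma measurable_logKernel (cl : ℝ) : Measurable (logKernel cl) := by
  unfold logKernel
  refine Measurable.ite (measurableSet_eq_fun measurable_fst measurable_snd) measurable_const ?_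
  fun_prop

lemma fieldQ_eq_top_or {a b p1 p2 cq τ : ℝ} (hab : a < b) (hτ : τ ∈ Set.Icc a b) :
    fieldQ a b p1 p2 cq τ = ⊤ ∨ (p1 / p2 - 1 = 0 ∨ a < τ) ∧ ((1 - p1 - p2) / p2 = 0 ∨ τ < b) ∧
      fieldQ a b p1 p2 cq τ = ENNReal.ofReal
        (-((p1 / p2 - 1) * log (τ - a)) - (1 - p1 - p2) / p2 * log (b - τ) + cq) := by
  unfold fieldQ
  rcases hτ.1.eq_or_lt with rfl | h1
  · by_cases h : p1 / p2 - 1 = 0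
    · right; simp [h, hab]
    · left; simp [h]
  rcases hτ.2.eq_or_lt with rfl | h2
  · by_cases h : (1 - p1 - p2) / p2 = 0
    · right; simp only [h]; simp [hab, hab.ne']
    · left; simp [h, hab.ne']
  · right
    exact ⟨.inr h1, .inr h2, if_pos ⟨h1, h2⟩⟩

/-- The Euler-Lagrange conditions for the equilibrium problem. -/
lemma exists_fieldQ_add_potential {a b p1 p2 : ℝ} (hab : a < b) (hp1 : p1 ∈ Set.Ioo (0 : ℝ) 1)
    (hp2 : p2 ∈ Set.Ioo (0 : ℝ) 1) (hge : p2 ≤ p1) (hsum : p1 + p2 ≤ 1) {cq : ℝ}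
    (hcq : (p1 / p2 - 1 + (1 - p1 - p2) / p2) * |log (b - a)| = cq) :
    ∃ F : ℝ≥0∞, F ≠ ⊤ ∧
      (∀ τ ∈ Set.Icc a b, F ≤ fieldQ a b p1 p2 cq τ
        + 2 * ∫⁻ y, logKernel |log (b - a)| (τ, y) ∂(muCompact a b p1 p2)) ∧
      ∀ᵐ τ ∂(muCompact a b p1 p2), fieldQ a b p1 p2 cq τ
        + 2 * ∫⁻ y, logKernel |log (b - a)| (τ, y) ∂(muCompact a b p1 p2) = F := by
  have h := isTrigParam_sqrt hp1 hp2 hge hsum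
  rw [muCompact_eq_map hab hp1 hp2 hge hsum]
  have hs2 : √(p1 * (1 - p2)) ^ 2 = p1 * (1 - p2) :=
    sq_sqrt (mul_nonneg hp1.1.le (by linarith [hp2.2]))
  have ht2 : √(p2 * (1 - p1)) ^ 2 = p2 * (1 - p1) :=
    sq_sqrt (mul_nonneg hp2.1.le (by linarith [hp1.2]))
  have hv2 : √(p1 * p2) ^ 2 = p1 * p2 := sq_sqrt (mul_nonneg hp1.1.le hp2.1.le)
  have hw2 : √((1 - p1) * (1 - p2)) ^ 2 = (1 - p1) * (1 - p2) :=
    sq_sqrt (mul_nonneg (by linarith [hp1.2]) (by linarith [hp2.2]))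
  generalize √(p1 * (1 - p2)) = s at *
  generalize √(p2 * (1 - p1)) = t at *
  generalize √(p1 * p2) = v at *
  generalize √((1 - p1) * (1 - p2)) = w at *
  have hp := hp2.1
  have htv : t ^ 2 + v ^ 2 = p2 := by rw [ht2, hv2]; ring
  have hc1 : p1 / p2 - 1 = (s ^ 2 - t ^ 2) / (t ^ 2 + v ^ 2) := by
    rw [htv, hs2, ht2]; field_simp; ring
  have hc2 : (1 - p1 - p2) / p2 = (w ^ 2 - v ^ 2) / (t ^ 2 + v ^ 2) := by
    rw [htv, hw2, hv2]; ring
  have hc1' : 0 ≤ p1 / p2 - 1 := by rw [sub_nonneg, one_le_div hp]; exact hge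
  have hc2' : 0 ≤ (1 - p1 - p2) / p2 := div_nonneg (by linarith) hp.le
  have hst : p1 / p2 - 1 = 0 → s = t := fun h0 ↦ by
    rw [sub_eq_zero, div_eq_one_iff_eq hp.ne'] at h0
    rw [← sq_eq_sq₀ h.s_pos.le h.t_pos.le, hs2, ht2, h0]
  have hwv : (1 - p1 - p2) / p2 = 0 → w = v := fun h0 ↦ by
    rw [div_eq_zero_iff, or_iff_left hp.ne'] at h0
    rw [← sq_eq_sq₀ h.w_pos.le h.v_pos.le, hw2, hv2]
    linear_combination h0
  have hX := (continuous_angleMap a b s t).measurable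
  have hU (τ : ℝ) : ∫⁻ y, logKernel |log (b - a)| (τ, y)
      ∂((angleMeasure s t v w).map (angleMap a b s t))
      = ∫⁻ θ, logKernel |log (b - a)| (τ, angleMap a b s t θ) ∂(angleMeasure s t v w) :=
    lintegral_map ((measurable_logKernel _).comp measurable_prodMk_left) hX
  have hQ {τ : ℝ} (hτ : τ ∈ Set.Icc a b) (ha : p1 / p2 - 1 = 0 ∨ a < τ)
      (hb : (1 - p1 - p2) / p2 = 0 ∨ τ < b) : 0 ≤ trigField a b s t v w τ + cq := by
    have h1 : (p1 / p2 - 1) * log (τ - a) ≤ (p1 / p2 - 1) * |log (b - a)| := by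
      rcases ha with ha | ha
      · simp [ha]
      · refine mul_le_mul_of_nonneg_left (le_trans ?_ (le_abs_self _)) hc1'
        exact log_le_log (sub_pos.2 ha) (by linarith [hτ.2])
    have h2 : (1 - p1 - p2) / p2 * log (b - τ) ≤ (1 - p1 - p2) / p2 * |log (b - a)| := by
      rcases hb with hb | hb
      · simp [hb]
      · refine mul_le_mul_of_nonneg_left (le_trans ?_ (le_abs_self _)) hc2'
        exact log_le_log (sub_pos.2 hb) (by linarith [hτ.1])
    rw [trigField, ← hc1, ← hc2, ← hcq]
    linarith
  have hsum' {τ : ℝ} (hτ : τ ∈ Set.Icc a b) (ha : p1 / p2 - 1 = 0 ∨ a < τ)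
      (hb : (1 - p1 - p2) / p2 = 0 ∨ τ < b) :
      ENNReal.ofReal (-((p1 / p2 - 1) * log (τ - a)) - (1 - p1 - p2) / p2 * log (b - τ) + cq)
        + 2 * ∫⁻ θ, logKernel |log (b - a)| (τ, angleMap a b s t θ) ∂(angleMeasure s t v w)
      = ENNReal.ofReal (trigField a b s t v w τ - 2 / π * (∫ θ in 0..π,
        angleDensity s t v w θ * log |angleMap a b s t θ - τ|) + (cq + 2 * |log (b - a)|)) := by
    obtain ⟨e, hn⟩ := h.lintegral_logKernel_angleMeasure hab hτ
      (h.trigConst_le hab hτ.1 hτ.2 (ha.imp_left hst) (hb.imp_left hwv)).1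
    have h0 := hQ hτ ha hb
    rw [e, hc1, hc2, ← trigField, ← ENNReal.ofReal_ofNat 2, ← ENNReal.ofReal_mul zero_le_two,
      ← ENNReal.ofReal_add h0 (mul_nonneg zero_le_two hn)]
    congr 1
    ring
  refine ⟨ENNReal.ofReal (trigConst a b s t v w + (cq + 2 * |log (b - a)|)),
    ENNReal.ofReal_ne_top, fun τ hτ ↦ ?_, ?_⟩
  · rcases fieldQ_eq_top_or hab hτ with htop | ⟨ha, hb, e⟩
    · rw [htop, top_add]; exact le_top
    · rw [e, hU, hsum' hτ ha hb]
      have := (h.trigConst_le hab hτ.1 hτ.2 (ha.imp_left hst) (hb.imp_left hwv)).2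
      exact ENNReal.ofReal_le_ofReal (by linarith)
  · have hmem : ∀ᵐ τ ∂((angleMeasure s t v w).map (angleMap a b s t)),
        τ ∈ angleMap a b s t '' Set.Ioo 0 π := by
      refine (ae_map_iff hX.aemeasurable ?_).2
        (IsTrigParam.ae_mem_Ioo_angleMeasure.mono fun θ hθ ↦ Set.mem_image_of_mem _ hθ)
      rw [h.image_angleMap hab]
      exact measurableSet_Ioo
    filter_upwards [hmem] with τ hτ
    obtain ⟨θ, hθ, rfl⟩ := hτ
    have hI := h.angleMap_mem_Ioo hab hθ
    rw [hU, fieldQ, if_pos hI, hsum' ⟨hI.1.le, hI.2.le⟩ (.inr hI.1) (.inr hI.2),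
      h.trigField_sub_angleMap hab θ]

lemma lintegral_add_two_mul_lintegral_prod {f : ℝ → ℝ≥0∞} {k : ℝ × ℝ → ℝ≥0∞} (hk : Measurable k)
    (ρ μ : Measure ℝ) [SFinite ρ] [SFinite μ] :
    ∫⁻ τ, (f τ + 2 * ∫⁻ y, k (τ, y) ∂μ) ∂ρ = ∫⁻ τ, f τ ∂ρ + 2 * ∫⁻ p, k p ∂(ρ.prod μ) := by
  rw [lintegral_add_right _ (hk.lintegral_prod_right'.const_mul 2),
    lintegral_const_mul _ hk.lintegral_prod_right', lintegral_prod _ hk.aemeasurable]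

lemma isProbabilityMeasure_muCompact {a b p1 p2 : ℝ} (hab : a < b) (hp1 : p1 ∈ Set.Ioo (0 : ℝ) 1)
    (hp2 : p2 ∈ Set.Ioo (0 : ℝ) 1) (hge : p2 ≤ p1) (hsum : p1 + p2 ≤ 1) :
    IsProbabilityMeasure (muCompact a b p1 p2) := by
  have := (isTrigParam_sqrt hp1 hp2 hge hsum).isProbabilityMeasure_angleMeasure
  rw [muCompact_eq_map hab hp1 hp2 hge hsum]
  exact Measure.isProbabilityMeasure_map (continuous_angleMap _ _ _ _).measurable.aemeasurable

lemma muCompact_compl_Icc {a b p1 p2 : ℝ} (hab : a < b) (hp1 : p1 ∈ Set.Ioo (0 : ℝ) 1)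
    (hp2 : p2 ∈ Set.Ioo (0 : ℝ) 1) (hge : p2 ≤ p1) (hsum : p1 + p2 ≤ 1) :
    muCompact a b p1 p2 (Set.Icc a b)ᶜ = 0 := by
  have h := isTrigParam_sqrt hp1 hp2 hge hsum
  rw [muCompact_eq_map hab hp1 hp2 hge hsum, ← mem_ae_iff]
  refine (ae_map_iff (continuous_angleMap _ _ _ _).measurable.aemeasurable measurableSet_Icc).2 ?_
  exact IsTrigParam.ae_mem_Ioo_angleMeasure.mono fun θ hθ ↦
    Set.Ioo_subset_Icc_self (h.angleMap_mem_Ioo hab hθ)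

/-- If `p1 ≥ p2` and `p1 + p2 ≤ 1` (so that `μ_{a,b,p1,p2}` has no atoms),
then `μ_{a,b,p1,p2}` is the unique minimizer of the weighted logarithmic energy
`ν ↦ ∫ Q dν - ∬ log|t-s| dν dν` among all Borel probability measures on `[a,b]`. -/
theorem statement1 (a b p1 p2 : ℝ) (hab : a < b)
    (hp1 : p1 ∈ Set.Ioo (0 : ℝ) 1) (hp2 : p2 ∈ Set.Ioo (0 : ℝ) 1)
    (hge : p2 ≤ p1) (hsum : p1 + p2 ≤ 1) :
    ∀ ν : Measure ℝ, IsProbabilityMeasure ν → ν (Set.Icc a b)ᶜ = 0 →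
      ν ≠ muCompact a b p1 p2 →
      energy a b p1 p2 (muCompact a b p1 p2) < energy a b p1 p2 ν := by
  intro ν hν hνs hne
  have hμ := isProbabilityMeasure_muCompact hab hp1 hp2 hge hsum
  have hμs := muCompact_compl_Icc hab hp1 hp2 hge hsum
  obtain ⟨F, hF, hle, heq⟩ := exists_fieldQ_add_potential hab hp1 hp2 hge hsum rfl
  unfold energy
  generalize (p1 / p2 - 1 + (1 - p1 - p2) / p2) * |log (b - a)| = cq at *
  generalize muCompact a b p1 p2 = μ at *
  have hfμ : ∫⁻ τ, fieldQ a b p1 p2 cq τ ∂μ + 2 * ∫⁻ p, logKernel |log (b - a)| p ∂(μ.prod μ)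
      = F := by
    rw [← lintegral_add_two_mul_lintegral_prod (measurable_logKernel _), lintegral_congr_ae heq]
    simp
  have hfν : F ≤ ∫⁻ τ, fieldQ a b p1 p2 cq τ ∂ν
      + 2 * ∫⁻ p, logKernel |log (b - a)| p ∂(ν.prod μ) := by
    rw [← lintegral_add_two_mul_lintegral_prod (measurable_logKernel _)]
    calc F = ∫⁻ _, F ∂ν := by simp
      _ ≤ _ := lintegral_mono_ae (Filter.mem_of_superset (mem_ae_iff.2 hνs) hle)
  have hμμ : ∫⁻ p, logKernel |log (b - a)| p ∂(μ.prod μ) ≠ ⊤ := fun htop ↦ by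
    rw [htop, ENNReal.mul_top two_ne_zero, add_top] at hfμ
    exact hF hfμ.symm
  have hlt : ∫⁻ τ, fieldQ a b p1 p2 cq τ ∂μ + ∫⁻ p, logKernel |log (b - a)| p ∂(μ.prod μ)
      < ∫⁻ τ, fieldQ a b p1 p2 cq τ ∂ν + ∫⁻ p, logKernel |log (b - a)| p ∂(ν.prod ν) := by
    by_cases hqν : ∫⁻ τ, fieldQ a b p1 p2 cq τ ∂ν = ⊤
    · rw [hqν, top_add, lt_top_iff_ne_top]
      refine ne_top_of_le_ne_top hF (hfμ ▸ ?_)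
      rw [two_mul]
      gcongr
      exact le_self_add
    by_cases hνν : ∫⁻ p, logKernel |log (b - a)| p ∂(ν.prod ν) = ⊤
    · rw [hνν, add_top, lt_top_iff_ne_top]
      refine ne_top_of_le_ne_top hF (hfμ ▸ ?_)
      rw [two_mul]
      gcongr
      exact le_self_add
    have hL : b - a ≤ exp |log (b - a)| :=
      (exp_log (sub_pos.2 hab)).ge.trans (exp_le_exp.2 (le_abs_self _))
    have hpos := two_mul_lintegral_logKernel_lt (exp_pos _) hL hνs hμs hne
    rw [log_exp] at hpos
    refine lt_of_add_lt_add_right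
      (a := ∫⁻ p, logKernel |log (b - a)| p ∂(μ.prod μ)) ?_
    rw [add_assoc, ← two_mul, hfμ, add_assoc]
    exact hfν.trans_lt ((ENNReal.add_lt_add_iff_left hqν).2 (hpos hνν hμμ))
  refine EReal.sub_lt_sub_of_lt_of_le ?_ le_rfl (EReal.coe_ne_bot _) (EReal.coe_ne_top _)
  rw [← EReal.coe_ennreal_add, ← EReal.coe_ennreal_add]
  exact EReal.coe_ennreal_lt_coe_ennreal_iff.2 hlt

end
end

section
/- For each m ∈ ℕ let a_m < b_m and p1,m*, p2,m* ∈ (0,1) be given, and assume as m→∞ that a_m→0, b_m→∞, p1,m*→0, p2,m*→0, and p_{i,m}*·b_m → z_i* for i=1,2, where z1*,z2* > 0 are constants. Then the measures μ_{a_m,b_m,p1,m*,p2,m*} converge weakly, as m→∞, to the Marchenko–Pastur measure μ_{MP,z1*,z2*}; the densities of the absolutely continuous parts of μ_{a_m,b_m,p1,m*,p2,m*} converge pointwise to the density of the absolutely continuous part of μ_{MP,z1*,z2*}, uniformly on compact subsets of (l_−,l_+) where l_± = (√z1* ± √z2*)²; and for every j ≥ 1 the j-th moment of μ_{a_m,b_m,p1,m*,p2,m*}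 converges to the j-th moment of μ_{MP,z1*,z2*}. -/
open MeasureTheory Real Filter Topology Polynomial

noncomputable section
/-- Density of the absolutely continuous part of the Marchenko-Pastur measure `μ_{MP,z1,z2}`. -/
def mpDensity (z1 z2 : ℝ) (x : ℝ) : ℝ :=
  if x ∈ Set.Icc ((Real.sqrt z1 - Real.sqrt z2) ^ 2) ((Real.sqrt z1 + Real.sqrt z2) ^ 2) then
    Real.sqrt ((x - (Real.sqrt z1 - Real.sqrt z2) ^ 2) *
        ((Real.sqrt z1 + Real.sqrt z2) ^ 2 - x)) / (2 * π * z2 * x)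
  else 0

/-- The Marchenko-Pastur measure `μ_{MP,z1,z2}`. -/
def muMP (z1 z2 : ℝ) : Measure ℝ :=
  ENNReal.ofReal (max (1 - z1 / z2) 0) • Measure.dirac 0 +
    volume.withDensity (fun x => ENNReal.ofReal (mpDensity z1 z2 x))

section Limits

variable {ι : Type*} {F : Filter ι} {a b p1 p2 x : ι → ℝ} {z1 z2 x0 : ℝ}

lemma tendsto_sqrt_scaled (hab : ∀ᶠ i in F, a i < b i) (ha : Tendsto a F (𝓝 0))
    (hp1 : Tendsto p1 F (𝓝 0)) (hp2 : Tendsto p2 F (𝓝 0))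
    (h1 : Tendsto (fun i => p1 i * b i) F (𝓝 z1)) :
    Tendsto (fun i => √(b i - a i) * √(p1 i * (1 - p2 i))) F (𝓝 (√z1)) := by
  have h : Tendsto (fun i => (p1 i * b i - p1 i * a i) * (1 - p2 i)) F
      (𝓝 ((z1 - 0 * 0) * (1 - 0))) :=
    (h1.sub (hp1.mul ha)).mul (tendsto_const_nhds.sub hp2)
  have h' := h.sqrt
  rw [show (z1 - 0 * 0) * (1 - 0) = z1 by ring] at h'
  refine h'.congr' ?_
  filter_upwards [hab] with i hi
  rw [← Real.sqrt_mul (by linarith)]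
  congr 1
  ring

lemma tendsto_lmin (hab : ∀ᶠ i in F, a i < b i) (ha : Tendsto a F (𝓝 0))
    (hp1 : Tendsto p1 F (𝓝 0)) (hp2 : Tendsto p2 F (𝓝 0))
    (h1 : Tendsto (fun i => p1 i * b i) F (𝓝 z1))
    (h2 : Tendsto (fun i => p2 i * b i) F (𝓝 z2)) :
    Tendsto (fun i => lmin (a i) (b i) (p1 i) (p2 i)) F (𝓝 ((√z1 - √z2) ^ 2)) := by
  have h := ha.add (((tendsto_sqrt_scaled hab ha hp1 hp2 h1).sub
    (tendsto_sqrt_scaled hab ha hp2 hp1 h2)).pow 2)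
  rw [zero_add] at h
  refine h.congr' ?_
  filter_upwards [hab] with i hi
  rw [lmin, ← mul_sub, mul_pow, Real.sq_sqrt (by linarith)]

lemma tendsto_lmax (hab : ∀ᶠ i in F, a i < b i) (ha : Tendsto a F (𝓝 0))
    (hp1 : Tendsto p1 F (𝓝 0)) (hp2 : Tendsto p2 F (𝓝 0))
    (h1 : Tendsto (fun i => p1 i * b i) F (𝓝 z1))
    (h2 : Tendsto (fun i => p2 i * b i) F (𝓝 z2)) :
    Tendsto (fun i => lmax (a i) (b i) (p1 i) (p2 i)) F (𝓝 ((√z1 + √z2) ^ 2)) := by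
  have h := ha.add (((tendsto_sqrt_scaled hab ha hp1 hp2 h1).add
    (tendsto_sqrt_scaled hab ha hp2 hp1 h2)).pow 2)
  rw [zero_add] at h
  refine h.congr' ?_
  filter_upwards [hab] with i hi
  rw [lmax, ← mul_add, mul_pow, Real.sq_sqrt (by linarith)]

lemma tendsto_mul_sub (hp2 : Tendsto p2 F (𝓝 0))
    (h2 : Tendsto (fun i => p2 i * b i) F (𝓝 z2)) (hx : Tendsto x F (𝓝 x0)) :
    Tendsto (fun i => p2 i * (b i - x i)) F (𝓝 z2) := by
  have h := h2.sub (hp2.mul hx)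
  rw [zero_mul, sub_zero] at h
  exact h.congr fun i => by ring

lemma tendsto_compactDensity (hab : ∀ᶠ i in F, a i < b i) (ha : Tendsto a F (𝓝 0))
    (hp1 : Tendsto p1 F (𝓝 0)) (hp2 : Tendsto p2 F (𝓝 0))
    (h1 : Tendsto (fun i => p1 i * b i) F (𝓝 z1))
    (h2 : Tendsto (fun i => p2 i * b i) F (𝓝 z2)) (hz2 : 0 < z2)
    (hx : Tendsto x F (𝓝 x0))
    (hx0 : x0 ∈ Set.Ioo ((√z1 - √z2) ^ 2) ((√z1 + √z2) ^ 2)) :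
    Tendsto (fun i => compactDensity (a i) (b i) (p1 i) (p2 i) (x i)) F
      (𝓝 (mpDensity z1 z2 x0)) := by
  have hl := tendsto_lmin hab ha hp1 hp2 h1 h2
  have hu := tendsto_lmax hab ha hp1 hp2 h1 h2
  have hx0pos : 0 < x0 := (sq_nonneg _).trans_lt hx0.1
  have hden : Tendsto (fun i => 2 * π * (p2 i * (b i - x i)) * (x i - a i)) F
      (𝓝 (2 * π * z2 * (x0 - 0))) :=
    ((tendsto_mul_sub hp2 h2 hx).const_mul _).mul (hx.sub ha)
  have h := (((hx.sub hl).mul (hu.sub hx)).sqrt).div hden (by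
    rw [sub_zero]; have := Real.pi_pos; positivity)
  rw [mpDensity, if_pos (Set.Ioo_subset_Icc_self hx0)]
  rw [sub_zero] at h
  refine h.congr' ?_
  filter_upwards [hl.eventually_lt hx hx0.1, hx.eventually_lt hu hx0.2] with i hi1 hi2
  rw [compactDensity, if_pos ⟨hi1.le, hi2.le⟩, Pi.div_apply]
  congr 1
  ring

end Limits

lemma continuousAt_mpDensity {z1 z2 x0 : ℝ} (hz2 : 0 < z2)
    (hx0 : x0 ∈ Set.Ioo ((√z1 - √z2) ^ 2) ((√z1 + √z2) ^ 2)) :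
    ContinuousAt (mpDensity z1 z2) x0 := by
  have hx0pos : 0 < x0 := (sq_nonneg _).trans_lt hx0.1
  have h : ContinuousAt (fun x => √((x - (√z1 - √z2) ^ 2) * ((√z1 + √z2) ^ 2 - x)) /
      (2 * π * z2 * x)) x0 := by
    refine ContinuousAt.div (by fun_prop) (by fun_prop) ?_
    have := Real.pi_pos
    positivity
  refine h.congr ?_
  filter_upwards [Ioo_mem_nhds hx0.1 hx0.2] with x hx
  rw [mpDensity, if_pos (Set.Ioo_subset_Icc_self hx)]

lemma sqrt_mul_div_le {l u c x : ℝ} (hc : c ≤ l) (hx : x ∈ Set.Icc l u) :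
    √((x - l) * (u - x)) / (x - c) ≤ √(u - l) * (x - l) ^ (-(1 / 2) : ℝ) := by
  obtain ⟨h1, h2⟩ := hx
  rcases h1.eq_or_lt with rfl | h1
  · simp only [sub_self, zero_mul, Real.sqrt_zero, zero_div]
    positivity
  · have hpos : 0 < x - l := by linarith
    rw [Real.rpow_neg hpos.le, ← Real.sqrt_eq_rpow, Real.sqrt_mul hpos.le]
    have hs : 0 < √(x - l) := Real.sqrt_pos.2 hpos
    rw [div_le_iff₀ (by linarith), mul_comm √(u - l), mul_assoc, inv_mul_eq_div,
      le_div_iff₀ hs]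
    have e : √(x - l) * √(u - x) * √(x - l) = √(u - x) * (x - l) := by
      nth_rewrite 3 [← Real.mul_self_sqrt hpos.le]
      ring
    rw [e]
    exact mul_le_mul (Real.sqrt_le_sqrt (by linarith)) (by linarith) hpos.le (by positivity)

lemma integrableOn_sqrt_mul_div {l u c : ℝ} (hlu : l ≤ u) (hc : c ≤ l) :
    IntegrableOn (fun x => √((x - l) * (u - x)) / (x - c)) (Set.Icc l u) := by
  have h : IntegrableOn (fun x => √(u - l) * (x - l) ^ (-(1 / 2) : ℝ)) (Set.Icc l u) := by
    have h0 : IntervalIntegrable (fun x : ℝ => x ^ (-(1 / 2) : ℝ)) volume (l - l) (u - l) :=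
      intervalIntegral.intervalIntegrable_rpow' (by norm_num)
    have h1 := (h0.comp_sub_right l).const_mul √(u - l)
    simp only [sub_add_cancel] at h1
    rwa [intervalIntegrable_iff_integrableOn_Ioc_of_le hlu,
      ← integrableOn_Icc_iff_integrableOn_Ioc] at h1
  refine Integrable.mono' h (Measurable.aestronglyMeasurable (by fun_prop)) ?_
  refine (ae_restrict_iff' measurableSet_Icc).2 (Eventually.of_forall fun x hx => ?_)
  have : 0 ≤ x - c := by linarith [hx.1]
  rw [Real.norm_of_nonneg (by positivity)]
  exact sqrt_mul_div_le hc hx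

lemma integrable_indicator_mul {l u c : ℝ} (hlu : l ≤ u) (hc : c ≤ l) {h D f : ℝ → ℝ}
    (hh : ContinuousOn h (Set.Icc l u)) (hf : Continuous f)
    (hD : D = (Set.Icc l u).indicator fun x => h x * (√((x - l) * (u - x)) / (x - c))) :
    Integrable (fun x => D x * f x) := by
  have h1 : IntegrableOn (fun x => (f x * h x) * (√((x - l) * (u - x)) / (x - c)))
      (Set.Icc l u) :=
    (integrableOn_sqrt_mul_div hlu hc).continuousOn_mul (hf.continuousOn.mul hh) isCompact_Icc
  refine ((integrable_indicator_iff measurableSet_Icc).2 h1).congr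
    (Eventually.of_forall fun x => ?_)
  by_cases hx : x ∈ Set.Icc l u
  · simp only [hD, Set.indicator_of_mem hx]
    ring
  · simp only [hD, Set.indicator_of_notMem hx, zero_mul]

lemma integral_eq_unitInterval {l u : ℝ} (hlu : l < u) {G : ℝ → ℝ}
    (hG : ∀ x, x ∉ Set.Icc l u → G x = 0) :
    ∫ x, G x = ∫ t in (0 : ℝ)..1, (u - l) * G (l + (u - l) * t) := by
  rw [← setIntegral_eq_integral_of_forall_compl_eq_zero hG, integral_Icc_eq_integral_Ioc,
    ← intervalIntegral.integral_of_le hlu.le, intervalIntegral.integral_const_mul,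
    intervalIntegral.mul_integral_comp_add_mul]
  simp

lemma integrable_and_integral_withDensity {D f : ℝ → ℝ} (hDm : Measurable D)
    (hD : ∀ x, 0 ≤ D x) (hDf : Integrable (fun x => D x * f x)) :
    Integrable f (volume.withDensity fun x => ENNReal.ofReal (D x)) ∧
      ∫ x, f x ∂(volume.withDensity fun x => ENNReal.ofReal (D x)) = ∫ x, D x * f x := by
  have hlt : ∀ᵐ x ∂(volume : Measure ℝ), ENNReal.ofReal (D x) < ⊤ :=
    Eventually.of_forall fun _ => ENNReal.ofReal_lt_top
  constructor
  · rw [integrable_withDensity_iff_integrable_smul' hDm.ennreal_ofReal hlt]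
    simpa only [ENNReal.toReal_ofReal (hD _), smul_eq_mul] using hDf
  · rw [integral_withDensity_eq_integral_toReal_smul hDm.ennreal_ofReal hlt]
    simp only [ENNReal.toReal_ofReal (hD _), smul_eq_mul]

lemma integral_smul_dirac {w : ℝ} (hw : 0 ≤ w) (f : ℝ → ℝ) (y : ℝ) :
    ∫ x, f x ∂(ENNReal.ofReal w • Measure.dirac y) = w * f y := by
  rw [integral_smul_measure, integral_dirac, ENNReal.toReal_ofReal hw, smul_eq_mul]

lemma integrable_smul_dirac (w : ℝ) (f : ℝ → ℝ) (y : ℝ) :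
    Integrable f (ENNReal.ofReal w • Measure.dirac y) :=
  (integrable_dirac (by simp)).smul_measure ENNReal.ofReal_ne_top

lemma le_lmin {a b : ℝ} (hab : a ≤ b) (p1 p2 : ℝ) : a ≤ lmin a b p1 p2 := by
  have : 0 ≤ b - a := by linarith
  rw [lmin, le_add_iff_nonneg_right]
  positivity

lemma compactDensity_eq_indicator (a b p1 p2 : ℝ) :
    compactDensity a b p1 p2 = (Set.Icc (lmin a b p1 p2) (lmax a b p1 p2)).indicator fun x =>
      (2 * π * (p2 * (b - x)))⁻¹ *
        (√((x - lmin a b p1 p2) * (lmax a b p1 p2 - x)) / (x - a)) := by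
  funext x
  rw [compactDensity, Set.indicator]
  split_ifs
  · rw [inv_mul_eq_div, div_div]
    congr 1
    ring
  · rfl

lemma mpDensity_eq_indicator (z1 z2 : ℝ) :
    mpDensity z1 z2 = (Set.Icc ((√z1 - √z2) ^ 2) ((√z1 + √z2) ^ 2)).indicator fun x =>
      (2 * π * z2)⁻¹ * (√((x - (√z1 - √z2) ^ 2) * ((√z1 + √z2) ^ 2 - x)) / (x - 0)) := by
  funext x
  rw [mpDensity, Set.indicator]
  split_ifs
  · rw [inv_mul_eq_div, div_div, sub_zero]
    congr 1
    ring
  · rfl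

lemma measurable_compactDensity (a b p1 p2 : ℝ) : Measurable (compactDensity a b p1 p2) := by
  rw [compactDensity_eq_indicator]
  exact Measurable.indicator (by fun_prop) measurableSet_Icc

lemma measurable_mpDensity (z1 z2 : ℝ) : Measurable (mpDensity z1 z2) := by
  rw [mpDensity_eq_indicator]
  exact Measurable.indicator (by fun_prop) measurableSet_Icc

lemma compactDensity_nonneg {a b p1 p2 : ℝ} (hab : a ≤ b) (hp2 : 0 < p2)
    (hub : lmax a b p1 p2 < b) (x : ℝ) : 0 ≤ compactDensity a b p1 p2 x := by
  rw [compactDensity_eq_indicator]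
  refine Set.indicator_nonneg (fun x hx => ?_) x
  have h1 : 0 ≤ x - a := by linarith [hx.1, le_lmin hab p1 p2]
  have h2 : 0 ≤ b - x := by linarith [hx.2]
  have := Real.pi_pos
  positivity

lemma mpDensity_nonneg {z1 z2 : ℝ} (hz2 : 0 < z2) (x : ℝ) : 0 ≤ mpDensity z1 z2 x := by
  rw [mpDensity_eq_indicator]
  refine Set.indicator_nonneg (fun x hx => ?_) x
  have h1 : 0 ≤ x - 0 := by linarith [hx.1, sq_nonneg (√z1 - √z2)]
  have := Real.pi_pos
  positivity

lemma compactDensity_le {a b p1 p2 x : ℝ} (hx : lmin a b p1 p2 ≤ x) (hab : a ≤ b) (hp2 : 0 < p2)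
    (hub : lmax a b p1 p2 < b) :
    compactDensity a b p1 p2 x ≤ (2 * π * (p2 * (b - lmax a b p1 p2)))⁻¹ *
      (√(lmax a b p1 p2 - lmin a b p1 p2) * (x - lmin a b p1 p2) ^ (-(1 / 2) : ℝ)) := by
  have hpi := Real.pi_pos
  have hu : 0 < b - lmax a b p1 p2 := by linarith
  rw [compactDensity_eq_indicator]
  by_cases hx' : x ∈ Set.Icc (lmin a b p1 p2) (lmax a b p1 p2)
  · rw [Set.indicator_of_mem hx']
    have h1 : 0 ≤ x - a := by linarith [hx'.1, le_lmin hab p1 p2]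
    refine mul_le_mul ?_ (sqrt_mul_div_le (le_lmin hab p1 p2) hx') (by positivity) (by positivity)
    have h2 : b - lmax a b p1 p2 ≤ b - x := by linarith [hx'.2]
    gcongr
  · rw [Set.indicator_of_notMem hx']
    have : 0 ≤ x - lmin a b p1 p2 := by linarith
    positivity

lemma sq_sub_lt_sq_add {z1 z2 : ℝ} (hz1 : 0 < z1) (hz2 : 0 < z2) :
    (√z1 - √z2) ^ 2 < (√z1 + √z2) ^ 2 := by
  have h1 := Real.sqrt_pos.2 hz1
  have h2 := Real.sqrt_pos.2 hz2
  nlinarith [mul_pos h1 h2]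

lemma integral_muMP {z1 z2 : ℝ} (hz2 : 0 < z2) {f : ℝ → ℝ}
    (hf : Continuous f) :
    ∫ x, f x ∂(muMP z1 z2) = max (1 - z1 / z2) 0 * f 0 + ∫ x, mpDensity z1 z2 x * f x := by
  have hle : (√z1 - √z2) ^ 2 ≤ (√z1 + √z2) ^ 2 := by
    nlinarith [mul_nonneg (Real.sqrt_nonneg z1) (Real.sqrt_nonneg z2)]
  obtain ⟨h1, h2⟩ := integrable_and_integral_withDensity (measurable_mpDensity z1 z2)
    (mpDensity_nonneg hz2) (integrable_indicator_mul hle (sq_nonneg _) continuousOn_const hf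
      (mpDensity_eq_indicator z1 z2))
  rw [muMP, integral_add_measure (integrable_smul_dirac _ _ _) h1, h2,
    integral_smul_dirac (le_max_right _ _)]

lemma integral_muCompact {a b p1 p2 : ℝ} (hab : a ≤ b) (hp2 : 0 < p2)
    (hlu : lmin a b p1 p2 ≤ lmax a b p1 p2) (hub : lmax a b p1 p2 < b) (hp : p1 + p2 ≤ 1)
    {f : ℝ → ℝ} (hf : Continuous f) :
    ∫ x, f x ∂(muCompact a b p1 p2) =
      max (1 - p1 / p2) 0 * f a + ∫ x, compactDensity a b p1 p2 x * f x := by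
  have hh : ContinuousOn (fun x => (2 * π * (p2 * (b - x)))⁻¹)
      (Set.Icc (lmin a b p1 p2) (lmax a b p1 p2)) := by
    refine ContinuousOn.inv₀ (by fun_prop) fun x hx => ?_
    have : 0 < b - x := by linarith [hx.2]
    have := Real.pi_pos
    positivity
  obtain ⟨h1, h2⟩ := integrable_and_integral_withDensity (measurable_compactDensity a b p1 p2)
    (compactDensity_nonneg hab hp2 hub) (integrable_indicator_mul hlu (le_lmin hab p1 p2) hh hf
      (compactDensity_eq_indicator a b p1 p2))
  have h3 : (p1 + p2 - 1) / p2 ≤ 0 := div_nonpos_of_nonpos_of_nonneg (by linarith) hp2.le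
  rw [muCompact, integral_add_measure (h1.add_measure (integrable_smul_dirac _ _ _))
      (integrable_smul_dirac _ _ _), integral_add_measure h1 (integrable_smul_dirac _ _ _), h2,
    integral_smul_dirac (le_max_right _ _), integral_smul_dirac (le_max_right _ _),
    max_eq_right h3, zero_mul, add_zero, add_comm]

lemma tendsto_integral_compactDensity_mul {a b p1 p2 : ℕ → ℝ} {z1 z2 : ℝ}
    (hab : ∀ m, a m < b m) (hp2 : ∀ m, 0 < p2 m)
    (ha : Tendsto a atTop (𝓝 0)) (hb : Tendsto b atTop atTop)
    (hp10 : Tendsto p1 atTop (𝓝 0)) (hp20 : Tendsto p2 atTop (𝓝 0))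
    (h1 : Tendsto (fun m => p1 m * b m) atTop (𝓝 z1))
    (h2 : Tendsto (fun m => p2 m * b m) atTop (𝓝 z2))
    (hz1 : 0 < z1) (hz2 : 0 < z2) {f : ℝ → ℝ} (hf : Continuous f) :
    Tendsto (fun m => ∫ x, compactDensity (a m) (b m) (p1 m) (p2 m) x * f x) atTop
      (𝓝 (∫ x, mpDensity z1 z2 x * f x)) := by
  have hab' := Eventually.of_forall (f := atTop) hab
  have hl := tendsto_lmin hab' ha hp10 hp20 h1 h2
  have hu := tendsto_lmax hab' ha hp10 hp20 h1 h2
  have hLU := sq_sub_lt_sq_add hz1 hz2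
  set l := fun m => lmin (a m) (b m) (p1 m) (p2 m)
  set u := fun m => lmax (a m) (b m) (p1 m) (p2 m)
  set L := (√z1 - √z2) ^ 2
  set U := (√z1 + √z2) ^ 2
  have hlu : ∀ᶠ m in atTop, l m < u m := hl.eventually_lt hu hLU
  have hub : ∀ᶠ m in atTop, u m < b m := by
    filter_upwards [hu.eventually_lt_const (lt_add_one U), hb.eventually_gt_atTop (U + 1)]
      with m h3 h4
    exact h3.trans h4
  obtain ⟨M, hM⟩ := isCompact_Icc.exists_bound_of_continuousOn (s := Set.Icc (L - 1) (U + 1))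
    hf.continuousOn
  rw [integral_eq_unitInterval hLU fun x hx => by
    rw [mpDensity_eq_indicator, Set.indicator_of_notMem hx, zero_mul]]
  have hcongr : (fun m => ∫ t in (0 : ℝ)..1, (u m - l m) *
        (compactDensity (a m) (b m) (p1 m) (p2 m) (l m + (u m - l m) * t) *
          f (l m + (u m - l m) * t))) =ᶠ[atTop]
      fun m => ∫ x, compactDensity (a m) (b m) (p1 m) (p2 m) x * f x := by
    filter_upwards [hlu] with m hm
    rw [integral_eq_unitInterval hm fun x hx => by
      rw [compactDensity_eq_indicator, Set.indicator_of_notMem hx, zero_mul]]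
  refine Tendsto.congr' hcongr ?_
  refine intervalIntegral.tendsto_integral_filter_of_dominated_convergence
    (fun t => (U - L + 1) * ((2 * π * (z2 / 2))⁻¹ * t ^ (-(1 / 2) : ℝ) * M)) ?_ ?_ ?_ ?_
  · refine Eventually.of_forall fun m => Measurable.aestronglyMeasurable ?_
    have := measurable_compactDensity (a m) (b m) (p1 m) (p2 m)
    have := hf.measurable
    fun_prop
  · filter_upwards [hlu, hub, hl.eventually_const_lt (sub_one_lt L),
      hu.eventually_lt_const (lt_add_one U),
      (hu.sub hl).eventually_lt_const (lt_add_one (U - L)),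
      (tendsto_mul_sub hp20 h2 hu).eventually_const_lt (half_lt_self hz2)]
      with m hm1 hm2 hm3 hm4 hm5 hm6
    refine Eventually.of_forall fun t ht => ?_
    rw [Set.uIoc_of_le zero_le_one] at ht
    have hd : 0 < u m - l m := by linarith
    have hx1 : L - 1 ≤ l m + (u m - l m) * t := by nlinarith [ht.1]
    have hx2 : l m + (u m - l m) * t ≤ U + 1 := by nlinarith [ht.2]
    have hD0 := compactDensity_nonneg (hab m).le (hp2 m) hm2 (l m + (u m - l m) * t)
    have hD : compactDensity (a m) (b m) (p1 m) (p2 m) (l m + (u m - l m) * t) ≤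
        (2 * π * (z2 / 2))⁻¹ * t ^ (-(1 / 2) : ℝ) := by
      have e : √(u m - l m) * (l m + (u m - l m) * t - l m) ^ (-(1 / 2) : ℝ) =
          t ^ (-(1 / 2) : ℝ) := by
        rw [add_sub_cancel_left, Real.mul_rpow hd.le ht.1.le, Real.rpow_neg hd.le,
          ← Real.sqrt_eq_rpow, ← mul_assoc, mul_inv_cancel₀ (Real.sqrt_pos.2 hd).ne', one_mul]
      refine (compactDensity_le (by change l m ≤ _; nlinarith [ht.1]) (hab m).le (hp2 m) hm2).trans ?_
      have := Real.rpow_nonneg ht.1.le (-(1 / 2))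
      have := Real.pi_pos
      refine (mul_le_mul_of_nonneg_left e.le ?_).trans ?_
      · have : 0 < b m - u m := by linarith
        have := hp2 m
        positivity
      · gcongr
    rw [norm_mul, norm_mul, Real.norm_of_nonneg hd.le, Real.norm_of_nonneg hD0]
    exact mul_le_mul hm5.le (mul_le_mul hD (hM _ ⟨hx1, hx2⟩) (norm_nonneg _) (hD0.trans hD))
      (by positivity) (by linarith)
  · exact (((intervalIntegral.intervalIntegrable_rpow' (by norm_num)).const_mul _).mul_const
      _).const_mul _
  · have hne : ∀ᵐ t : ℝ, t ≠ 1 := by simp [ae_iff]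
    filter_upwards [hne] with t ht1 ht
    rw [Set.uIoc_of_le zero_le_one] at ht
    have ht1' : t < 1 := lt_of_le_of_ne ht.2 ht1
    have hx : Tendsto (fun m => l m + (u m - l m) * t) atTop (𝓝 (L + (U - L) * t)) :=
      hl.add ((hu.sub hl).mul_const t)
    refine (hu.sub hl).mul (Tendsto.mul ?_ ((hf.tendsto _).comp hx))
    refine tendsto_compactDensity hab' ha hp10 hp20 h1 h2 hz2 hx ⟨?_, ?_⟩
    · nlinarith [ht.1]
    · nlinarith

lemma tendsto_integral_muCompact {a b p1 p2 : ℕ → ℝ} {z1 z2 : ℝ}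
    (hab : ∀ m, a m < b m) (hp2 : ∀ m, 0 < p2 m)
    (ha : Tendsto a atTop (𝓝 0)) (hb : Tendsto b atTop atTop)
    (hp10 : Tendsto p1 atTop (𝓝 0)) (hp20 : Tendsto p2 atTop (𝓝 0))
    (h1 : Tendsto (fun m => p1 m * b m) atTop (𝓝 z1))
    (h2 : Tendsto (fun m => p2 m * b m) atTop (𝓝 z2))
    (hz1 : 0 < z1) (hz2 : 0 < z2) {f : ℝ → ℝ} (hf : Continuous f) :
    Tendsto (fun m => ∫ x, f x ∂(muCompact (a m) (b m) (p1 m) (p2 m))) atTop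
      (𝓝 (∫ x, f x ∂(muMP z1 z2))) := by
  have hab' := Eventually.of_forall (f := atTop) hab
  have hl := tendsto_lmin hab' ha hp10 hp20 h1 h2
  have hu := tendsto_lmax hab' ha hp10 hp20 h1 h2
  have hratio : Tendsto (fun m => p1 m / p2 m) atTop (𝓝 (z1 / z2)) := by
    refine (h1.div h2 hz2.ne').congr' ?_
    filter_upwards [hb.eventually_gt_atTop 0] with m hm
    exact mul_div_mul_right _ _ hm.ne'
  have hatom := ((tendsto_const_nhds (x := (1 : ℝ))).sub hratio).max
    (tendsto_const_nhds (x := (0 : ℝ)))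
  rw [integral_muMP hz2 hf]
  refine ((hatom.mul ((hf.tendsto _).comp ha)).add (tendsto_integral_compactDensity_mul
    hab hp2 ha hb hp10 hp20 h1 h2 hz1 hz2 hf)).congr' ?_
  filter_upwards [hl.eventually_lt hu (sq_sub_lt_sq_add hz1 hz2),
    hu.eventually_lt_const (lt_add_one _), hb.eventually_gt_atTop ((√z1 + √z2) ^ 2 + 1),
    (hp10.add hp20).eventually_lt_const (u := 1) (by norm_num)] with m hm1 hm2 hm3 hm4
  exact (integral_muCompact (hab m).le (hp2 m) hm1.le (hm2.trans hm3) hm4.le hf).symm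

/-- Free Poisson limit: if `a_m → 0`, `b_m → ∞`, `p_{i,m}* → 0` with
`p_{i,m}* b_m → z_i* > 0`, then `μ_{a_m,b_m,p1_m,p2_m}` converges weakly to the
Marchenko-Pastur measure `μ_{MP,z1*,z2*}`, the densities of the absolutely continuous parts
converge pointwise on `(l₋,l₊)` and uniformly on compact subsets of `(l₋,l₊)`, and all
moments converge. -/
theorem statement2 (a b p1 p2 : ℕ → ℝ) (z1s z2s : ℝ)
    (hab : ∀ m, a m < b m)
    (hp1 : ∀ m, p1 m ∈ Set.Ioo (0 : ℝ) 1) (hp2 : ∀ m, p2 m ∈ Set.Ioo (0 : ℝ) 1)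
    (ha : Tendsto a atTop (𝓝 0)) (hb : Tendsto b atTop atTop)
    (hp10 : Tendsto p1 atTop (𝓝 0)) (hp20 : Tendsto p2 atTop (𝓝 0))
    (h1 : Tendsto (fun m => p1 m * b m) atTop (𝓝 z1s))
    (h2 : Tendsto (fun m => p2 m * b m) atTop (𝓝 z2s))
    (hz1 : 0 < z1s) (hz2 : 0 < z2s) :
    (∀ f : BoundedContinuousFunction ℝ ℝ,
      Tendsto (fun m => ∫ x, f x ∂(muCompact (a m) (b m) (p1 m) (p2 m))) atTop
        (𝓝 (∫ x, f x ∂(muMP z1s z2s)))) ∧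
    (∀ x ∈ Set.Ioo ((Real.sqrt z1s - Real.sqrt z2s) ^ 2) ((Real.sqrt z1s + Real.sqrt z2s) ^ 2),
      Tendsto (fun m => compactDensity (a m) (b m) (p1 m) (p2 m) x) atTop
        (𝓝 (mpDensity z1s z2s x))) ∧
    (∀ K : Set ℝ, IsCompact K →
      K ⊆ Set.Ioo ((Real.sqrt z1s - Real.sqrt z2s) ^ 2) ((Real.sqrt z1s + Real.sqrt z2s) ^ 2) →
      TendstoUniformlyOn (fun m x => compactDensity (a m) (b m) (p1 m) (p2 m) x)
        (mpDensity z1s z2s) atTop K) ∧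
    (∀ j : ℕ, 1 ≤ j →
      Tendsto (fun m => ∫ x, x ^ j ∂(muCompact (a m) (b m) (p1 m) (p2 m))) atTop
        (𝓝 (∫ x, x ^ j ∂(muMP z1s z2s)))) := by
  have hab' := Eventually.of_forall (f := atTop) hab
  have hcont {f : ℝ → ℝ} (hf : Continuous f) := tendsto_integral_muCompact hab
    (fun m => (hp2 m).1) ha hb hp10 hp20 h1 h2 hz1 hz2 hf
  refine ⟨fun f => hcont f.continuous, fun x hx => ?_, fun K hK hKs => ?_,
    fun j _ => hcont (continuous_pow j)⟩
  · exact tendsto_compactDensity hab' ha hp10 hp20 h1 h2 hz2 tendsto_const_nhds hx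
  · rw [← tendstoLocallyUniformlyOn_iff_tendstoUniformlyOn_of_compact hK,
      tendstoLocallyUniformlyOn_iff_filter]
    intro x hx
    have hfst : Tendsto (Prod.fst : ℕ × ℝ → ℕ) (atTop ×ˢ 𝓝[K] x) atTop := tendsto_fst
    have hsnd : Tendsto (Prod.snd : ℕ × ℝ → ℝ) (atTop ×ˢ 𝓝[K] x) (𝓝 x) :=
      tendsto_snd.mono_right nhdsWithin_le_nhds
    have hlim := tendsto_compactDensity (hfst.eventually hab') (ha.comp hfst) (hp10.comp hfst)
      (hp20.comp hfst) (h1.comp hfst) (h2.comp hfst) hz2 hsnd (hKs hx)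
    rw [tendstoUniformlyOnFilter_iff_tendsto]
    refine Tendsto.mono_right ?_ (nhds_le_uniformity (mpDensity z1s z2s x))
    exact ((continuousAt_mpDensity hz2 (hKs hx)).tendsto.comp hsnd).prodMk_nhds hlim

end
end

section
/- For each m ∈ ℕ let a_m < b_m and p1,m*, p2,m* ∈ (0,1) be given, and assume as m→∞ that a_m → −∞, b_m → ∞, p2,m*·|a_m|·b_m → β*, and a_m + (b_m − a_m)·p1,m* → α*, where α* ∈ ℝ and β* > 0 are constants. Then the measures μ_{a_m,b_m,p1,m*,p2,m*} converge weakly, as m→∞, to the semicircle measure μ_{SC,α*,β*}; the densities of the absolutely continuous parts of μ_{a_m,b_m,p1,m*,p2,m*} converge pointwise to the density of μ_{SC,α*,β*}, uniformly on compact subsets of (l_−,l_+) where l_± = α* ± 2√β*; and for every j ≥ 1 the j-th moment of μ_{a_m,b_m,p1,m*,p2,m*} converges to the j-th moment of μ_{SC,α*,β*}. -/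
open MeasureTheory Real Filter Topology Polynomial

noncomputable section
/-- Density of the semicircle measure `μ_{SC,α,β}`. -/
def scDensity (al be : ℝ) (x : ℝ) : ℝ :=
  if x ∈ Set.Icc (al - 2 * Real.sqrt be) (al + 2 * Real.sqrt be) then
    Real.sqrt (4 * be - (x - al) ^ 2) / (2 * π * be)
  else 0

/-- The semicircle measure `μ_{SC,α,β}`. -/
def muSC (al be : ℝ) : Measure ℝ :=
  volume.withDensity (fun x => ENNReal.ofReal (scDensity al be x))

/-- The function `√((x - u) (v - x)) / (2π (c₀ + c₁ x - c₂ x²))` of `x`, where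
`θ = (u, v, c₀, c₁, c₂)`. -/
def sqrtQuotient (θ : ℝ × ℝ × ℝ × ℝ × ℝ) (x : ℝ) : ℝ :=
  Real.sqrt ((x - θ.1) * (θ.2.1 - x)) /
    (2 * π * (θ.2.2.1 + θ.2.2.2.1 * x - θ.2.2.2.2 * x ^ 2))

lemma measurable_sqrtQuotient (θ : ℝ × ℝ × ℝ × ℝ × ℝ) : Measurable (sqrtQuotient θ) := by
  unfold sqrtQuotient
  fun_prop

lemma sqrtQuotient_eq_zero {θ : ℝ × ℝ × ℝ × ℝ × ℝ} {x : ℝ} (h : θ.1 ≤ θ.2.1)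
    (hx : x ∉ Set.Icc θ.1 θ.2.1) : sqrtQuotient θ x = 0 := by
  have : (x - θ.1) * (θ.2.1 - x) ≤ 0 := by
    rcases not_and_or.mp hx with hx | hx
    · exact mul_nonpos_of_nonpos_of_nonneg (by linarith) (by linarith)
    · exact mul_nonpos_of_nonneg_of_nonpos (by linarith) (by linarith)
  rw [sqrtQuotient, Real.sqrt_eq_zero_of_nonpos this, zero_div]

lemma lmin_le_lmax {a b : ℝ} (p1 p2 : ℝ) (hab : a ≤ b) : lmin a b p1 p2 ≤ lmax a b p1 p2 := by
  have := mul_nonneg (sub_nonneg.2 hab) (mul_nonneg (Real.sqrt_nonneg (p1 * (1 - p2)))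
    (Real.sqrt_nonneg (p2 * (1 - p1))))
  unfold lmin lmax
  linarith

lemma compactDensity_eq_sqrtQuotient {a b : ℝ} (p1 p2 : ℝ) (hab : a ≤ b) :
    compactDensity a b p1 p2 = sqrtQuotient
      (lmin a b p1 p2, lmax a b p1 p2, -(p2 * a * b), p2 * a + p2 * b, p2) := by
  ext x
  unfold compactDensity
  split_ifs with h
  · unfold sqrtQuotient
    congr 1
    ring
  · exact (sqrtQuotient_eq_zero (lmin_le_lmax p1 p2 hab) h).symm

lemma scDensity_eq_sqrtQuotient (al : ℝ) {be : ℝ} (hbe : 0 ≤ be) :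
    scDensity al be = sqrtQuotient
      (al - 2 * Real.sqrt be, al + 2 * Real.sqrt be, be, 0, 0) := by
  ext x
  unfold scDensity
  split_ifs with h
  · unfold sqrtQuotient
    congr 2
    · linear_combination -4 * Real.sq_sqrt hbe
    · ring
  · exact (sqrtQuotient_eq_zero (by dsimp; linarith [Real.sqrt_nonneg be]) h).symm

lemma continuousAt_uncurry_sqrtQuotient {θ : ℝ × ℝ × ℝ × ℝ × ℝ} {x : ℝ}
    (h : θ.2.2.1 + θ.2.2.2.1 * x - θ.2.2.2.2 * x ^ 2 ≠ 0) :
    ContinuousAt (fun q : (ℝ × ℝ × ℝ × ℝ × ℝ) × ℝ => sqrtQuotient q.1 q.2) (θ, x) := by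
  unfold sqrtQuotient
  refine ContinuousAt.div (by fun_prop) (by fun_prop) ?_
  exact mul_ne_zero (by positivity) h

section Convergence

variable {ι : Type*} {l : Filter ι} {θ : ι → ℝ × ℝ × ℝ × ℝ × ℝ} {u v c : ℝ}

lemma continuous_sqrtQuotient_const (u v : ℝ) (hc : c ≠ 0) :
    Continuous (sqrtQuotient (u, v, c, 0, 0)) :=
  continuous_iff_continuousAt.2 fun x =>
    (continuousAt_uncurry_sqrtQuotient (θ := (u, v, c, 0, 0)) (x := x) (by simpa using hc)).comp
      (f := fun y => ((u, v, c, 0, 0), y)) (by fun_prop)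

lemma tendstoLocallyUniformly_sqrtQuotient (hθ : Tendsto θ l (𝓝 (u, v, c, 0, 0)))
    (hc : c ≠ 0) :
    TendstoLocallyUniformly (fun i => sqrtQuotient (θ i)) (sqrtQuotient (u, v, c, 0, 0)) l := by
  rw [tendstoLocallyUniformly_iff_forall_tendsto]
  intro x
  have h1 : Tendsto (fun q : ι × ℝ => sqrtQuotient (θ q.1) q.2) (l ×ˢ 𝓝 x)
      (𝓝 (sqrtQuotient (u, v, c, 0, 0) x)) :=
    (continuousAt_uncurry_sqrtQuotient (θ := (u, v, c, 0, 0)) (x := x)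
      (by simpa using hc)).tendsto.comp
      (((hθ.comp tendsto_fst).prodMk_nhds tendsto_snd))
  have h2 : Tendsto (fun q : ι × ℝ => sqrtQuotient (u, v, c, 0, 0) q.2) (l ×ˢ 𝓝 x)
      (𝓝 (sqrtQuotient (u, v, c, 0, 0) x)) :=
    ((continuous_sqrtQuotient_const u v hc).tendsto x).comp tendsto_snd
  exact (h2.prodMk_nhds h1).mono_right (nhds_le_uniformity _)

lemma integral_withDensity_ofReal {g : ℝ → ℝ} (hg : Measurable g) (f : ℝ → ℝ) :
    ∫ x, f x ∂(volume.withDensity fun x => ENNReal.ofReal (g x)) =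
      ∫ x, max (g x) 0 * f x := by
  rw [integral_withDensity_eq_integral_toReal_smul hg.ennreal_ofReal (by simp)]
  simp [ENNReal.toReal_ofReal']

lemma tendsto_integral_withDensity_sqrtQuotient [l.IsCountablyGenerated]
    (hθ : Tendsto θ l (𝓝 (u, v, c, 0, 0))) (huv : u ≤ v) (hc : c ≠ 0)
    (hle : ∀ i, (θ i).1 ≤ (θ i).2.1) {f : ℝ → ℝ} (hf : Continuous f) :
    Tendsto (fun i => ∫ x, f x ∂(volume.withDensity fun x =>
        ENNReal.ofReal (sqrtQuotient (θ i) x))) l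
      (𝓝 (∫ x, f x ∂(volume.withDensity fun x =>
        ENNReal.ofReal (sqrtQuotient (u, v, c, 0, 0) x)))) := by
  simp_rw [integral_withDensity_ofReal (measurable_sqrtQuotient _)]
  have hg := continuous_sqrtQuotient_const u v hc
  set g := sqrtQuotient (u, v, c, 0, 0)
  set K := Set.Icc (u - 1) (v + 1)
  have hset {ϑ : ℝ × ℝ × ℝ × ℝ × ℝ} (h : ϑ.1 ≤ ϑ.2.1) (hu : u - 1 < ϑ.1) (hv : ϑ.2.1 < v + 1) :
      ∫ x in K, max (sqrtQuotient ϑ x) 0 * f x = ∫ x, max (sqrtQuotient ϑ x) 0 * f x :=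
    setIntegral_eq_integral_of_forall_compl_eq_zero fun x hx => by
      rw [sqrtQuotient_eq_zero h fun hx' => hx ⟨hu.le.trans hx'.1, hx'.2.trans hv.le⟩]
      simp
  have hu : ∀ᶠ i in l, u - 1 < (θ i).1 :=
    (continuous_fst.continuousAt.tendsto.comp hθ).eventually (lt_mem_nhds (by simp))
  have hv : ∀ᶠ i in l, (θ i).2.1 < v + 1 :=
    ((continuous_fst.comp continuous_snd).continuousAt.tendsto.comp hθ).eventually
      (gt_mem_nhds (by simp))
  have hlu := tendstoLocallyUniformly_sqrtQuotient hθ hc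
  have hunif := (tendstoLocallyUniformlyOn_iff_tendstoUniformlyOn_of_compact
    (isCompact_Icc : IsCompact K)).1 hlu.tendstoLocallyUniformlyOn
  rw [← hset (ϑ := (u, v, c, 0, 0)) huv (by simp) (by simp)]
  refine Tendsto.congr' (f₁ := fun i => ∫ x in K, max (sqrtQuotient (θ i) x) 0 * f x)
    (by filter_upwards [hu, hv] with i h1 h2 using hset (hle i) h1 h2) ?_
  refine tendsto_integral_filter_of_dominated_convergence
    (fun x => (|g x| + 1) * |f x|) ?_ ?_ ?_ ?_
  · exact .of_forall fun i => (((measurable_sqrtQuotient _).max measurable_const).mul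
      hf.measurable).aestronglyMeasurable
  · filter_upwards [Metric.tendstoUniformlyOn_iff.1 hunif 1 one_pos] with i hi
    filter_upwards [ae_restrict_mem measurableSet_Icc] with x hx
    have h1 := hi x hx
    rw [Real.dist_eq] at h1
    rw [norm_mul, Real.norm_eq_abs, Real.norm_eq_abs]
    gcongr
    rw [abs_of_nonneg (le_max_right _ _)]
    refine max_le ?_ (by positivity)
    linarith [neg_abs_le (g x - sqrtQuotient (θ i) x), le_abs_self (g x)]
  · exact (by fun_prop : Continuous fun x => (|g x| + 1) * |f x|).continuousOn.integrableOn_Icc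
  · filter_upwards with x
    have h1 : Tendsto (fun i => sqrtQuotient (θ i) x) l (𝓝 (g x)) :=
      (hlu.tendstoLocallyUniformlyOn (s := Set.univ)).tendsto_at (Set.mem_univ x)
    exact (h1.max tendsto_const_nhds).mul_const _

end Convergence

lemma sub_mul_sqrt_mul_sqrt {a b p1 p2 : ℝ} (hab : a ≤ b) (hp1 : p1 ∈ Set.Ioo (0 : ℝ) 1)
    (hp2 : p2 ∈ Set.Ioo (0 : ℝ) 1) :
    (b - a) * (Real.sqrt (p1 * (1 - p2)) * Real.sqrt (p2 * (1 - p1))) =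
      Real.sqrt ((b - a) * p1 * ((b - a) * (1 - p1)) * (p2 * (1 - p2))) := by
  rw [← Real.sqrt_mul (mul_nonneg hp1.1.le (by linarith [hp2.2]))]
  nth_rw 1 [← Real.sqrt_sq (sub_nonneg.2 hab)]
  rw [← Real.sqrt_mul (sq_nonneg _)]
  congr 1
  ring

lemma lmin_eq {a b p1 p2 : ℝ} (hab : a ≤ b) (hp1 : p1 ∈ Set.Ioo (0 : ℝ) 1)
    (hp2 : p2 ∈ Set.Ioo (0 : ℝ) 1) :
    lmin a b p1 p2 = a + (b - a) * (p1 * (1 - p2) + p2 * (1 - p1)) -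
      2 * Real.sqrt ((b - a) * p1 * ((b - a) * (1 - p1)) * (p2 * (1 - p2))) := by
  rw [← sub_mul_sqrt_mul_sqrt hab hp1 hp2, lmin]
  have h1 := Real.sq_sqrt (mul_nonneg hp1.1.le (by linarith [hp2.2] : 0 ≤ 1 - p2))
  have h2 := Real.sq_sqrt (mul_nonneg hp2.1.le (by linarith [hp1.2] : 0 ≤ 1 - p1))
  linear_combination (b - a) * (h1 + h2)

lemma lmax_eq {a b p1 p2 : ℝ} (hab : a ≤ b) (hp1 : p1 ∈ Set.Ioo (0 : ℝ) 1)
    (hp2 : p2 ∈ Set.Ioo (0 : ℝ) 1) :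
    lmax a b p1 p2 = a + (b - a) * (p1 * (1 - p2) + p2 * (1 - p1)) +
      2 * Real.sqrt ((b - a) * p1 * ((b - a) * (1 - p1)) * (p2 * (1 - p2))) := by
  rw [← sub_mul_sqrt_mul_sqrt hab hp1 hp2, lmax]
  have h1 := Real.sq_sqrt (mul_nonneg hp1.1.le (by linarith [hp2.2] : 0 ≤ 1 - p2))
  have h2 := Real.sq_sqrt (mul_nonneg hp2.1.le (by linarith [hp1.2] : 0 ≤ 1 - p1))
  linear_combination (b - a) * (h1 + h2)

lemma muCompact_eq_withDensity {a b p1 p2 : ℝ} (hp2 : 0 < p2) (h1 : p2 ≤ p1)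
    (h2 : p1 + p2 ≤ 1) :
    muCompact a b p1 p2 =
      volume.withDensity (fun x => ENNReal.ofReal (compactDensity a b p1 p2 x)) := by
  have e1 : max (1 - p1 / p2) 0 = 0 := max_eq_right (by linarith [(one_le_div hp2).2 h1])
  have e2 : max ((p1 + p2 - 1) / p2) 0 = 0 :=
    max_eq_right (div_nonpos_of_nonpos_of_nonneg (by linarith) hp2.le)
  simp [muCompact, e1, e2]

section Asymptotics

variable {a b p1 p2 : ℕ → ℝ} {als bes : ℝ}

lemma tendsto_param_mul_left (ha : Tendsto a atTop atBot) (hb : Tendsto b atTop atTop)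
    (h1 : Tendsto (fun m => p2 m * |a m| * b m) atTop (𝓝 bes)) :
    Tendsto (fun m => p2 m * a m) atTop (𝓝 0) := by
  have h := (h1.div_atTop hb).neg
  rw [neg_zero] at h
  refine h.congr' ?_
  filter_upwards [hb.eventually_gt_atTop 0, ha.eventually_lt_atBot 0] with m hm hm'
  rw [abs_of_neg hm']
  field_simp

lemma tendsto_param_mul_right (ha : Tendsto a atTop atBot)
    (h1 : Tendsto (fun m => p2 m * |a m| * b m) atTop (𝓝 bes)) :
    Tendsto (fun m => p2 m * b m) atTop (𝓝 0) := by
  refine (h1.div_atTop (tendsto_abs_atBot_atTop.comp ha)).congr' ?_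
  filter_upwards [ha.eventually_lt_atBot 0] with m hm
  have : |a m| ≠ 0 := abs_ne_zero.2 hm.ne
  simp only [Function.comp_apply]
  field_simp

lemma tendsto_param (ha : Tendsto a atTop atBot) (hb : Tendsto b atTop atTop)
    (h1 : Tendsto (fun m => p2 m * |a m| * b m) atTop (𝓝 bes)) :
    Tendsto p2 atTop (𝓝 0) := by
  refine ((tendsto_param_mul_right ha h1).div_atTop hb).congr' ?_
  filter_upwards [hb.eventually_gt_atTop 0] with m hm
  field_simp

lemma tendsto_neg_param_mul_mul (ha : Tendsto a atTop atBot)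
    (h1 : Tendsto (fun m => p2 m * |a m| * b m) atTop (𝓝 bes)) :
    Tendsto (fun m => -(p2 m * a m * b m)) atTop (𝓝 bes) := by
  refine h1.congr' ?_
  filter_upwards [ha.eventually_lt_atBot 0] with m hm
  rw [abs_of_neg hm]
  ring

lemma tendsto_center (ha : Tendsto a atTop atBot) (hb : Tendsto b atTop atTop)
    (h1 : Tendsto (fun m => p2 m * |a m| * b m) atTop (𝓝 bes))
    (h2 : Tendsto (fun m => a m + (b m - a m) * p1 m) atTop (𝓝 als)) :
    Tendsto (fun m => a m + (b m - a m) * (p1 m * (1 - p2 m) + p2 m * (1 - p1 m)))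
      atTop (𝓝 als) := by
  have h := ((h2.add (tendsto_param_mul_right ha h1)).add (tendsto_param_mul_left ha hb h1)).sub
    (((tendsto_param ha hb h1).mul h2).const_mul 2)
  simp only [zero_mul, mul_zero, add_zero, sub_zero] at h
  refine h.congr fun m => ?_
  ring

lemma tendsto_variance (ha : Tendsto a atTop atBot) (hb : Tendsto b atTop atTop)
    (h1 : Tendsto (fun m => p2 m * |a m| * b m) atTop (𝓝 bes))
    (h2 : Tendsto (fun m => a m + (b m - a m) * p1 m) atTop (𝓝 als)) :
    Tendsto (fun m => (b m - a m) * p1 m * ((b m - a m) * (1 - p1 m)) * (p2 m * (1 - p2 m)))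
      atTop (𝓝 bes) := by
  have hp := tendsto_param ha hb h1
  have h := ((hp.const_sub 1)).mul
    ((((tendsto_param_mul_right ha h1).mul h2).sub (hp.mul (h2.pow 2))).add
      (tendsto_neg_param_mul_mul ha h1) |>.add ((tendsto_param_mul_left ha hb h1).mul h2))
  simp only [zero_mul, sub_zero, add_zero, zero_add, one_mul] at h
  refine h.congr fun m => ?_
  ring

lemma tendsto_sqrtQuotient_param (hab : ∀ m, a m < b m)
    (hp1 : ∀ m, p1 m ∈ Set.Ioo (0 : ℝ) 1) (hp2 : ∀ m, p2 m ∈ Set.Ioo (0 : ℝ) 1)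
    (ha : Tendsto a atTop atBot) (hb : Tendsto b atTop atTop)
    (h1 : Tendsto (fun m => p2 m * |a m| * b m) atTop (𝓝 bes))
    (h2 : Tendsto (fun m => a m + (b m - a m) * p1 m) atTop (𝓝 als)) :
    Tendsto (fun m => (lmin (a m) (b m) (p1 m) (p2 m), lmax (a m) (b m) (p1 m) (p2 m),
        -(p2 m * a m * b m), p2 m * a m + p2 m * b m, p2 m)) atTop
      (𝓝 (als - 2 * Real.sqrt bes, als + 2 * Real.sqrt bes, bes, 0, 0)) := by
  have hc := tendsto_center ha hb h1 h2
  have hs := (tendsto_variance ha hb h1 h2).sqrt.const_mul 2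
  have h0 := (tendsto_param_mul_left ha hb h1).add (tendsto_param_mul_right ha h1)
  rw [add_zero] at h0
  refine .prodMk_nhds ?_ (.prodMk_nhds ?_ ((tendsto_neg_param_mul_mul ha h1).prodMk_nhds
    (h0.prodMk_nhds (tendsto_param ha hb h1))))
  · exact (hc.sub hs).congr fun m => (lmin_eq (hab m).le (hp1 m) (hp2 m)).symm
  · exact (hc.add hs).congr fun m => (lmax_eq (hab m).le (hp1 m) (hp2 m)).symm

lemma eventually_muCompact_eq_withDensity (hab : ∀ m, a m < b m)
    (hp2 : ∀ m, p2 m ∈ Set.Ioo (0 : ℝ) 1)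
    (ha : Tendsto a atTop atBot) (hb : Tendsto b atTop atTop)
    (h1 : Tendsto (fun m => p2 m * |a m| * b m) atTop (𝓝 bes))
    (h2 : Tendsto (fun m => a m + (b m - a m) * p1 m) atTop (𝓝 als)) :
    ∀ᶠ m in atTop, muCompact (a m) (b m) (p1 m) (p2 m) = volume.withDensity
      (fun x => ENNReal.ofReal (compactDensity (a m) (b m) (p1 m) (p2 m) x)) := by
  have h0 := (tendsto_param_mul_right ha h1).sub (tendsto_param_mul_left ha hb h1)
  rw [sub_zero] at h0
  have hl := h2.add_atTop (tendsto_neg_atBot_atTop.comp ha)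
  have hr := h2.neg.add_atTop hb
  filter_upwards [h0.eventually (gt_mem_nhds one_pos), hl.eventually_gt_atTop 1,
    hr.eventually_gt_atTop 1] with m hm0 hml hmr
  have hd : 0 < b m - a m := sub_pos.2 (hab m)
  simp only [Function.comp_apply] at hml
  refine muCompact_eq_withDensity (hp2 m).1 ?_ ?_
  · refine le_of_mul_le_mul_left ?_ hd
    linarith
  · refine le_of_mul_le_mul_left ?_ hd
    linarith

end Asymptotics

/-- Free CLT: if `a_m → -∞`, `b_m → ∞`, `p2_m |a_m| b_m → β* > 0` and
`a_m + (b_m - a_m) p1_m → α*`, then `μ_{a_m,b_m,p1_m,p2_m}` converges weakly to the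
semicircle measure `μ_{SC,α*,β*}`, the densities of the absolutely continuous parts
converge pointwise on `(l₋,l₊)` and uniformly on compact subsets of `(l₋,l₊)`, and all
moments converge. -/
theorem statement3 (a b p1 p2 : ℕ → ℝ) (als bes : ℝ)
    (hab : ∀ m, a m < b m)
    (hp1 : ∀ m, p1 m ∈ Set.Ioo (0 : ℝ) 1) (hp2 : ∀ m, p2 m ∈ Set.Ioo (0 : ℝ) 1)
    (ha : Tendsto a atTop atBot) (hb : Tendsto b atTop atTop)
    (h1 : Tendsto (fun m => p2 m * |a m| * b m) atTop (𝓝 bes))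
    (h2 : Tendsto (fun m => a m + (b m - a m) * p1 m) atTop (𝓝 als))
    (hbes : 0 < bes) :
    (∀ f : BoundedContinuousFunction ℝ ℝ,
      Tendsto (fun m => ∫ x, f x ∂(muCompact (a m) (b m) (p1 m) (p2 m))) atTop
        (𝓝 (∫ x, f x ∂(muSC als bes)))) ∧
    (∀ x ∈ Set.Ioo (als - 2 * Real.sqrt bes) (als + 2 * Real.sqrt bes),
      Tendsto (fun m => compactDensity (a m) (b m) (p1 m) (p2 m) x) atTop
        (𝓝 (scDensity als bes x))) ∧
    (∀ K : Set ℝ, IsCompact K →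
      K ⊆ Set.Ioo (als - 2 * Real.sqrt bes) (als + 2 * Real.sqrt bes) →
      TendstoUniformlyOn (fun m x => compactDensity (a m) (b m) (p1 m) (p2 m) x)
        (scDensity als bes) atTop K) ∧
    (∀ j : ℕ, 1 ≤ j →
      Tendsto (fun m => ∫ x, x ^ j ∂(muCompact (a m) (b m) (p1 m) (p2 m))) atTop
        (𝓝 (∫ x, x ^ j ∂(muSC als bes)))) := by
  have hθ := tendsto_sqrtQuotient_param hab hp1 hp2 ha hb h1 h2
  have hsc := scDensity_eq_sqrtQuotient als hbes.le
  have hlu : TendstoLocallyUniformly (fun m x => compactDensity (a m) (b m) (p1 m) (p2 m) x)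
      (scDensity als bes) atTop := by
    simp_rw [compactDensity_eq_sqrtQuotient _ _ (hab _).le]
    exact hsc ▸ tendstoLocallyUniformly_sqrtQuotient hθ hbes.ne'
  have hint (f : ℝ → ℝ) (hf : Continuous f) :
      Tendsto (fun m => ∫ x, f x ∂(muCompact (a m) (b m) (p1 m) (p2 m))) atTop
        (𝓝 (∫ x, f x ∂(muSC als bes))) := by
    have h := tendsto_integral_withDensity_sqrtQuotient hθ
      (by linarith [Real.sqrt_nonneg bes]) hbes.ne'
      (fun m => lmin_le_lmax (p1 m) (p2 m) (hab m).le) hf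
    rw [muSC, hsc]
    refine h.congr' ?_
    filter_upwards [eventually_muCompact_eq_withDensity hab hp2 ha hb h1 h2] with m hm
    rw [hm, compactDensity_eq_sqrtQuotient _ _ (hab m).le]
  refine ⟨fun f => hint f f.continuous, fun x _ => ?_, fun K hK _ => ?_,
    fun j _ => hint _ (continuous_pow j)⟩
  · exact (hlu.tendstoLocallyUniformlyOn (s := Set.univ)).tendsto_at (Set.mem_univ x)
  · exact (tendstoLocallyUniformlyOn_iff_tendstoUniformlyOn_of_compact hK).1
      hlu.tendstoLocallyUniformlyOn

end
end

section
/- For n ≥ 1 define φ_{2n}: (ℝ×(0,∞))^n → ℝ^{2n} by φ_{2n}(α_1,β_1,…,α_n,β_n) = ((T)_{11},(T²)_{11},…,(T^{2n})_{11}), where T is the (n+1)×(n+1) symmetric tridiagonal matrix with diagonal entries (α_1,…,α_n,0) and off-diagonal entries (√β_1,…,√β_n). Then φ_{2n} is a bijection from (ℝ×(0,∞))^n onto the interior of the moment space M_{2n}(ℝ); in particular, for every (m_1,…,m_{2n}) ∈ Int(M_{2n}(ℝ)) there are unique recursion coefficients (α_1,β_1,…,α_n,β_n) ∈ (ℝ×(0,∞))^n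 whose associated Jacobi-matrix moments (T^k)_{11}, k=1,…,2n, equal (m_1,…,m_{2n}). -/
open MeasureTheory Real Filter Topology Polynomial

noncomputable section
/-- The `n`-th moment space of Borel probability measures supported on `E ⊆ ℝ`
with all moments finite. -/
def momentSpace (E : Set ℝ) (n : ℕ) : Set (Fin n → ℝ) :=
  {v | ∃ μ : Measure ℝ, IsProbabilityMeasure μ ∧ μ Eᶜ = 0 ∧
      (∀ j : ℕ, Integrable (fun x => x ^ j) μ) ∧
      ∀ j : Fin n, v j = ∫ x, x ^ ((j : ℕ) + 1) ∂μ}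
/-- The symmetric tridiagonal (Jacobi) matrix of size `(N+1) × (N+1)` with diagonal entries
`a 0, a 1, …, a N` and off-diagonal entries `√(b 0), …, √(b (N-1))`. -/
def jacobiT (N : ℕ) (a b : ℕ → ℝ) : Matrix (Fin (N + 1)) (Fin (N + 1)) ℝ :=
  Matrix.of fun i j =>
    if (i : ℕ) = (j : ℕ) then a (i : ℕ)
    else if (i : ℕ) + 1 = (j : ℕ) then Real.sqrt (b (i : ℕ))
    else if (j : ℕ) + 1 = (i : ℕ) then Real.sqrt (b (j : ℕ))
    else 0

/-- Extension of a `Fin n`-indexed vector to `ℕ` by zero. -/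
def finExt {n : ℕ} (v : Fin n → ℝ) : ℕ → ℝ := fun i => if h : i < n then v ⟨i, h⟩ else 0

namespace Matrix

/-- Uniqueness of the Cholesky factorization. -/
theorem IsUpperTriangular.eq_of_transpose_mul_self_eq {ι : Type*} [Fintype ι] [LinearOrder ι]
    {V W : Matrix ι ι ℝ} (hV : V.IsUpperTriangular) (hW : W.IsUpperTriangular)
    (hV0 : ∀ i, 0 < V i i) (hW0 : ∀ i, 0 < W i i) (h : Vᵀ * V = Wᵀ * W) : V = W := by
  have hdet : IsUnit V.det := by
    rw [det_of_isUpperTriangular hV]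
    exact (Finset.prod_pos fun i _ => hV0 i).ne'.isUnit
  let := invertibleOfIsUnitDet V hdet
  obtain ⟨U, hU⟩ : ∃ U, U = W * V⁻¹ := ⟨_, rfl⟩
  have hUt : U.IsUpperTriangular := hU ▸ hW.mul (blockTriangular_inv_of_blockTriangular hV)
  have hUV : U * V = W := by
    rw [hU, Matrix.mul_assoc, nonsing_inv_mul _ hdet, Matrix.mul_one]
  have hUU : Uᵀ * U = 1 := by
    rw [hU, transpose_mul, Matrix.mul_assoc, ← Matrix.mul_assoc Wᵀ, ← h, Matrix.mul_assoc Vᵀ,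
      mul_nonsing_inv _ hdet, Matrix.mul_one, ← transpose_mul, mul_nonsing_inv _ hdet,
      transpose_one]
  have hUinv : U⁻¹ = Uᵀ := inv_eq_left_inv hUU
  let := invertibleOfLeftInverse U _ hUU
  have hUt' : Uᵀ.IsUpperTriangular := hUinv ▸ blockTriangular_inv_of_blockTriangular hUt
  have hd : U = diagonal U.diag := by
    ext i j
    rcases lt_trichotomy i j with hij | rfl | hij
    · rw [diagonal_apply_ne _ hij.ne]
      exact hUt' hij
    · simp
    · rw [diagonal_apply_ne _ hij.ne']
      exact hUt hij
  ext i j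
  have hpos : 0 < U i i := by
    have := congrFun (congrFun hUV i) i
    rw [hd, diagonal_mul] at this
    exact pos_of_mul_pos_left (this ▸ hW0 i) (hV0 i).le
  have hsq : U i i * U i i = 1 := by
    have := congrFun (congrFun hUU i) i
    rw [hd, diagonal_transpose, diagonal_mul_diagonal] at this
    simpa using this
  have hone : U i i = 1 := by nlinarith
  have := congrFun (congrFun hUV i) j
  rw [hd, diagonal_mul, diag_apply, hone, one_mul] at this
  exact this

/-- Existence of the Cholesky factorization of a real positive definite matrix. -/
theorem PosDef.exists_isUpperTriangular_transpose_mul_self {N : ℕ}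
    {H : Matrix (Fin N) (Fin N) ℝ} (hH : H.PosDef) :
    ∃ V : Matrix (Fin N) (Fin N) ℝ, V.IsUpperTriangular ∧ (∀ i, 0 < V i i) ∧ Vᵀ * V = H := by
  obtain ⟨B, hB⟩ : ∃ B : Matrix (Fin N) (Fin N) ℝ, H = Bᵀ * B := by
    open scoped MatrixOrder in
    obtain ⟨B, hB⟩ := CStarAlgebra.nonneg_iff_eq_star_mul_self.mp hH.posSemidef.nonneg
    exact ⟨B, by simpa [star_eq_conjTranspose] using hB⟩
  have hBu : IsUnit B.det := by
    have := (isUnit_iff_isUnit_det _).1 hH.isUnit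
    rw [hB, det_mul] at this
    exact isUnit_of_mul_isUnit_right this
  let f : Fin N → EuclideanSpace ℝ (Fin N) := fun k => WithLp.toLp 2 (B.col k)
  have hf : LinearIndependent ℝ f := by
    have h1 : LinearIndependent ℝ B.col :=
      linearIndependent_cols_of_isUnit ((isUnit_iff_isUnit_det _).2 hBu)
    exact h1.map' (WithLp.linearEquiv 2 ℝ (Fin N → ℝ)).symm.toLinearMap (LinearEquiv.ker _)
  have hcard : Module.finrank ℝ (EuclideanSpace ℝ (Fin N)) = Fintype.card (Fin N) := by simp
  let o := InnerProductSpace.gramSchmidtOrthonormalBasis hcard f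
  refine ⟨of fun i k => inner ℝ (o i) (f k), fun i j hij =>
    InnerProductSpace.gramSchmidtOrthonormalBasis_inv_triangular hcard f hij, fun i => ?_, ?_⟩
  · have hne := InnerProductSpace.gramSchmidt_ne_zero (𝕜 := ℝ) i hf
    have hne' : InnerProductSpace.gramSchmidtNormed ℝ f i ≠ 0 := by
      simpa [InnerProductSpace.gramSchmidtNormed] using hne
    have key : inner ℝ (InnerProductSpace.gramSchmidt ℝ f i) (f i)
        = ‖InnerProductSpace.gramSchmidt ℝ f i‖ ^ 2 := by
      conv_lhs => rw [InnerProductSpace.gramSchmidt_def'' ℝ f i]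
      rw [inner_add_right, inner_sum, Finset.sum_eq_zero, add_zero, real_inner_self_eq_norm_sq]
      intro j hj
      rw [inner_smul_right, InnerProductSpace.gramSchmidt_orthogonal ℝ f
        (Finset.mem_Iio.1 hj).ne', mul_zero]
    simp only [of_apply, o]
    rw [InnerProductSpace.gramSchmidtOrthonormalBasis_apply hcard hne',
      InnerProductSpace.gramSchmidtNormed, inner_smul_left, key]
    have := norm_pos_iff.2 hne
    simp only [RCLike.ofReal_real_eq_id, id_eq, conj_trivial]
    positivity
  · rw [hB]
    ext j k
    have := o.sum_inner_mul_inner (f j) (f k)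
    simp only [mul_apply, transpose_apply, of_apply]
    simp_rw [real_inner_comm (f j)] at this ⊢
    rw [this]
    simp [f, PiLp.inner_apply, mul_comm]

end Matrix

open scoped Matrix

/-- The Hankel matrix `(c (i + j))` of size `N` attached to a sequence `c`. -/
def hankel (N : ℕ) (c : ℕ → ℝ) : Matrix (Fin N) (Fin N) ℝ :=
  Matrix.of fun i j => c (i + j)

/-- The matrix whose `k`-th column is `T ^ k` applied to the first basis vector. -/
def krylov {N : ℕ} (T : Matrix (Fin (N + 1)) (Fin (N + 1)) ℝ) :
    Matrix (Fin (N + 1)) (Fin (N + 1)) ℝ :=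
  Matrix.of fun i k => (T ^ (k : ℕ)) i 0

theorem krylov_transpose_mul_self {N : ℕ} {T : Matrix (Fin (N + 1)) (Fin (N + 1)) ℝ}
    (hT : T.IsSymm) : (krylov T)ᵀ * krylov T = hankel (N + 1) fun j => (T ^ j) 0 0 := by
  ext j k
  have hs : ∀ i, (T ^ (j : ℕ)) i 0 = (T ^ (j : ℕ)) 0 i := fun i => (hT.pow j).apply 0 i
  simp [Matrix.mul_apply, krylov, hankel, hs, pow_add]

section jacobiT

variable {N : ℕ} {a b : ℕ → ℝ}

theorem jacobiT_isSymm : (jacobiT N a b).IsSymm := by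
  ext i j
  simp only [jacobiT, Matrix.transpose_apply, Matrix.of_apply]
  split_ifs <;> first | omega | simp_all

theorem jacobiT_apply_eq_zero {i j : Fin (N + 1)} (h : (j : ℕ) + 1 < i) :
    jacobiT N a b i j = 0 := by
  simp only [jacobiT, Matrix.of_apply]
  split_ifs <;> first | omega | rfl

theorem jacobiT_apply_self (i : Fin (N + 1)) : jacobiT N a b i i = a i := by
  simp [jacobiT]

theorem jacobiT_apply_succ {i j : Fin (N + 1)} (h : (j : ℕ) + 1 = i) :
    jacobiT N a b i j = √(b j) := by
  simp only [jacobiT, Matrix.of_apply]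
  split_ifs <;> first | omega | rfl

theorem jacobiT_pow_apply_eq_zero {k : ℕ} {i : Fin (N + 1)} (h : k < i) :
    (jacobiT N a b ^ k) i 0 = 0 := by
  induction k generalizing i with
  | zero => simpa using Matrix.one_apply_ne (α := ℝ) (Fin.pos_iff_ne_zero.1 h)
  | succ k ih =>
    rw [pow_succ', Matrix.mul_apply]
    refine Finset.sum_eq_zero fun j _ => ?_
    rcases lt_or_ge k j with hj | hj
    · rw [ih hj, mul_zero]
    · rw [jacobiT_apply_eq_zero (by omega), zero_mul]

theorem jacobiT_pow_apply_pos (hb : ∀ i < N, 0 < b i) {i : Fin (N + 1)} {k : ℕ} (hk : k = i) :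
    0 < (jacobiT N a b ^ k) i 0 := by
  induction k generalizing i with
  | zero =>
    obtain rfl : i = 0 := Fin.ext hk.symm
    simp
  | succ k ih =>
    have hk' : k < N + 1 := by omega
    rw [pow_succ', Matrix.mul_apply, Finset.sum_eq_single (⟨k, hk'⟩ : Fin (N + 1))]
    · rw [jacobiT_apply_succ hk]
      exact mul_pos (Real.sqrt_pos.2 (hb k (by omega))) (ih rfl)
    · intro j _ hj
      rcases lt_trichotomy k j with h | h | h
      · rw [jacobiT_pow_apply_eq_zero h, mul_zero]
      · exact absurd (Fin.ext h.symm) hj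
      · rw [jacobiT_apply_eq_zero (by omega), zero_mul]
    · simp

theorem krylov_jacobiT_isUpperTriangular : (krylov (jacobiT N a b)).IsUpperTriangular :=
  fun _ _ h => jacobiT_pow_apply_eq_zero h

theorem krylov_jacobiT_diag_pos (hb : ∀ i < N, 0 < b i) (i : Fin (N + 1)) :
    0 < krylov (jacobiT N a b) i i :=
  jacobiT_pow_apply_pos hb rfl

theorem posDef_hankel_jacobiT (hb : ∀ i < N, 0 < b i) :
    (hankel (N + 1) fun j => (jacobiT N a b ^ j) 0 0).PosDef := by
  rw [← krylov_transpose_mul_self jacobiT_isSymm]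
  have hu : IsUnit (krylov (jacobiT N a b)) := by
    rw [Matrix.isUnit_iff_isUnit_det,
      Matrix.det_of_isUpperTriangular krylov_jacobiT_isUpperTriangular]
    exact (Finset.prod_pos fun i _ => krylov_jacobiT_diag_pos hb i).ne'.isUnit
  simpa using Matrix.PosDef.conjTranspose_mul_self _ (Matrix.mulVec_injective_of_isUnit hu)

/-- The Hankel matrix of its moments determines a Jacobi matrix up to the last diagonal entry. -/
theorem jacobiT_apply_eq_of_hankel_eq {a' b' : ℕ → ℝ} (hb : ∀ i < N, 0 < b i)
    (hb' : ∀ i < N, 0 < b' i)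
    (h : (hankel (N + 1) fun j => (jacobiT N a b ^ j) 0 0) =
      hankel (N + 1) fun j => (jacobiT N a' b' ^ j) 0 0)
    (i j : Fin (N + 1)) (hj : (j : ℕ) < N) : jacobiT N a b i j = jacobiT N a' b' i j := by
  have hV : krylov (jacobiT N a b) = krylov (jacobiT N a' b') :=
    krylov_jacobiT_isUpperTriangular.eq_of_transpose_mul_self_eq krylov_jacobiT_isUpperTriangular
      (krylov_jacobiT_diag_pos hb) (krylov_jacobiT_diag_pos hb')
      (by rw [krylov_transpose_mul_self jacobiT_isSymm,
        krylov_transpose_mul_self jacobiT_isSymm, h])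
  have hpow : ∀ k ≤ N, ∀ i, (jacobiT N a b ^ k) i 0 = (jacobiT N a' b' ^ k) i 0 := fun k hk i =>
    congrFun (congrFun hV i) ⟨k, by omega⟩
  induction hm : (j : ℕ) using Nat.strong_induction_on generalizing j with
  | _ m ih =>
    subst hm
    have key := hpow (j + 1) hj i
    rw [pow_succ', pow_succ', Matrix.mul_apply, Matrix.mul_apply,
      ← sub_eq_zero, ← Finset.sum_sub_distrib, Finset.sum_eq_single j] at key
    · rw [← hpow j hj.le j, ← sub_mul] at key
      exact sub_eq_zero.1
        ((mul_eq_zero.1 key).resolve_right (jacobiT_pow_apply_pos hb rfl).ne')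
    · intro l _ hl
      rw [← hpow j hj.le l]
      rcases lt_trichotomy l j with h | h | h
      · rw [ih l h l (lt_trans h hj) rfl, sub_self]
      · exact absurd h hl
      · rw [jacobiT_pow_apply_eq_zero h, mul_zero, mul_zero, sub_self]
    · simp

end jacobiT

theorem finExt_apply {n : ℕ} (v : Fin n → ℝ) (i : Fin n) : finExt v i = v i := by
  simp [finExt]

/-- Every positive definite Hankel matrix with `c 0 = 1` comes from a Jacobi matrix. -/
theorem exists_jacobiT_of_posDef_hankel {n : ℕ} {c : ℕ → ℝ} (hc : c 0 = 1)
    (hH : (hankel (n + 1) c).PosDef) :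
    ∃ a b : Fin n → ℝ, (∀ i, 0 < b i) ∧
      (hankel (n + 1) fun j => (jacobiT n (finExt a) (finExt b) ^ j) 0 0) = hankel (n + 1) c := by
  obtain ⟨V, hVt, hV0, hVH⟩ := hH.exists_isUpperTriangular_transpose_mul_self
  have hdet : IsUnit V.det := by
    rw [Matrix.det_of_isUpperTriangular hVt]
    exact (Finset.prod_pos fun i _ => hV0 i).ne'.isUnit
  let := Matrix.invertibleOfIsUnitDet V hdet
  obtain ⟨W, hW⟩ : ∃ W, W = V⁻¹ := ⟨_, rfl⟩
  have hWt : W.IsUpperTriangular := hW ▸ Matrix.blockTriangular_inv_of_blockTriangular hVt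
  have hVW : V * W = 1 := hW ▸ Matrix.mul_nonsing_inv _ hdet
  have hWV : W * V = 1 := hW ▸ Matrix.nonsing_inv_mul _ hdet
  have hW0 : ∀ i, 0 < W i i := by
    intro i
    have h1 := congrFun (congrFun hWV i) i
    rw [Matrix.mul_apply, Finset.sum_eq_single i, Matrix.one_apply_eq] at h1
    · exact pos_of_mul_pos_left (h1 ▸ one_pos) (hV0 i).le
    · intro l _ hl
      rcases lt_or_gt_of_ne hl with h | h
      · rw [hWt h, zero_mul]
      · rw [hVt h, mul_zero]
    · simp
  have hV00 : V 0 0 = 1 := by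
    have h1 := congrFun (congrFun hVH 0) 0
    rw [Matrix.mul_apply, Finset.sum_eq_single 0] at h1
    · simp only [Matrix.transpose_apply, hankel, Matrix.of_apply, Fin.val_zero, add_zero, hc] at h1
      nlinarith [hV0 0]
    · intro l _ hl
      rw [hVt (Fin.pos_iff_ne_zero.2 hl), mul_zero]
    · simp
  let K : Matrix (Fin (n + 1)) (Fin (n + 1)) ℝ := hankel (n + 1) fun j => c (j + 1)
  obtain ⟨T, hT⟩ : ∃ T, T = Wᵀ * K * W := ⟨_, rfl⟩
  have hKs : Kᵀ = K := by
    ext i j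
    simp [K, hankel, add_comm]
  have hTs : ∀ i j, T i j = T j i := by
    intro i j
    have : Tᵀ = T := by
      rw [hT, Matrix.transpose_mul, Matrix.transpose_mul, Matrix.transpose_transpose, hKs,
        Matrix.mul_assoc]
    exact (congrFun (congrFun this i) j).symm
  have hTV : ∀ (i k l : Fin (n + 1)), (k : ℕ) + 1 = l → (T * V) i k = V i l := by
    intro i k l hkl
    have h1 : T * V = Wᵀ * K := by
      rw [hT, Matrix.mul_assoc, hWV, Matrix.mul_one]
    have h2 : V = Wᵀ * hankel (n + 1) c := by
      rw [← hVH, ← Matrix.mul_assoc, ← Matrix.transpose_mul, hVW, Matrix.transpose_one,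
        Matrix.one_mul]
    rw [h1]
    conv_rhs => rw [h2]
    simp [Matrix.mul_apply, K, hankel, ← hkl, add_assoc]
  have hTW : ∀ i j, T i j = ∑ k, (T * V) i k * W k j := by
    intro i j
    rw [← Matrix.mul_apply, Matrix.mul_assoc, hVW, Matrix.mul_one]
  have hTz : ∀ i j : Fin (n + 1), (j : ℕ) + 1 < i → T i j = 0 := by
    intro i j hij
    rw [hTW]
    refine Finset.sum_eq_zero fun k _ => ?_
    rcases lt_or_ge j k with h | h
    · rw [hWt h, mul_zero]
    · rw [hTV i k ⟨k + 1, by omega⟩ rfl, hVt (show (⟨k + 1, _⟩ : Fin (n + 1)) < i from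
        Fin.lt_def.2 (by simp; omega)), zero_mul]
  have hTp : ∀ i j : Fin (n + 1), (j : ℕ) + 1 = i → 0 < T i j := by
    intro i j hij
    rw [hTW, Finset.sum_eq_single j, hTV i j i hij]
    · exact mul_pos (hV0 i) (hW0 j)
    · intro k _ hk
      rcases lt_or_gt_of_ne hk with h | h
      · rw [hTV i k ⟨k + 1, by omega⟩ rfl, hVt (show (⟨k + 1, _⟩ : Fin (n + 1)) < i from
          Fin.lt_def.2 (by simp; omega)), zero_mul]
      · rw [hWt h, mul_zero]
    · simp
  let a : Fin n → ℝ := fun i => T i.castSucc i.castSucc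
  let b : Fin n → ℝ := fun i => T i.succ i.castSucc ^ 2
  have hb : ∀ i, 0 < b i := fun i => pow_pos (hTp _ _ (by simp)) 2
  have hsqrt : ∀ i : Fin n, √(finExt b i) = T i.succ i.castSucc := by
    intro i
    rw [finExt_apply]
    exact Real.sqrt_sq (hTp _ _ (by simp)).le
  have hJ : ∀ i j : Fin (n + 1), (j : ℕ) < n → jacobiT n (finExt a) (finExt b) i j = T i j := by
    intro i j hj
    obtain ⟨j, rfl⟩ : ∃ j' : Fin n, j = j'.castSucc := ⟨⟨j, hj⟩, rfl⟩
    rcases lt_trichotomy (i : ℕ) j with h | h | h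
    · rw [jacobiT_isSymm.apply, hTs]
      rcases Nat.lt_or_ge (i + 1) j with h' | h'
      · rw [jacobiT_apply_eq_zero h', hTz _ _ h']
      · have hij : (i : ℕ) + 1 = j := by omega
        obtain ⟨i, rfl⟩ : ∃ i' : Fin n, i = i'.castSucc := ⟨⟨i, by omega⟩, rfl⟩
        rw [jacobiT_apply_succ hij]
        simp only [Fin.val_castSucc]
        rw [hsqrt]
        congr 1
        exact Fin.ext hij
    · obtain rfl : i = j.castSucc := Fin.ext h
      rw [jacobiT_apply_self]
      exact finExt_apply a j
    · rcases Nat.lt_or_ge (j + 1) i with h' | h'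
      · rw [jacobiT_apply_eq_zero h', hTz _ _ h']
      · obtain rfl : i = j.succ := Fin.ext (by simp; omega)
        rw [jacobiT_apply_succ (by simp)]
        exact hsqrt j
  have hpow : ∀ (k : ℕ) (i l : Fin (n + 1)), k = l →
      (jacobiT n (finExt a) (finExt b) ^ k) i 0 = V i l := by
    intro k
    induction k with
    | zero =>
      intro i l hl
      obtain rfl : l = 0 := Fin.ext hl.symm
      rcases eq_or_ne i 0 with rfl | hi
      · simp [hV00]
      · rw [hVt (Fin.pos_iff_ne_zero.2 hi), pow_zero, Matrix.one_apply_ne hi]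
    | succ k ih =>
      intro i l hl
      have hk : k < n + 1 := by omega
      rw [pow_succ', Matrix.mul_apply, ← hTV i ⟨k, hk⟩ l hl, Matrix.mul_apply]
      refine Finset.sum_congr rfl fun j _ => ?_
      rw [ih j ⟨k, hk⟩ rfl]
      rcases lt_or_ge k (j : ℕ) with h | h
      · rw [hVt (show (⟨k, hk⟩ : Fin (n + 1)) < j from h), mul_zero, mul_zero]
      · rw [hJ i j (by omega)]
  refine ⟨a, b, hb, ?_⟩
  rw [← krylov_transpose_mul_self jacobiT_isSymm, ← hVH]
  have : krylov (jacobiT n (finExt a) (finExt b)) = V := by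
    ext i k
    exact hpow k i k rfl
  rw [this]

theorem Matrix.IsHermitian.exists_pow_apply_self_eq_sum {ι : Type*} [Fintype ι] [DecidableEq ι]
    {A : Matrix ι ι ℝ} (hA : A.IsHermitian) (e : ι) :
    ∃ w x : ι → ℝ, (∀ i, 0 ≤ w i) ∧ ∀ k : ℕ, (A ^ k) e e = ∑ i, w i * x i ^ k := by
  let U : Matrix ι ι ℝ := hA.eigenvectorUnitary
  refine ⟨fun i => U e i ^ 2, hA.eigenvalues, fun i => sq_nonneg _, fun k => ?_⟩
  have h : A ^ k = U * Matrix.diagonal (fun i => hA.eigenvalues i ^ k) * star U := by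
    conv_lhs => rw [hA.spectral_theorem, ← map_pow, Matrix.diagonal_pow]
    rfl
  rw [h, Matrix.mul_apply]
  refine Finset.sum_congr rfl fun i _ => ?_
  rw [Matrix.mul_diagonal, Matrix.star_apply, star_trivial]
  ring

theorem sum_weights_mem_momentSpace {ι : Type*} [Fintype ι] {w x : ι → ℝ} (hw : ∀ i, 0 ≤ w i)
    (hw1 : ∑ i, w i = 1) (N : ℕ) :
    (fun k : Fin N => ∑ i, w i * x i ^ ((k : ℕ) + 1)) ∈ momentSpace Set.univ N := by
  refine ⟨∑ i, ENNReal.ofReal (w i) • Measure.dirac (x i), ⟨?_⟩, by simp, fun j => ?_, fun j => ?_⟩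
  · simp only [Measure.coe_finsetSum, Measure.coe_smul, Finset.sum_apply, Pi.smul_apply,
      measure_univ, smul_eq_mul, mul_one]
    rw [← ENNReal.ofReal_sum_of_nonneg fun i _ => hw i, hw1, ENNReal.ofReal_one]
  · refine integrable_finsetSum_measure.2 fun i _ => Integrable.smul_measure ?_ (by simp)
    exact integrable_dirac (by simp)
  · rw [integral_finsetSum_measure]
    · simp [integral_smul_measure, hw]
    · intro i _
      exact Integrable.smul_measure (integrable_dirac (by simp)) (by simp)

/-- The moment sequence `1, m₁, m₂, …` attached to a vector of moments. -/
def momentSeq {N : ℕ} (m : Fin N → ℝ) : ℕ → ℝ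
  | 0 => 1
  | j + 1 => finExt m j

theorem momentSeq_succ {N : ℕ} (m : Fin N → ℝ) (k : Fin N) : momentSeq m (k + 1) = m k :=
  finExt_apply m k

theorem continuous_momentSeq {N : ℕ} (j : ℕ) :
    Continuous fun m : Fin N → ℝ => momentSeq m j := by
  cases j with
  | zero => exact continuous_const
  | succ j =>
    simp only [momentSeq, finExt]
    split_ifs <;> fun_prop

theorem momentSeq_affine {N : ℕ} {s t : ℝ} (hst : s + t = 1) (m g : Fin N → ℝ) (j : ℕ) :
    momentSeq (s • m + t • g) j = s * momentSeq m j + t * momentSeq g j := by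
  cases j with
  | zero => simp [momentSeq, hst]
  | succ j =>
    simp only [momentSeq, finExt]
    split_ifs <;> simp

theorem hankel_congr {n : ℕ} {c d : ℕ → ℝ} (h : ∀ j ≤ 2 * n, c j = d j) :
    hankel (n + 1) c = hankel (n + 1) d := by
  ext i j
  exact h _ (by omega)

theorem eq_of_hankel_eq {n : ℕ} {c d : ℕ → ℝ} (h : hankel (n + 1) c = hankel (n + 1) d) {j : ℕ}
    (hj : j ≤ 2 * n) : c j = d j := by
  have := congrFun (congrFun h ⟨j / 2, by omega⟩) ⟨j - j / 2, by omega⟩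
  simpa [hankel, show j / 2 + (j - j / 2) = j by omega] using this

theorem hankel_momentSeq_eq {n : ℕ} {c : ℕ → ℝ} (hc : c 0 = 1) :
    hankel (n + 1) (momentSeq fun k : Fin (2 * n) => c (k + 1)) = hankel (n + 1) c := by
  refine hankel_congr fun j hj => ?_
  cases j with
  | zero => exact hc.symm
  | succ j => exact momentSeq_succ _ ⟨j, hj⟩

theorem hankel_isHermitian (N : ℕ) (c : ℕ → ℝ) : (hankel N c).IsHermitian := by
  ext i j
  simp [hankel, add_comm]

theorem dotProduct_hankel_mulVec {N : ℕ} (c : ℕ → ℝ) (x : Fin N → ℝ) :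
    x ⬝ᵥ hankel N c *ᵥ x = ∑ i, ∑ j, x i * x j * c (i + j) := by
  simp only [dotProduct, Matrix.mulVec, hankel, Matrix.of_apply, Finset.mul_sum]
  refine Finset.sum_congr rfl fun i _ => Finset.sum_congr rfl fun j _ => ?_
  ring

theorem posSemidef_hankel_of_mem_momentSpace {n : ℕ} {m : Fin (2 * n) → ℝ}
    (hm : m ∈ momentSpace Set.univ (2 * n)) : (hankel (n + 1) (momentSeq m)).PosSemidef := by
  obtain ⟨μ, hμ, -, hint, hmom⟩ := hm
  have hseq : ∀ j ≤ 2 * n, momentSeq m j = ∫ t, t ^ j ∂μ := by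
    intro j hj
    cases j with
    | zero => simp [momentSeq]
    | succ j => exact (momentSeq_succ m ⟨j, hj⟩).trans (hmom ⟨j, hj⟩)
  rw [hankel_congr hseq]
  refine .of_dotProduct_mulVec_nonneg (hankel_isHermitian _ _) fun x => ?_
  rw [star_trivial, dotProduct_hankel_mulVec]
  have : ∑ i, ∑ j, x i * x j * ∫ t, t ^ ((i : ℕ) + j) ∂μ
      = ∫ t, (∑ i : Fin (n + 1), x i * t ^ (i : ℕ)) ^ 2 ∂μ := by
    simp_rw [sq, Finset.sum_mul_sum]
    rw [integral_finsetSum]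
    · refine Finset.sum_congr rfl fun i _ => ?_
      rw [integral_finsetSum]
      · refine Finset.sum_congr rfl fun j _ => ?_
        rw [← integral_const_mul]
        congr 1 with t
        ring
      · intro j _
        refine ((hint (i + j)).const_mul (x i * x j)).congr (.of_forall fun t => ?_)
        simp only
        ring
    · intro i _
      refine integrable_finsetSum _ fun j _ => ?_
      refine ((hint (i + j)).const_mul (x i * x j)).congr (.of_forall fun t => ?_)
      simp only
      ring
  rw [this]
  exact integral_nonneg fun t => sq_nonneg _

theorem isOpen_setOf_posDef_hankel (N M : ℕ) :
    IsOpen {m : Fin M → ℝ | (hankel N (momentSeq m)).PosDef} := by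
  rw [isOpen_iff_mem_nhds]
  intro m hm
  have hcont : Continuous fun z : (Fin M → ℝ) × (Fin N → ℝ) =>
      z.2 ⬝ᵥ hankel N (momentSeq z.1) *ᵥ z.2 := by
    simp only [dotProduct_hankel_mulVec]
    refine continuous_finsetSum _ fun i _ => continuous_finsetSum _ fun j _ => ?_
    have := (continuous_momentSeq (N := M) (i + j)).comp
      (continuous_fst (X := Fin M → ℝ) (Y := Fin N → ℝ))
    exact Continuous.mul (by fun_prop) this
  have hev : ∀ᶠ m' in 𝓝 m, ∀ x ∈ Metric.sphere (0 : Fin N → ℝ) 1,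
      0 < x ⬝ᵥ hankel N (momentSeq m') *ᵥ x := by
    refine (isCompact_sphere _ _).eventually_forall_of_forall_eventually fun x hx => ?_
    refine hcont.continuousAt.eventually (lt_mem_nhds ?_)
    simpa using hm.dotProduct_mulVec_pos (ne_zero_of_mem_unit_sphere ⟨x, hx⟩)
  filter_upwards [hev] with m' hm'
  refine Matrix.PosDef.of_dotProduct_mulVec_pos (hankel_isHermitian _ _) fun x hx => ?_
  have hx' := norm_pos_iff.2 hx
  have := hm' (‖x‖⁻¹ • x) (by simp [norm_smul, hx'.ne'])
  rw [Matrix.mulVec_smul, dotProduct_smul, smul_dotProduct, smul_smul, smul_eq_mul] at this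
  rw [star_trivial]
  exact pos_of_mul_pos_right this (by positivity)

/-- A point of the interior of the moment space has a positive definite Hankel matrix as soon as
some vector does. -/
theorem posDef_hankel_of_mem_interior {n : ℕ} {m g : Fin (2 * n) → ℝ}
    (hg : (hankel (n + 1) (momentSeq g)).PosDef)
    (hm : m ∈ interior (momentSpace Set.univ (2 * n))) :
    (hankel (n + 1) (momentSeq m)).PosDef := by
  have hcont : ContinuousAt (fun ε : ℝ => (1 + ε) • m + (-ε) • g) 0 := by fun_prop
  have hev : ∀ᶠ ε in 𝓝 (0 : ℝ), (1 + ε) • m + (-ε) • g ∈ momentSpace Set.univ (2 * n) :=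
    hcont.eventually (by simpa using mem_interior_iff_mem_nhds.1 hm)
  obtain ⟨ε, hε, hε0 : 0 < ε⟩ := ((hev.filter_mono nhdsWithin_le_nhds).and
    (self_mem_nhdsWithin : Set.Ioi (0 : ℝ) ∈ 𝓝[>] 0)).exists
  have h1 := Matrix.PosDef.posSemidef_add (posSemidef_hankel_of_mem_momentSpace hε) (hg.smul hε0)
  have h2 : hankel (n + 1) (momentSeq m) = (1 + ε)⁻¹ •
      (hankel (n + 1) (momentSeq ((1 + ε) • m + (-ε) • g)) +
        ε • hankel (n + 1) (momentSeq g)) := by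
    ext i j
    simp only [hankel, Matrix.smul_apply, Matrix.add_apply, Matrix.of_apply, smul_eq_mul]
    rw [momentSeq_affine (by ring)]
    field_simp
    ring
  rw [h2]
  exact Matrix.PosDef.smul h1 (by positivity)

theorem jacobiT_moments_mem_momentSpace {N : ℕ} (a b : ℕ → ℝ) (M : ℕ) :
    (fun k : Fin M => (jacobiT N a b ^ ((k : ℕ) + 1)) 0 0) ∈ momentSpace Set.univ M := by
  have hT : (jacobiT N a b).IsHermitian := by
    rw [Matrix.IsHermitian, Matrix.conjTranspose_eq_transpose_of_trivial]
    exact jacobiT_isSymm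
  obtain ⟨w, x, hw, h⟩ := hT.exists_pow_apply_self_eq_sum 0
  simp_rw [h]
  exact sum_weights_mem_momentSpace hw (by simpa using (h 0).symm) M

theorem finExt_pos {n : ℕ} {v : Fin n → ℝ} (hv : ∀ i, 0 < v i) : ∀ i < n, 0 < finExt v i :=
  fun i hi => (finExt_apply v ⟨i, hi⟩).symm ▸ hv ⟨i, hi⟩

theorem posDef_hankel_momentSeq_jacobiT {n : ℕ} {a b : ℕ → ℝ} (hb : ∀ i < n, 0 < b i) :
    (hankel (n + 1)
      (momentSeq fun k : Fin (2 * n) => (jacobiT n a b ^ ((k : ℕ) + 1)) 0 0)).PosDef := by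
  rw [hankel_momentSeq_eq (c := fun j => (jacobiT n a b ^ j) 0 0) (by simp)]
  exact posDef_hankel_jacobiT hb

theorem interior_momentSpace_eq (n : ℕ) :
    interior (momentSpace Set.univ (2 * n)) =
      {m : Fin (2 * n) → ℝ | (hankel (n + 1) (momentSeq m)).PosDef} := by
  refine Set.Subset.antisymm (fun m hm => ?_)
    (interior_maximal (fun m hm => ?_) (isOpen_setOf_posDef_hankel _ _))
  · exact posDef_hankel_of_mem_interior
      (posDef_hankel_momentSeq_jacobiT (a := 0) (b := 1) fun _ _ => one_pos) hm
  · obtain ⟨a, b, -, hab⟩ := exists_jacobiT_of_posDef_hankel rfl hm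
    convert jacobiT_moments_mem_momentSpace (N := n) (finExt a) (finExt b) (2 * n) with k
    exact (momentSeq_succ m k).symm.trans (eq_of_hankel_eq hab (by omega)).symm

/-- The map `φ_{2n}` sending recursion coefficients
`(α_1,β_1,…,α_n,β_n) ∈ (ℝ × (0,∞))^n` to the first `2n` Jacobi-matrix moments
`((T)_{11}, …, (T^{2n})_{11})`, with `T` the `(n+1) × (n+1)` symmetric tridiagonal matrix
with diagonal `(α_1,…,α_n,0)` and off-diagonal `(√β_1,…,√β_n)`, is a bijection onto the
interior of the moment space `M_{2n}(ℝ)`. -/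
theorem statement6 (n : ℕ) (hn : 1 ≤ n) :
    Set.BijOn
      (fun p : (Fin n → ℝ) × (Fin n → ℝ) =>
        fun k : Fin (2 * n) => ((jacobiT n (finExt p.1) (finExt p.2)) ^ ((k : ℕ) + 1)) 0 0)
      {p : (Fin n → ℝ) × (Fin n → ℝ) | ∀ i, 0 < p.2 i}
      (interior (momentSpace Set.univ (2 * n))) := by
  rw [interior_momentSpace_eq]
  refine ⟨fun p hp => posDef_hankel_momentSeq_jacobiT (finExt_pos hp), ?_, fun m hm => ?_⟩
  · rintro ⟨a, b⟩ hb ⟨a', b'⟩ hb' h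
    have hb : ∀ i, 0 < b i := hb
    have hb' : ∀ i, 0 < b' i := hb'
    have hH : (hankel (n + 1) fun j => (jacobiT n (finExt a) (finExt b) ^ j) 0 0) =
        hankel (n + 1) fun j => (jacobiT n (finExt a') (finExt b') ^ j) 0 0 := by
      refine hankel_congr fun j hj => ?_
      cases j with
      | zero => simp
      | succ j => exact congrFun h ⟨j, hj⟩
    have key := jacobiT_apply_eq_of_hankel_eq (finExt_pos hb) (finExt_pos hb') hH
    refine Prod.ext (funext fun i => ?_) (funext fun i => ?_)
    · simpa [jacobiT_apply_self, finExt_apply] using key i.castSucc i.castSucc i.2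
    · have hi := key i.succ i.castSucc i.2
      rw [jacobiT_apply_succ (by simp), jacobiT_apply_succ (by simp), Fin.val_castSucc,
        finExt_apply, finExt_apply] at hi
      exact (Real.sqrt_inj (hb i).le (hb' i).le).1 hi
  · obtain ⟨a, b, hb, hab⟩ := exists_jacobiT_of_posDef_hankel rfl hm
    refine ⟨(a, b), hb, funext fun k => ?_⟩
    exact (eq_of_hankel_eq hab (by omega)).trans (momentSeq_succ m k)

end
end
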